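/- arXiv:1409.1079 — 10 statements merged into one kernel-verified Lean document; each statement's English description precedes it below -/
import Mathlib

section
/- For every p ∈ ℂ, for Lebesgue-almost every α ∈ ℝ, the image of the line L_α(p) under exp ∘ exp is dense in ℂ; i.e. the complement of the set {α ∈ ℝ : closure((exp ∘ exp) '' L_α(p)) = ℂ} has Lebesgue measure zero. -/
open MeasureTheory Complex

/-- The non-horizontal line through `p` with direction `i + α`. -/
def lineThrough (p : ℂ) (α : ℝ) : Set ℂ :=
  {z : ℂ | ∃ t : ℝ, z = p + (t : ℂ) * (Complex.I + (α : ℂ))}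

open Filter Topology Metric ComplexConjugate

/-- The spiral `exp (L_α(p))` comes `ε`-close to `ζ` modulo `2πi`. -/
def SpiralApproaches (p ζ : ℂ) (ε α : ℝ) : Prop :=
  ∃ (t : ℝ) (m : ℤ), ‖exp (p + t * (I + α)) - (ζ + 2 * Real.pi * m * I)‖ < ε

theorem SpiralApproaches.conj_neg {p ζ : ℂ} {ε α : ℝ} (h : SpiralApproaches p ζ ε α) :
    SpiralApproaches (conj p) (conj ζ) ε (-α) := by
  obtain ⟨t, m, h⟩ := h
  refine ⟨-t, -m, ?_⟩
  rw [← Complex.norm_conj] at h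
  convert h using 2
  simp only [map_sub, map_add, map_mul, ← exp_conj, conj_ofReal, conj_I, map_ofNat,
    map_intCast]
  push_cast
  ring_nf

theorem norm_exp_line_sub_le {p : ℂ} {T R α v x V C : ℝ} (hT : 1 ≤ T) (hR : 1 ≤ R)
    (hp : exp (p + T * (I + α)) = I * R) (hv : |v| ≤ V)
    (hC : C = V + |x| * (1 + |α|) + |x| * V) (hCR : C ≤ R) :
    ‖exp (p + (T - x / R : ℝ) * (I + (α + v / (R * T) : ℝ))) - (x + I * (R + v - α * x))‖
      ≤ (C ^ 2 + C) / R := by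
  have hR0 : 0 < R := by linarith
  have hT0 : 0 < T := by linarith
  have hV : 0 ≤ V := (abs_nonneg v).trans hv
  have hRc : (R : ℂ) ≠ 0 := by exact_mod_cast hR0.ne'
  have hTc : (T : ℂ) ≠ 0 := by exact_mod_cast hT0.ne'
  set e : ℂ := x * v / (R * T) with he
  set h : ℂ := v - x * (I + α) - e with hh
  have hxv : |x| * |v| ≤ |x| * V := by gcongr
  have hxV : 0 ≤ |x| * V := by positivity
  have hxa : 0 ≤ |x| * (1 + |α|) := by positivity
  have e1 : ‖e‖ ≤ C / R := by
    simp only [he, norm_div, norm_mul, Complex.norm_real, Real.norm_eq_abs, abs_of_pos hR0,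
      abs_of_pos hT0]
    apply div_le_div₀ <;> nlinarith
  have e2 : ‖e‖ ≤ |x| * V := by
    simp only [he, norm_div, norm_mul, Complex.norm_real, Real.norm_eq_abs, abs_of_pos hR0,
      abs_of_pos hT0]
    refine (div_le_self (by positivity) ?_).trans hxv
    nlinarith
  have hh1 : ‖h‖ ≤ C := by
    calc ‖h‖ ≤ ‖(v : ℂ)‖ + ‖(x : ℂ) * (I + α)‖ + ‖e‖ :=
          (norm_sub_le _ _).trans <| by gcongr; exact norm_sub_le _ _
      _ ≤ V + |x| * (1 + |α|) + |x| * V := by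
          rw [norm_mul, Complex.norm_real, Complex.norm_real, Real.norm_eq_abs, Real.norm_eq_abs]
          gcongr
          exact (norm_add_le _ _).trans (by simp)
      _ = C := hC.symm
  have hhR : ‖h / R‖ ≤ C / R := by
    rw [norm_div, Complex.norm_real, Real.norm_eq_abs, abs_of_pos hR0]
    gcongr
  have hq : ‖exp (h / R) - 1 - h / R‖ ≤ (C / R) ^ 2 :=
    (norm_exp_sub_one_sub_id_le (hhR.trans ((div_le_one hR0).2 hCR))).trans (by gcongr)
  have key : exp (p + (T - x / R : ℝ) * (I + (α + v / (R * T) : ℝ))) - (x + I * (R + v - α * x))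
      = I * R * (exp (h / R) - 1 - h / R) - I * e := by
    have : p + (T - x / R : ℝ) * (I + (α + v / (R * T) : ℝ)) = p + T * (I + α) + h / R := by
      rw [hh, he]
      push_cast
      field_simp
      ring
    rw [this, exp_add, hp]
    have : I * R * (h / R) = I * h := by field_simp
    rw [mul_sub, mul_sub, this, hh]
    linear_combination -(x : ℂ) * I_sq
  rw [key]
  calc _ ≤ ‖I * R * (exp (h / R) - 1 - h / R)‖ + ‖I * e‖ := norm_sub_le _ _
    _ ≤ R * (C / R) ^ 2 + C / R := by
        simp only [norm_mul, norm_I, one_mul, Complex.norm_real, Real.norm_eq_abs, abs_of_pos hR0]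
        gcongr
    _ = (C ^ 2 + C) / R := by field_simp

theorem exp_line_eq_I_mul (p : ℂ) (α : ℝ) (k : ℕ) :
    exp (p + (Real.pi / 2 - p.im + 2 * Real.pi * k : ℝ) * (I + α))
      = I * (Real.exp (p.re + α * (Real.pi / 2 - p.im + 2 * Real.pi * k)) : ℝ) := by
  have : p + (Real.pi / 2 - p.im + 2 * Real.pi * k : ℝ) * (I + α)
      = (p.re + α * (Real.pi / 2 - p.im + 2 * Real.pi * k) : ℝ) + Real.pi / 2 * I
        + k * (2 * Real.pi * I) := by
    push_cast
    linear_combination -re_add_im p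
  rw [this, exp_add, exp_add, exp_nat_mul_two_pi_mul_I, exp_pi_div_two_mul_I, ofReal_exp]
  ring

theorem exists_closedBall_spiralApproaches (p ζ : ℂ) {ε α : ℝ} (hε : 0 < ε) (hα : 0 < α) :
    ∃ (w δ : ℕ → ℝ), Tendsto δ atTop (𝓝[>] 0) ∧
      (∀ᶠ k in atTop, α ∈ closedBall (w k) (4 * Real.pi / ε * δ k)) ∧
      ∀ᶠ k in atTop, ∀ β ∈ closedBall (w k) (δ k), SpiralApproaches p ζ ε β := by
  set T : ℕ → ℝ := fun k => Real.pi / 2 - p.im + 2 * Real.pi * k with hTdef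
  set R : ℕ → ℝ := fun k => Real.exp (p.re + α * T k) with hRdef
  have hT : Tendsto T atTop atTop :=
    tendsto_atTop_add_const_left _ _
      (tendsto_natCast_atTop_atTop.const_mul_atTop Real.two_pi_pos)
  have hR : Tendsto R atTop atTop :=
    Real.tendsto_exp_atTop.comp (tendsto_atTop_add_const_left _ _ (hT.const_mul_atTop hα))
  set v : ℕ → ℝ := fun k => toIcoMod Real.two_pi_pos 0 (ζ.im + α * ζ.re - R k) with hvdef
  set C : ℝ := (2 * Real.pi + ε) + |ζ.re| * (1 + |α|) + |ζ.re| * (2 * Real.pi + ε) with hC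
  have hv : ∀ k, 0 ≤ v k ∧ v k < 2 * Real.pi := fun k =>
    toIcoMod_mem_Ico' Real.two_pi_pos _
  have hT1 := hT.eventually_ge_atTop 1
  have hR1 := hR.eventually_ge_atTop 1
  refine ⟨fun k => α + v k / (R k * T k), fun k => ε / 2 / (R k * T k), ?_, ?_, ?_⟩
  · refine tendsto_nhdsWithin_iff.2 ⟨(hR.atTop_mul_atTop₀ hT).const_div_atTop _, ?_⟩
    filter_upwards [hT1, hR1] with k h1 h2
    have hpos : 0 < R k * T k := mul_pos (by linarith) (by linarith)
    exact div_pos (half_pos hε) hpos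
  · filter_upwards [hT1, hR1] with k h1 h2
    have hpos : 0 < R k * T k := mul_pos (by linarith) (by linarith)
    rw [mem_closedBall, Real.dist_eq, sub_add_cancel_left, abs_neg, abs_div, abs_of_pos hpos,
      abs_of_nonneg (hv k).1, ← mul_div_assoc]
    gcongr
    calc v k ≤ 2 * Real.pi := (hv k).2.le
      _ = 4 * Real.pi / ε * (ε / 2) := by field_simp; ring
  · have herr : ∀ᶠ k in atTop, (C ^ 2 + C) / R k < ε / 2 :=
      (hR.const_div_atTop _).eventually (gt_mem_nhds (by positivity))
    filter_upwards [hT1, hR1, hR.eventually_ge_atTop C, herr] with k h1 h2 h3 h4 β hβ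
    have hpos : 0 < R k * T k := mul_pos (by linarith) (by linarith)
    obtain ⟨u, rfl⟩ : ∃ u, β = α + u / (R k * T k) :=
      ⟨(β - α) * (R k * T k), by field_simp; ring⟩
    have hu : |u - v k| ≤ ε / 2 := by
      rw [mem_closedBall, Real.dist_eq, add_sub_add_left_eq_sub, ← sub_div, abs_div,
        abs_of_pos hpos] at hβ
      exact (div_le_div_iff_of_pos_right hpos).1 hβ
    have huV : |u| ≤ 2 * Real.pi + ε := by
      rw [abs_le] at hu ⊢
      constructor <;> linarith [hu.1, hu.2, (hv k).1, (hv k).2, Real.pi_pos]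
    have main := norm_exp_line_sub_le h1 h2 (exp_line_eq_I_mul p α k) huV hC h3
    have hm := self_sub_toIcoMod Real.two_pi_pos 0 (ζ.im + α * ζ.re - R k)
    set n := toIcoDiv Real.two_pi_pos 0 (ζ.im + α * ζ.re - R k)
    refine ⟨T k - ζ.re / R k, -n, ?_⟩
    have hm' : (ζ.im + α * ζ.re - R k - v k : ℂ) = n * (2 * Real.pi) := by
      rw [zsmul_eq_mul] at hm
      exact_mod_cast hm
    have hz : ζ + 2 * Real.pi * (-n : ℤ) * I
        = ζ.re + I * (R k + u - α * ζ.re) - I * (u - v k : ℝ) := by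
      conv_lhs => rw [← re_add_im ζ]
      push_cast
      linear_combination I * hm'
    rw [hz, ← sub_add]
    calc _ ≤ _ + ‖I * (u - v k : ℝ)‖ := norm_add_le _ _
      _ ≤ (C ^ 2 + C) / R k + ε / 2 := by
          gcongr
          rwa [norm_mul, norm_I, one_mul, Complex.norm_real]
      _ < ε := by linarith

theorem ae_spiralApproaches_of_pos (p ζ : ℂ) {ε : ℝ} (hε : 0 < ε) :
    ∀ᵐ α ∂(volume : Measure ℝ), 0 < α → SpiralApproaches p ζ ε α := by
  set S : Set ℝ := {α | ¬ SpiralApproaches p ζ ε α} with hS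
  have h : ∀ᵐ α ∂(volume : Measure ℝ).restrict S, α ∉ Set.Ioi (0 : ℝ) := by
    filter_upwards [IsUnifLocDoublingMeasure.ae_tendsto_measure_inter_div
      (volume : Measure ℝ) S (4 * Real.pi / ε)] with α hdens hα
    obtain ⟨w, δ, hδ, hmem, hball⟩ := exists_closedBall_spiralApproaches p ζ hε hα
    have hlim := hdens w δ hδ hmem
    have hzero : Tendsto (fun k => volume (S ∩ closedBall (w k) (δ k)) /
        volume (closedBall (w k) (δ k))) atTop (𝓝 0) := by
      refine tendsto_const_nhds.congr' ?_
      filter_upwards [hball] with k hk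
      have : S ∩ closedBall (w k) (δ k) = ∅ :=
        Set.eq_empty_of_forall_notMem fun β hβ => hβ.1 (hk β hβ.2)
      simp [this]
    exact zero_ne_one (tendsto_nhds_unique hzero hlim)
  rw [← measure_eq_zero_iff_ae_notMem, Measure.restrict_apply measurableSet_Ioi] at h
  filter_upwards [measure_eq_zero_iff_ae_notMem.1 h] with α hα hpos
  by_contra hn
  exact hα ⟨hpos, hn⟩

theorem ae_spiralApproaches (p ζ : ℂ) {ε : ℝ} (hε : 0 < ε) :
    ∀ᵐ α ∂(volume : Measure ℝ), SpiralApproaches p ζ ε α := by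
  have hneg := (Measure.measurePreserving_neg (volume : Measure ℝ)).quasiMeasurePreserving.ae
    (ae_spiralApproaches_of_pos (conj p) (conj ζ) hε)
  filter_upwards [ae_spiralApproaches_of_pos p ζ hε, hneg, Measure.ae_ne volume (0 : ℝ)]
    with α h1 h2 h0
  rcases lt_or_gt_of_ne h0 with h | h
  · simpa using (h2 (neg_pos.2 h)).conj_neg
  · exact h1 h

/-- For every `p ∈ ℂ`, for Lebesgue-almost every `α ∈ ℝ`, the image of the line
`L_α(p)` under `exp ∘ exp` is dense in `ℂ`. -/
theorem expexp_of_ae_line_dense (p : ℂ) :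
    ∀ᵐ α ∂(volume : Measure ℝ),
      closure ((fun z : ℂ => Complex.exp (Complex.exp z)) '' lineThrough p α)
        = Set.univ := by
  have h : ∀ᵐ α ∂(volume : Measure ℝ), ∀ n j : ℕ,
      SpiralApproaches p (TopologicalSpace.denseSeq ℂ n) (1 / ((j : ℝ) + 1)) α :=
    ae_all_iff.2 fun n => ae_all_iff.2 fun j => ae_spiralApproaches p _ (by positivity)
  filter_upwards [h] with α hα
  refine Set.eq_univ_of_univ_subset ?_
  rw [← (dense_compl_singleton (0 : ℂ)).closure_eq]
  refine closure_minimal (fun z hz => ?_) isClosed_closure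
  obtain ⟨ζ, rfl⟩ : ∃ ζ, exp ζ = z := ⟨log z, exp_log hz⟩
  rw [Metric.mem_closure_iff]
  intro r hr
  obtain ⟨δ, hδ, hcont⟩ := Metric.continuous_iff.1 continuous_exp ζ r hr
  obtain ⟨n, hn⟩ := (TopologicalSpace.denseRange_denseSeq ℂ).exists_dist_lt ζ (half_pos hδ)
  obtain ⟨j, hj⟩ := exists_nat_one_div_lt (half_pos hδ)
  obtain ⟨t, m, htm⟩ := hα n j
  refine ⟨_, ⟨_, ⟨t, rfl⟩, rfl⟩, ?_⟩
  have hperiod := exp_periodic.sub_int_mul_eq (x := exp (p + t * (I + α))) m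
  rw [dist_comm]
  simp only
  rw [← hperiod]
  apply hcont
  refine (dist_triangle_right _ _ (TopologicalSpace.denseSeq ℂ n)).trans_lt ?_
  have : dist (exp (p + t * (I + α)) - m * (2 * Real.pi * I)) (TopologicalSpace.denseSeq ℂ n)
      < δ / 2 := by
    rw [dist_eq_norm]
    refine lt_of_eq_of_lt ?_ (htm.trans hj)
    congr 1
    ring
  linarith
end

section
/- For every p ∈ ℂ, the set {α ∈ ℝ : closure((exp ∘ exp) '' L_α(p)) = ℂ} is residual in ℝ, i.e. it contains a countable intersection of open dense subsets of ℝ (equivalently, its complement is meagre). -/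
open Complex

open Filter Topology Bornology in
/-- If `t` stays within bounded distance of `L / α` while `L → ∞`, then `(L - a) / t → α`. -/
theorem tendsto_sub_div_of_abs_sub_div_le {ι : Type*} {l : Filter ι} {L t : ι → ℝ} {α C : ℝ}
    (hα : α ≠ 0) (hL : Tendsto L l atTop) (ht : ∀ i, |t i - L i / α| ≤ C) (a : ℝ) :
    Tendsto (fun i => (L i - a) / t i) l (𝓝 α) := by
  have hinv : Tendsto (fun i => (L i)⁻¹) l (𝓝 0) := tendsto_inv_atTop_zero.comp hL
  have herr : Tendsto (fun i => (t i - L i / α) * (L i)⁻¹) l (𝓝 0) :=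
    bdd_le_mul_tendsto_zero' C (Eventually.of_forall ht) hinv
  have hnum : Tendsto (fun i => 1 - a * (L i)⁻¹) l (𝓝 (1 - a * 0)) :=
    tendsto_const_nhds.sub (hinv.const_mul a)
  have hden : Tendsto (fun i => α⁻¹ + (t i - L i / α) * (L i)⁻¹) l (𝓝 (α⁻¹ + 0)) :=
    tendsto_const_nhds.add herr
  have hquot := hnum.div hden (by simpa using hα)
  simp only [mul_zero, sub_zero, add_zero, one_div, inv_inv] at hquot
  refine hquot.congr' ?_
  filter_upwards [hL.eventually_gt_atTop 0] with i hi
  have hi' : L i ≠ 0 := hi.ne'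
  have h1 : 1 - a * (L i)⁻¹ = (L i - a) * (L i)⁻¹ := by field_simp
  have h2 : α⁻¹ + (t i - L i / α) * (L i)⁻¹ = t i * (L i)⁻¹ := by field_simp; ring
  rw [Pi.div_apply, h1, h2, mul_div_mul_right _ _ (inv_ne_zero hi')]

/-- A nonzero `q` is the exponential of the point of the line with slope parameter `α` at time `t`,
when `t` and `α` match the argument and the modulus of `q`. -/
theorem exp_add_mul_I_add_eq {p q : ℂ} (hq : q ≠ 0) {t α : ℝ} {k : ℤ}
    (ht : t = q.arg + k * (2 * Real.pi) - p.im) (hα : t * α = Real.log ‖q‖ - p.re) :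
    exp (p + t * (I + α)) = q := by
  have h : p + t * (I + α) = log q + k * (2 * Real.pi * I) := by
    apply Complex.ext
    · simp [log_re, hα]
    · simp [log_im, ht]
  rw [h, exp_add, exp_int_mul_two_pi_mul_I, mul_one, exp_log hq]

open Filter Topology in
theorem dense_setOf_exp_exp_lineThrough_mem (p : ℂ) {U : Set ℂ} (hU : IsOpen U)
    (hne : U.Nonempty) :
    Dense {α : ℝ | ∃ t : ℝ, exp (exp (p + t * (I + α))) ∈ U} := by
  obtain ⟨w, hwU, hw⟩ : ∃ w ∈ U, w ≠ 0 := by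
    obtain ⟨w, hw0, hwU⟩ := (dense_compl_singleton (0 : ℂ)).exists_mem_open hU hne
    exact ⟨w, hwU, hw0⟩
  refine dense_closure.1 ((dense_compl_singleton (0 : ℝ)).mono fun α hα => ?_)
  have hα : α ≠ 0 := hα
  let q : ℕ → ℂ := fun n => log w + (n : ℤ) * (2 * Real.pi * I)
  let L : ℕ → ℝ := fun n => Real.log ‖q n‖
  let k : ℕ → ℤ := fun n => ⌊L n / α / (2 * Real.pi)⌋
  let t : ℕ → ℝ := fun n => (q n).arg + k n * (2 * Real.pi) - p.im
  have hqw (n : ℕ) : exp (q n) = w := by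
    simp only [q]
    rw [exp_add, exp_int_mul_two_pi_mul_I, mul_one, exp_log hw]
  have hqnorm : Tendsto (fun n => ‖q n‖) atTop atTop := by
    have him : Tendsto (fun n : ℕ => (log w).im + n * (2 * Real.pi)) atTop atTop :=
      tendsto_atTop_add_const_left _ _
        (tendsto_natCast_atTop_atTop.atTop_mul_const Real.two_pi_pos)
    refine tendsto_atTop_mono (fun n => ?_) him
    refine le_trans (le_of_eq ?_) ((le_abs_self _).trans (abs_im_le_norm (q n)))
    simp [q]
  have hL : Tendsto L atTop atTop := Real.tendsto_log_atTop.comp hqnorm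
  have ht (n : ℕ) : |t n - L n / α| ≤ Real.pi + 2 * Real.pi + |p.im| := by
    have h1 := Int.floor_le (L n / α / (2 * Real.pi))
    have h2 := (Int.lt_floor_add_one (L n / α / (2 * Real.pi))).le
    rw [le_div_iff₀ Real.two_pi_pos] at h1
    rw [div_le_iff₀ Real.two_pi_pos] at h2
    have h3 := abs_le.1 (abs_arg_le_pi (q n))
    have h4 := abs_le.1 (le_refl |p.im|)
    have h5 := Real.pi_pos
    simp only [t, k]
    rw [abs_le]
    constructor <;> linarith [h3.1, h3.2, h4.1, h4.2]
  have hlim := tendsto_sub_div_of_abs_sub_div_le hα hL ht p.re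
  refine mem_closure_of_tendsto hlim ?_
  filter_upwards [hlim.eventually_ne hα, hqnorm.eventually_gt_atTop 0] with n hn hqn
  have htn : t n ≠ 0 := fun h => hn (by rw [h, div_zero])
  refine ⟨t n, ?_⟩
  rw [exp_add_mul_I_add_eq (norm_pos_iff.1 hqn) (k := k n) rfl (mul_div_cancel₀ _ htn), hqw]
  exact hwU

theorem isOpen_setOf_exp_exp_lineThrough_mem (p : ℂ) {U : Set ℂ} (hU : IsOpen U) :
    IsOpen {α : ℝ | ∃ t : ℝ, exp (exp (p + t * (I + α))) ∈ U} := by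
  simp only [Set.ofPred_exists]
  exact isOpen_iUnion fun t => hU.preimage (by fun_prop)

/-- For every `p ∈ ℂ`, the set of `α ∈ ℝ` such that the image of `L_α(p)` under
`exp ∘ exp` is dense in `ℂ` is residual in `ℝ`. -/
theorem expexp_dense_residual (p : ℂ) :
    {α : ℝ | closure ((fun z : ℂ => Complex.exp (Complex.exp z)) '' lineThrough p α)
        = Set.univ} ∈ residual ℝ := by
  have hB := TopologicalSpace.isBasis_countableBasis ℂ
  have hres : ∀ᶠ α : ℝ in residual ℝ, ∀ U ∈ TopologicalSpace.countableBasis ℂ,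
      ∃ t : ℝ, exp (exp (p + t * (I + α))) ∈ U := by
    rw [eventually_countable_ball (TopologicalSpace.countable_countableBasis ℂ)]
    intro U hU
    exact residual_of_dense_open (isOpen_setOf_exp_exp_lineThrough_mem p (hB.isOpen hU))
      (dense_setOf_exp_exp_lineThrough_mem p (hB.isOpen hU)
        (TopologicalSpace.nonempty_of_mem_countableBasis hU))
  filter_upwards [hres] with α hα
  refine dense_iff_closure_eq.1 (hB.dense_iff.2 fun U hU _ => ?_)
  obtain ⟨t, ht⟩ := hα U hU
  exact ⟨_, ht, _, ⟨t, rfl⟩, rfl⟩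
end

section
/- For every p ∈ ℂ and every α ∈ ℝ with α ≠ 0, the image of the line L_α(p) under exp ∘ exp ∘ exp is dense in ℂ: closure({exp(exp(exp(z))) : z ∈ L_α(p)}) = ℂ. -/
open Complex

open Filter Topology

/-- An interval of length at least `4π` contains an even multiple of `π` and its successor. -/
theorem exists_int_mul_two_pi_mem_Icc {a b : ℝ} (h : a + 4 * Real.pi ≤ b) :
    ∃ k : ℤ, (k : ℝ) * (2 * Real.pi) ∈ Set.Icc a b ∧
      (k : ℝ) * (2 * Real.pi) + Real.pi ∈ Set.Icc a b := by
  have hpi := Real.pi_pos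
  refine ⟨⌈a / (2 * Real.pi)⌉, ?_⟩
  have h1 := Int.le_ceil (a / (2 * Real.pi))
  have h2 := Int.ceil_lt_add_one (a / (2 * Real.pi))
  rw [div_le_iff₀ (by positivity)] at h1
  rw [← sub_lt_iff_lt_add, lt_div_iff₀ (by positivity)] at h2
  refine ⟨⟨h1, ?_⟩, ?_, ?_⟩ <;> nlinarith

/-- If `Im w` varies by at least `4π` along a segment on which `exp (Re w) ≥ |a|`, then `exp ∘ w`
meets the vertical line `Re = a`. -/
theorem exists_exp_re_eq {w : ℝ → ℂ} (hw : Continuous w) {a δ : ℝ} (hδ : 0 ≤ δ)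
    (hre : ∀ τ ∈ Set.Icc 0 δ, |a| ≤ Real.exp (w τ).re)
    (him : 4 * Real.pi ≤ |(w δ).im - (w 0).im|) :
    ∃ τ ∈ Set.Icc 0 δ, (Complex.exp (w τ)).re = a := by
  have him_conn : ((fun τ => (w τ).im) '' Set.Icc 0 δ).OrdConnected :=
    (isPreconnected_Icc.image _ (by fun_prop)).ordConnected
  have hre_conn : ((fun τ => (Complex.exp (w τ)).re) '' Set.Icc 0 δ).OrdConnected :=
    (isPreconnected_Icc.image _ (by fun_prop)).ordConnected
  have hzero : (w 0).im ∈ (fun τ => (w τ).im) '' Set.Icc 0 δ := ⟨0, ⟨le_rfl, hδ⟩, rfl⟩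
  have hend : (w δ).im ∈ (fun τ => (w τ).im) '' Set.Icc 0 δ := ⟨δ, ⟨hδ, le_rfl⟩, rfl⟩
  obtain ⟨k, hk⟩ : ∃ k : ℤ, (k : ℝ) * (2 * Real.pi) ∈ (fun τ => (w τ).im) '' Set.Icc 0 δ ∧
      (k : ℝ) * (2 * Real.pi) + Real.pi ∈ (fun τ => (w τ).im) '' Set.Icc 0 δ := by
    rcases le_abs'.1 him with h | h
    · obtain ⟨k, h1, h2⟩ :=
        exists_int_mul_two_pi_mem_Icc (a := (w δ).im) (b := (w 0).im) (by linarith)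
      exact ⟨k, him_conn.out hend hzero h1, him_conn.out hend hzero h2⟩
    · obtain ⟨k, h1, h2⟩ :=
        exists_int_mul_two_pi_mem_Icc (a := (w 0).im) (b := (w δ).im) (by linarith)
      exact ⟨k, him_conn.out hzero hend h1, him_conn.out hzero hend h2⟩
  obtain ⟨⟨τ₁, hτ₁, h₁⟩, τ₂, hτ₂, h₂⟩ := hk
  simp only at h₁ h₂
  have e₁ : (Complex.exp (w τ₁)).re = Real.exp (w τ₁).re := by
    rw [Complex.exp_re, h₁, Real.cos_int_mul_two_pi, mul_one]
  have e₂ : (Complex.exp (w τ₂)).re = -Real.exp (w τ₂).re := by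
    rw [Complex.exp_re, h₂, Real.cos_add_pi, Real.cos_int_mul_two_pi]; ring
  refine hre_conn.out ⟨τ₂, hτ₂, rfl⟩ ⟨τ₁, hτ₁, rfl⟩ ⟨?_, ?_⟩
  · simp only [e₂]
    linarith [hre τ₂ hτ₂, neg_abs_le a]
  · simp only [e₁]
    exact (le_abs_self a).trans (hre τ₁ hτ₁)

/-- For a small time the spiral `exp (β τ)`, started in the direction `1`, changes the imaginary
part of its primitive `exp (β τ) / β`. -/
theorem im_exp_div_ne {β : ℂ} (him : β.im ≠ 0) {δ : ℝ} (hδ : 0 < δ)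
    (hδπ : |β.im| * δ < Real.pi) :
    (Complex.exp (β * (δ : ℝ)) / β).im ≠ (Complex.exp (β * (0 : ℝ)) / β).im := by
  have hβ : β ≠ 0 := by rintro rfl; simp at him
  intro heq
  have hd : ∀ τ : ℝ, HasDerivAt (fun τ : ℝ => (Complex.exp (β * (τ : ℝ)) / β).im)
      (Complex.exp (β * (τ : ℝ))).im τ := by
    intro τ
    have h1 : HasDerivAt (fun τ : ℝ => Complex.exp (β * (τ : ℝ)) / β)
        (Complex.exp (β * (τ : ℝ))) τ := by
      have := (((hasDerivAt_id τ).ofReal_comp.const_mul β).cexp).div_const β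
      simpa only [id, Complex.ofReal_one, mul_one, mul_div_cancel_right₀ _ hβ] using this
    exact Complex.imCLM.hasFDerivAt.comp_hasDerivAt τ h1
  obtain ⟨τ, hτ, h0⟩ := exists_hasDerivAt_eq_zero hδ
    (fun x _ => (hd x).continuousAt.continuousWithinAt) heq.symm (fun x _ => hd x)
  rw [Complex.exp_im] at h0
  have hsin : Real.sin (β.im * τ) = 0 := by
    have := (mul_eq_zero.1 h0).resolve_left (Real.exp_pos _).ne'
    simpa using this
  have hlt : |β.im * τ| < Real.pi := by
    rw [abs_mul, abs_of_pos hτ.1]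
    exact (mul_le_mul_of_nonneg_left hτ.2.le (abs_nonneg _)).trans_lt hδπ
  rw [abs_lt] at hlt
  have := (Real.sin_eq_zero_iff_of_lt_of_lt hlt.1 hlt.2).1 hsin
  exact mul_ne_zero him hτ.1.ne' this

/-- Along `z = p + T β` there are arbitrarily late times at which `exp z` moves almost in the
direction of the positive reals and `exp (exp z)` lies high on the line `Re = a`. -/
theorem exists_exp_exp_re_eq {β : ℂ} (hre : 0 < β.re) (him : β.im ≠ 0) (p : ℂ) (a M : ℝ)
    {ε : ℝ} (hε : 0 < ε) :
    ∃ T ρ : ℝ, ∃ z : ℂ, M ≤ ρ ∧ ‖z - 1‖ < ε ∧ β * Complex.exp (p + T * β) = ρ * z ∧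
      (Complex.exp (Complex.exp (p + T * β))).re = a ∧
      M ≤ |(Complex.exp (Complex.exp (p + T * β))).im| := by
  have hβ : β ≠ 0 := by rintro rfl; simp at him
  set m : ℝ := (β⁻¹).re / 2 with hm
  have hm0 : 0 < m := by
    rw [hm, Complex.inv_re]
    have := Complex.normSq_pos.2 hβ
    positivity
  have hclose : ∀ᶠ τ : ℝ in 𝓝 0, ‖Complex.exp (β * (τ : ℝ)) - 1‖ < ε ∧
      m < (Complex.exp (β * (τ : ℝ)) / β).re ∧ |β.im| * τ < Real.pi := by
    refine Eventually.and ?_ (Eventually.and ?_ ?_)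
    · exact ContinuousAt.eventually_lt (by fun_prop) continuousAt_const (by simpa using hε)
    · refine ContinuousAt.eventually_lt continuousAt_const (by fun_prop) ?_
      simp only [Complex.ofReal_zero, mul_zero, Complex.exp_zero, one_div]
      linarith
    · exact ContinuousAt.eventually_lt (by fun_prop) continuousAt_const
        (by simpa using Real.pi_pos)
  obtain ⟨r, hr, hball⟩ := Metric.eventually_nhds_iff.1 hclose
  set δ : ℝ := r / 2 with hδ
  have hδ0 : 0 < δ := by positivity
  have hnear : ∀ τ ∈ Set.Icc 0 δ, ‖Complex.exp (β * (τ : ℝ)) - 1‖ < ε ∧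
      m < (Complex.exp (β * (τ : ℝ)) / β).re ∧ |β.im| * τ < Real.pi := by
    intro τ hτ
    apply hball
    rw [Real.dist_eq, sub_zero, abs_of_nonneg hτ.1]
    linarith [hτ.2]
  set D : ℝ := |(Complex.exp (β * (δ : ℝ)) / β).im - (Complex.exp (β * (0 : ℝ)) / β).im| with hD
  have hD0 : 0 < D := abs_pos.2 (sub_ne_zero.2
    (im_exp_div_ne him hδ0 (hnear δ ⟨hδ0.le, le_rfl⟩).2.2))
  obtain ⟨q, hq⟩ : ∃ q : ℂ, β * Complex.exp p = Complex.exp q :=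
    ⟨Complex.log (β * Complex.exp p),
      (Complex.exp_log (mul_ne_zero hβ (Complex.exp_ne_zero p))).symm⟩
  set S : ℕ → ℝ := fun n => n * (2 * Real.pi / |β.im|) - q.im / β.im with hS
  have hST : Tendsto S atTop atTop := by
    refine tendsto_atTop_add_const_right _ _ (tendsto_natCast_atTop_atTop.atTop_mul_const ?_)
    have := abs_pos.2 him
    have := Real.pi_pos
    positivity
  have hET : Tendsto (fun n => Real.exp (q.re + S n * β.re)) atTop atTop :=
    Real.tendsto_exp_atTop.comp
      (tendsto_atTop_add_const_left _ _ (hST.atTop_mul_const hre))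
  obtain ⟨n, hn1, hn2, hn3⟩ := ((hET.eventually_ge_atTop M).and
    ((hET.eventually_ge_atTop (4 * Real.pi / D)).and
      (hET.eventually_ge_atTop ((|M| + |a|) / m)))).exists
  set E : ℝ := Real.exp (q.re + S n * β.re) with hE
  have hE0 : 0 < E := Real.exp_pos _
  have hturn : β * Complex.exp (p + S n * β) = E := by
    rw [Complex.exp_add, ← mul_assoc, hq, ← Complex.exp_add, hE, Complex.ofReal_exp]
    have key : ∃ k : ℤ, (q + S n * β).im = k * (2 * Real.pi) := by
      rcases lt_or_gt_of_ne him with h | h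
      · refine ⟨-n, ?_⟩
        simp only [hS, Complex.add_im, Complex.mul_im, Complex.ofReal_re, Complex.ofReal_im,
          abs_of_neg h]
        push_cast
        field_simp
        ring
      · refine ⟨n, ?_⟩
        simp only [hS, Complex.add_im, Complex.mul_im, Complex.ofReal_re, Complex.ofReal_im,
          abs_of_pos h]
        push_cast
        field_simp
        ring
    obtain ⟨k, hk⟩ := key
    refine Complex.exp_eq_exp_iff_exists_int.2 ⟨k, ?_⟩
    apply Complex.ext
    · simp
    · simpa using hk
  have hspiral : ∀ τ : ℝ, Complex.exp (p + ((S n + τ : ℝ) : ℂ) * β) =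
      E * (Complex.exp (β * (τ : ℝ)) / β) := by
    intro τ
    have : p + ((S n + τ : ℝ) : ℂ) * β = (p + S n * β) + β * τ := by push_cast; ring
    rw [this, Complex.exp_add, ← hturn]
    field_simp
  have hlarge : ∀ τ ∈ Set.Icc 0 δ,
      |M| + |a| ≤ Real.exp (E * (Complex.exp (β * (τ : ℝ)) / β) : ℂ).re := by
    intro τ hτ
    rw [Complex.re_ofReal_mul]
    have h1 := (hnear τ hτ).2.1
    rw [div_le_iff₀ hm0] at hn3
    have h2 : E * m ≤ E * (Complex.exp (β * (τ : ℝ)) / β).re :=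
      mul_le_mul_of_nonneg_left h1.le hE0.le
    linarith [Real.add_one_le_exp (E * (Complex.exp (β * (τ : ℝ)) / β).re)]
  obtain ⟨τ, hτ, ha⟩ := exists_exp_re_eq
    (w := fun τ : ℝ => E * (Complex.exp (β * (τ : ℝ)) / β)) (a := a) (by fun_prop) hδ0.le
    (fun τ hτ => le_trans (by linarith [abs_nonneg M]) (hlarge τ hτ)) (by
      simp only [Complex.im_ofReal_mul]
      rw [← mul_sub, abs_mul, abs_of_pos hE0]
      exact (div_le_iff₀ hD0).1 hn2)
  refine ⟨S n + τ, E, Complex.exp (β * (τ : ℝ)), hn1, (hnear τ hτ).1, ?_, ?_, ?_⟩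
  · rw [hspiral]
    field_simp
  · rw [hspiral]
    exact ha
  · rw [hspiral]
    have h1 := Complex.norm_le_abs_re_add_abs_im
      (Complex.exp (E * (Complex.exp (β * (τ : ℝ)) / β)))
    rw [Complex.norm_exp, ha] at h1
    linarith [hlarge τ hτ, le_abs_self M]

/-- Linearization of `h ↦ v * exp (w * (exp h - 1))` for small `h`. -/
theorem norm_mul_exp_mul_exp_sub_one_sub_le {v w h : ℂ} (hh : ‖h‖ ≤ 1)
    (hk : 2 * (‖w‖ * ‖h‖) ≤ 1) :
    ‖v * Complex.exp (w * (Complex.exp h - 1)) - v - v * (w * h)‖ ≤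
      ‖v‖ * (4 * (‖w‖ * ‖h‖) ^ 2 + ‖w‖ * ‖h‖ ^ 2) := by
  set k := w * (Complex.exp h - 1) with hkdef
  have h1 : ‖k‖ ≤ 2 * (‖w‖ * ‖h‖) := by
    rw [hkdef, norm_mul]
    nlinarith [Complex.norm_exp_sub_one_le hh, norm_nonneg w]
  have h2 : ‖Complex.exp k - 1 - k‖ ≤ ‖k‖ ^ 2 :=
    Complex.norm_exp_sub_one_sub_id_le (h1.trans hk)
  have h3 : ‖k - w * h‖ ≤ ‖w‖ * ‖h‖ ^ 2 := by
    have : k - w * h = w * (Complex.exp h - 1 - h) := by rw [hkdef]; ring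
    rw [this, norm_mul]
    exact mul_le_mul_of_nonneg_left (Complex.norm_exp_sub_one_sub_id_le hh) (norm_nonneg _)
  have h4 : v * Complex.exp k - v - v * (w * h) =
      v * ((Complex.exp k - 1 - k) + (k - w * h)) := by ring
  rw [h4, norm_mul]
  refine mul_le_mul_of_nonneg_left ((norm_add_le _ _).trans (add_le_add (h2.trans ?_) h3))
    (norm_nonneg _)
  nlinarith [norm_nonneg k]

/-- High up near the line `Re = a`, the curve `exp (exp (p + T β))` contains an almost vertical
segment of length `2π`. -/
theorem exists_exp_exp_near {β : ℂ} (hre : 0 < β.re) (him : β.im ≠ 0) (p u : ℂ)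
    {ε : ℝ} (hε : 0 < ε) :
    ∃ T : ℝ, ∃ k : ℤ,
      ‖Complex.exp (Complex.exp (p + T * β)) - (u + k * (2 * Real.pi * Complex.I))‖ < ε := by
  have hβ : 0 ≤ ‖β‖ := norm_nonneg β
  set K : ℝ := 3200 + 400 * ‖β‖ + 14 * |u.re| with hK
  set M : ℝ := K / (ε / 2) + K + 1 with hM
  have hK0 : 0 < K := by positivity
  have hMK : K / M < ε / 2 := by
    rw [div_lt_iff₀ (by positivity), hM]
    have : ε / 2 * (K / (ε / 2)) = K := by field_simp
    nlinarith
  have hMK' : K + 1 ≤ M := by rw [hM]; linarith [show 0 < K / (ε / 2) by positivity]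
  have hM0 : 0 < M := by linarith
  obtain ⟨T, ρ, z, hρ, hz, hw, ha, hI⟩ := exists_exp_exp_re_eq hre him p u.re M
    (ε := min 1 (ε / 14)) (by positivity)
  obtain ⟨hz1, hz2⟩ := lt_min_iff.1 hz
  set w := Complex.exp (p + T * β) with hwdef
  set v := Complex.exp w with hvdef
  have hI0 : 0 < |v.im| := hM0.trans_le hI
  have hIne : v.im ≠ 0 := abs_pos.1 hI0
  have hρ0 : 0 < ρ := hM0.trans_le hρ
  obtain ⟨r, ⟨hr0, hr7⟩, k, hk⟩ : ∃ r ∈ Set.Icc (0 : ℝ) 7, ∃ k : ℤ,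
      v.im + r = u.im + k * (2 * Real.pi) := by
    have hpi : 0 < 2 * Real.pi := by positivity
    refine ⟨toIcoMod hpi 0 (u.im - v.im), ⟨left_le_toIcoMod _ _ _, ?_⟩,
      -toIcoDiv hpi 0 (u.im - v.im), ?_⟩
    · linarith [toIcoMod_lt_right hpi 0 (u.im - v.im), Real.pi_lt_d2]
    · rw [toIcoMod]
      push_cast
      simp only [zsmul_eq_mul]
      ring
  have hznorm : ‖z‖ ≤ 2 := by
    have := norm_add_le (z - 1) 1
    rw [sub_add_cancel, norm_one] at this
    linarith
  set s : ℝ := r / (ρ * v.im) with hs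
  have hwh : w * (β * s) = z * r / v.im := by
    rw [← mul_assoc, mul_comm w, hw, hs]
    push_cast
    have : (ρ : ℂ) ≠ 0 := by exact_mod_cast hρ0.ne'
    have : (v.im : ℂ) ≠ 0 := by exact_mod_cast hIne
    field_simp
  have hwhn : ‖w‖ * ‖β * (s : ℂ)‖ ≤ 14 / |v.im| := by
    rw [← norm_mul, hwh, norm_div, norm_mul, Complex.norm_real, Complex.norm_real,
      Real.norm_eq_abs, Real.norm_eq_abs, abs_of_nonneg hr0]
    gcongr
    nlinarith [norm_nonneg z]
  have hhn : ‖β * (s : ℂ)‖ ≤ 7 * ‖β‖ / (M * |v.im|) := by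
    rw [norm_mul, Complex.norm_real, hs, Real.norm_eq_abs, abs_div, abs_mul, abs_of_nonneg hr0,
      abs_of_pos hρ0, ← mul_div_assoc, mul_comm ‖β‖]
    gcongr
  have hKβ : 400 * ‖β‖ ≤ M := by linarith [abs_nonneg u.re]
  have hM3200 : 3200 ≤ M := by linarith [abs_nonneg u.re]
  have hhn' : ‖β * (s : ℂ)‖ ≤ 7 * ‖β‖ / M := by
    refine hhn.trans ?_
    gcongr
    nlinarith
  have hh1 : ‖β * (s : ℂ)‖ ≤ 1 := by
    refine hhn'.trans ?_
    rw [div_le_one hM0]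
    linarith
  have hk1 : 2 * (‖w‖ * ‖β * (s : ℂ)‖) ≤ 1 := by
    have : 14 / |v.im| ≤ 1 / 2 := by
      rw [div_le_div_iff₀ hI0 two_pos]
      linarith
    linarith
  have hvn : ‖v‖ ≤ 2 * |v.im| := by
    have := Complex.norm_le_abs_re_add_abs_im v
    rw [ha] at this
    linarith
  have hlin := norm_mul_exp_mul_exp_sub_one_sub_le (v := v) hh1 hk1
  have herr : ‖v‖ * (4 * (‖w‖ * ‖β * (s : ℂ)‖) ^ 2 + ‖w‖ * ‖β * (s : ℂ)‖ ^ 2) ≤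
      (3200 + 400 * ‖β‖) / M := by
    calc ‖v‖ * (4 * (‖w‖ * ‖β * (s : ℂ)‖) ^ 2 + ‖w‖ * ‖β * (s : ℂ)‖ ^ 2)
        = ‖v‖ * ((‖w‖ * ‖β * (s : ℂ)‖) * (4 * (‖w‖ * ‖β * (s : ℂ)‖) + ‖β * (s : ℂ)‖)) := by ring
      _ ≤ (2 * |v.im|) * ((14 / |v.im|) * (4 * (14 / |v.im|) + 7 * ‖β‖ / M)) := by gcongr
      _ = 28 * (56 / |v.im| + 7 * ‖β‖ / M) := by field_simp; ring
      _ ≤ 28 * (56 / M + 7 * ‖β‖ / M) := by gcongr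
      _ ≤ (3200 + 400 * ‖β‖) / M := by
        rw [← add_div, ← mul_div_assoc]
        gcongr
        linarith
  have hdir : ‖v * (w * (β * s)) - r * Complex.I‖ ≤ 7 * (ε / 14) + 14 * |u.re| / M := by
    have hv : v = u.re + v.im * Complex.I := by rw [← ha]; exact (Complex.re_add_im v).symm
    have hc : (v.im : ℂ) ≠ 0 := by exact_mod_cast hIne
    have : v * (w * (β * s)) - r * Complex.I =
        r * ((z - 1) * Complex.I) + r * (z * (u.re / v.im)) := by
      rw [hwh]
      nth_rewrite 1 [hv]
      field_simp
      ring
    rw [this]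
    refine (norm_add_le _ _).trans (add_le_add ?_ ?_)
    · rw [norm_mul, norm_mul, Complex.norm_I, mul_one, Complex.norm_real, Real.norm_eq_abs,
        abs_of_nonneg hr0]
      gcongr
    · rw [norm_mul, norm_mul, norm_div, Complex.norm_real, Complex.norm_real, Complex.norm_real,
        Real.norm_eq_abs, Real.norm_eq_abs, Real.norm_eq_abs, abs_of_nonneg hr0]
      calc r * (‖z‖ * (|u.re| / |v.im|)) ≤ 7 * (2 * (|u.re| / M)) := by gcongr
        _ = 14 * |u.re| / M := by ring
  refine ⟨T + s, k, ?_⟩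
  have hmove : Complex.exp (Complex.exp (p + ((T + s : ℝ) : ℂ) * β)) =
      v * Complex.exp (w * (Complex.exp (β * s) - 1)) := by
    have : p + ((T + s : ℝ) : ℂ) * β = (p + T * β) + β * s := by push_cast; ring
    rw [this, hvdef, ← Complex.exp_add w, Complex.exp_add _ (β * s), ← hwdef]
    congr 1
    ring
  have htarget : u + k * (2 * Real.pi * Complex.I) = v + r * Complex.I := by
    apply Complex.ext
    · simp [ha]
    · simpa using hk.symm
  rw [hmove, htarget]
  have hsplit : v * Complex.exp (w * (Complex.exp (β * s) - 1)) - (v + r * Complex.I) =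
      (v * Complex.exp (w * (Complex.exp (β * s) - 1)) - v - v * (w * (β * s))) +
      (v * (w * (β * s)) - r * Complex.I) := by ring
  rw [hsplit]
  refine (norm_add_le _ _).trans_lt ?_
  have hsum : (3200 + 400 * ‖β‖) / M + 14 * |u.re| / M = K / M := by rw [← add_div]
  linarith

/-- The image of an oblique line under `exp ∘ exp ∘ exp` is dense in `ℂ`. -/
theorem expexpexp_oblique_line_dense (p : ℂ) (α : ℝ) (hα : α ≠ 0) :
    closure ((fun z : ℂ => Complex.exp (Complex.exp (Complex.exp z))) ''
        lineThrough p α) = Set.univ := by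
  set S := (fun z : ℂ => Complex.exp (Complex.exp (Complex.exp z))) '' lineThrough p α
  obtain ⟨κ, hκ⟩ : ∃ κ : ℝ, 0 < κ * α := ⟨α, mul_self_pos.2 hα⟩
  have hκ0 : κ ≠ 0 := left_ne_zero_of_mul hκ.ne'
  have hexp : ∀ u : ℂ, Complex.exp u ∈ closure S := by
    intro u
    have hu : u ∈ closure {v | Complex.exp v ∈ S} := by
      refine Metric.mem_closure_iff.2 fun ε hε => ?_
      obtain ⟨T, k, h⟩ := exists_exp_exp_near (β := κ * (Complex.I + α))
        (by simpa using hκ) (by simpa using hκ0) p u hε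
      refine ⟨Complex.exp (Complex.exp (p + T * (κ * (Complex.I + α)))) -
        k * (2 * Real.pi * Complex.I), ?_, ?_⟩
      · rw [Set.mem_ofPred_eq, Complex.exp_periodic.sub_int_mul_eq]
        exact ⟨_, ⟨T * κ, by push_cast; ring⟩, rfl⟩
      · rw [dist_comm, dist_eq_norm, sub_sub, add_comm _ u]
        exact h
    exact map_mem_closure Complex.continuous_exp hu fun _ h => h
  have hcompl : ({0}ᶜ : Set ℂ) ⊆ closure S := fun u hu => by
    simpa [Complex.exp_log hu] using hexp (Complex.log u)
  refine Set.eq_univ_of_univ_subset ?_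
  rw [← (dense_compl_singleton (0 : ℂ)).closure_eq]
  exact closure_minimal hcompl isClosed_closure
end

section
/- Let a ∈ (0,1) be a real number with the property that for every finite string (s_1,…,s_m) of binary digits there is a position in the binary expansion of a at which the digits s_1,…,s_m occur consecutively. Let p := log(2πa) + (π/2)i and α := (log 2)/(2π). Then the image of the line L_α(p) under exp ∘ exp is dense in ℂ. -/
open Complex Real

/-- The real number with binary digits `e`. -/
noncomputable def binaryValue (e : ℕ → ℕ) : ℝ := ∑' k : ℕ, (e k : ℝ) / 2 ^ (k + 1)

theorem summable_binary {e : ℕ → ℕ} (he : ∀ k, e k = 0 ∨ e k = 1) :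
    Summable fun k : ℕ => (e k : ℝ) / 2 ^ (k + 1) := by
  refine Summable.of_nonneg_of_le (fun k => by positivity) (fun k => ?_)
    (summable_geometric_two' 1)
  have h : (e k : ℝ) ≤ 1 := by rcases he k with h | h <;> simp [h]
  rw [pow_succ', ← div_div]
  gcongr

theorem binaryValue_mem_Icc {e : ℕ → ℕ} (he : ∀ k, e k = 0 ∨ e k = 1) :
    binaryValue e ∈ Set.Icc (0 : ℝ) 1 := by
  refine ⟨tsum_nonneg fun k => by positivity, ?_⟩
  rw [← tsum_geometric_two' 1]
  refine (summable_binary he).tsum_le_tsum (fun k => ?_) (summable_geometric_two' 1)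
  have h : (e k : ℝ) ≤ 1 := by rcases he k with h | h <;> simp [h]
  rw [pow_succ', ← div_div]
  gcongr

theorem two_mul_binaryValue {e : ℕ → ℕ} (he : ∀ k, e k = 0 ∨ e k = 1) :
    2 * binaryValue e = e 0 + binaryValue fun k => e (k + 1) := by
  have h : binaryValue e = (e 0 : ℝ) / 2 ^ (0 + 1) + ∑' k : ℕ, (e (k + 1) : ℝ) / 2 ^ (k + 1 + 1) :=
    (summable_binary he).tsum_eq_zero_add
  rw [h, mul_add, ← tsum_mul_left, binaryValue]
  congr 1
  · ring
  · refine tsum_congr fun k => ?_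
    rw [pow_succ' _ (k + 1)]
    field_simp

/-- Multiplying by a power of two shifts the digits, up to an integer. -/
theorem exists_two_pow_mul_binaryValue {e : ℕ → ℕ} (he : ∀ k, e k = 0 ∨ e k = 1) (n : ℕ) :
    ∃ z : ℤ, 2 ^ n * binaryValue e = z + binaryValue fun k => e (n + k) := by
  induction n with
  | zero => exact ⟨0, by simp⟩
  | succ n ih =>
    obtain ⟨z, hz⟩ := ih
    refine ⟨2 * z + e n, ?_⟩
    have h := two_mul_binaryValue (e := fun k => e (n + k)) fun k => he _
    have h' : (fun k => e (n + 1 + k)) = fun k => e (n + (k + 1)) := by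
      funext k
      congr 1
      ring
    rw [h', pow_succ', mul_assoc, hz, mul_add, h]
    push_cast
    simp only [add_zero]
    ring

/-- Every point of the unit interval has a string of `m` binary digits that determines it up to
`2⁻ᵐ`. -/
theorem exists_digits_approx (m : ℕ) : ∀ x ∈ Set.Icc (0 : ℝ) 1,
    ∃ s : ℕ → ℕ, (∀ k, s k = 0 ∨ s k = 1) ∧ ∀ e : ℕ → ℕ, (∀ k, e k = 0 ∨ e k = 1) →
      (∀ i < m, e i = s i) → |binaryValue e - x| ≤ (1 / 2) ^ m := by
  induction m with
  | zero =>
    intro x hx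
    refine ⟨fun _ => 0, fun _ => Or.inl rfl, fun e he _ => ?_⟩
    have h := binaryValue_mem_Icc he
    rw [pow_zero, abs_le]
    constructor <;> linarith [h.1, h.2, hx.1, hx.2]
  | succ m ih =>
    intro x hx
    obtain ⟨b, hb, hbx⟩ : ∃ b : ℕ, (b = 0 ∨ b = 1) ∧ 2 * x - b ∈ Set.Icc (0 : ℝ) 1 := by
      rcases le_total x (1 / 2) with h | h
      · exact ⟨0, Or.inl rfl, by constructor <;> push_cast <;> linarith [hx.1]⟩
      · exact ⟨1, Or.inr rfl, by constructor <;> push_cast <;> linarith [hx.2]⟩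
    obtain ⟨s, hs, H⟩ := ih _ hbx
    refine ⟨fun k => Nat.casesOn k b s, fun k => ?_, fun e he hes => ?_⟩
    · cases k with
      | zero => exact hb
      | succ k => exact hs k
    · have h := H (fun k => e (k + 1)) (fun k => he _) fun i hi => hes (i + 1) (by omega)
      have h0 : e 0 = b := hes 0 (by omega)
      have h2 := two_mul_binaryValue he
      rw [h0] at h2
      rw [abs_le] at h ⊢
      rw [pow_succ]
      constructor <;> linarith [h.1, h.2]

/-- If every finite string occurs among the digits `d`, then the shifts of `d` approximate every
point of the unit interval arbitrarily far out. -/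
theorem exists_shift_approx {d : ℕ → ℕ} (hd : ∀ k, d k = 0 ∨ d k = 1)
    (hstrings : ∀ m : ℕ, ∀ s : Fin m → ℕ, (∀ i, s i = 0 ∨ s i = 1) →
      ∃ j : ℕ, ∀ i : Fin m, d (j + (i : ℕ)) = s i) {x : ℝ} (hx : x ∈ Set.Icc (0 : ℝ) 1) (m : ℕ) :
    ∃ n ≥ m, |binaryValue (fun k => d (n + k)) - x| ≤ (1 / 2) ^ m := by
  obtain ⟨s, hs, H⟩ := exists_digits_approx m x hx
  obtain ⟨j, hj⟩ := hstrings (m + m) (fun i => s (i - m)) fun i => hs _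
  refine ⟨j + m, by omega, H _ (fun k => hd _) fun i hi => ?_⟩
  have h := hj ⟨m + i, by omega⟩
  simpa [add_assoc] using h

open Filter Topology in
theorem tendsto_mul_exp_div_sub_one {c : ℕ → ℝ} (hc : Tendsto c atTop atTop) (b : ℂ) :
    Tendsto (fun m => (c m : ℂ) * (Complex.exp (b / c m) - 1)) atTop (𝓝 b) := by
  have h1 : HasDerivAt (fun y : ℂ => Complex.exp (b * y)) b 0 := by
    simpa using ((hasDerivAt_id (0 : ℂ)).const_mul b).cexp
  have h2 : Tendsto (fun m => ((c m : ℂ))⁻¹) atTop (𝓝[≠] 0) := by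
    rw [tendsto_nhdsWithin_iff]
    constructor
    · have h : Tendsto (fun m => ((c m)⁻¹ : ℝ)) atTop (𝓝 0) := tendsto_inv_atTop_zero.comp hc
      simpa [Function.comp_def] using (Complex.continuous_ofReal.tendsto 0).comp h
    · filter_upwards [hc.eventually_gt_atTop 0] with m hm
      simpa using hm.ne'
  simpa [Function.comp_def, div_eq_mul_inv] using h1.tendsto_slope_zero.comp h2

/-- The value of `exp ∘ exp` at the parameter `2πn - u / c`, where `c = 2πa2ⁿ`. -/
theorem exp_exp_line_eq {a : ℝ} (ha : 0 < a) (n : ℕ) (u : ℝ) :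
    Complex.exp (Real.log (2 * π * a) + (π / 2) * Complex.I +
        ((2 * π * n - u / (2 * π * a * 2 ^ n) : ℝ) : ℂ) *
          (Complex.I + ((Real.log 2 / (2 * π) : ℝ) : ℂ))) =
      ((2 * π * a * 2 ^ n : ℝ) : ℂ) * Complex.I *
        Complex.exp (-u * (Complex.I + ((Real.log 2 / (2 * π) : ℝ) : ℂ)) /
          ((2 * π * a * 2 ^ n : ℝ) : ℂ)) := by
  have hpos : 0 < 2 * π * a := by positivity
  have h1 : Complex.exp ((Real.log (2 * π * a) : ℝ) : ℂ) = ((2 * π * a : ℝ) : ℂ) := by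
    rw [← Complex.ofReal_exp, Real.exp_log hpos]
  have h2 : Complex.exp ((n : ℂ) * ((Real.log 2 : ℝ) : ℂ)) = 2 ^ n := by
    rw [Complex.exp_nat_mul, ← Complex.ofReal_exp, Real.exp_log two_pos]
    simp
  have hπ : (π : ℂ) ≠ 0 := Complex.ofReal_ne_zero.2 Real.pi_ne_zero
  have h3 : (Real.log (2 * π * a) : ℂ) + (π / 2) * Complex.I +
        ((2 * π * n - u / (2 * π * a * 2 ^ n) : ℝ) : ℂ) *
          (Complex.I + ((Real.log 2 / (2 * π) : ℝ) : ℂ)) =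
      ((Real.log (2 * π * a) : ℝ) : ℂ) + (π / 2) * Complex.I + (n : ℂ) * ((Real.log 2 : ℝ) : ℂ) +
        (n : ℂ) * (2 * π * Complex.I) + -u * (Complex.I + ((Real.log 2 / (2 * π) : ℝ) : ℂ)) /
          ((2 * π * a * 2 ^ n : ℝ) : ℂ) := by
    have h4 : ((Real.log 2 / (2 * π) : ℝ) : ℂ) * (2 * π) = ((Real.log 2 : ℝ) : ℂ) := by
      push_cast
      field_simp
    rw [← h4, Complex.ofReal_sub, Complex.ofReal_div]
    push_cast
    ring
  rw [h3, Complex.exp_add, Complex.exp_add, Complex.exp_add, Complex.exp_add, h1, h2,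
    Complex.exp_pi_div_two_mul_I, Complex.exp_nat_mul_two_pi_mul_I]
  push_cast
  ring

open Filter Topology in
theorem exp_mem_closure_exp_exp_line {a : ℝ} (ha : 0 < a)
    {d : ℕ → ℕ} (hd : ∀ k, d k = 0 ∨ d k = 1) (hsum : a = binaryValue d)
    (hstrings : ∀ m : ℕ, ∀ s : Fin m → ℕ, (∀ i, s i = 0 ∨ s i = 1) →
      ∃ j : ℕ, ∀ i : Fin m, d (j + (i : ℕ)) = s i) (v : ℂ) :
    Complex.exp v ∈ closure ((fun z : ℂ => Complex.exp (Complex.exp z)) ''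
        lineThrough (Real.log (2 * π * a) + (π / 2) * Complex.I) (Real.log 2 / (2 * π))) := by
  set α : ℝ := Real.log 2 / (2 * π) with hα
  set y : ℝ := (v.im + v.re * α) / (2 * π) with hy
  have hx : Int.fract y ∈ Set.Icc (0 : ℝ) 1 := ⟨Int.fract_nonneg y, (Int.fract_lt_one y).le⟩
  choose n hn happrox using exists_shift_approx hd hstrings hx
  choose z hz using exists_two_pow_mul_binaryValue hd
  set c : ℕ → ℝ := fun m => 2 * π * a * 2 ^ n m with hc
  have hn_tendsto : Tendsto n atTop atTop := tendsto_atTop_mono hn tendsto_id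
  have hc_tendsto : Tendsto c atTop atTop :=
    ((tendsto_pow_atTop_atTop_of_one_lt one_lt_two).comp hn_tendsto).const_mul_atTop
      (by positivity)
  have hfract : Tendsto (fun m => binaryValue fun k => d (n m + k)) atTop (𝓝 (Int.fract y)) := by
    rw [tendsto_iff_dist_tendsto_zero]
    exact squeeze_zero (fun _ => dist_nonneg) happrox
      (tendsto_pow_atTop_nhds_zero_of_lt_one (by norm_num) (by norm_num))
  have hrot : Tendsto (fun m => Complex.exp (c m * Complex.I)) atTop
      (𝓝 (Complex.exp ((v.im + v.re * α) * Complex.I))) := by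
    have h1 : ∀ m, Complex.exp (c m * Complex.I) =
        Complex.exp (2 * π * Complex.I * (binaryValue fun k => d (n m + k) : ℝ)) := by
      intro m
      rw [Complex.exp_eq_exp_iff_exists_int]
      refine ⟨z (n m), ?_⟩
      have h : c m = 2 * π * (z (n m) + binaryValue fun k => d (n m + k)) := by
        rw [← hz, ← hsum, hc]
        ring
      rw [h]
      push_cast
      ring
    have h2 : Complex.exp ((v.im + v.re * α) * Complex.I) =
        Complex.exp (2 * π * Complex.I * (Int.fract y : ℝ)) := by
      rw [Complex.exp_eq_exp_iff_exists_int]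
      refine ⟨⌊y⌋, ?_⟩
      have h : v.im + v.re * α = 2 * π * (⌊y⌋ + Int.fract y) := by
        rw [Int.floor_add_fract, hy]
        field_simp
      rw [← Complex.ofReal_mul, ← Complex.ofReal_add, h]
      push_cast
      ring
    simp_rw [h1, h2]
    exact (((Complex.continuous_ofReal.tendsto _).comp hfract).const_mul _).cexp
  have hstretch := ((tendsto_mul_exp_div_sub_one hc_tendsto
    (-v.re * (Complex.I + α))).mul_const Complex.I).cexp
  have hlim := hstretch.mul hrot
  rw [← Complex.exp_add] at hlim
  have hv : -v.re * (Complex.I + α) * Complex.I + (v.im + v.re * α) * Complex.I = v := by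
    have h : -v.re * (Complex.I + α) * Complex.I + (v.im + v.re * α) * Complex.I =
        -(v.re * (Complex.I * Complex.I)) + v.im * Complex.I := by ring
    rw [h, Complex.I_mul_I, mul_neg_one, neg_neg, Complex.re_add_im]
  rw [hv] at hlim
  refine mem_closure_of_tendsto hlim (Eventually.of_forall fun m => ?_)
  refine ⟨_, ⟨2 * π * n m - v.re / c m, rfl⟩, ?_⟩
  beta_reduce
  rw [exp_exp_line_eq ha (n m) v.re, ← Complex.exp_add]
  congr 1
  ring

/-- If `a ∈ (0,1)` has a binary expansion containing every finite string of binary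
digits, `p = log (2πa) + (π/2)i` and `α = (log 2)/(2π)`, then the image of
`L_α(p)` under `exp ∘ exp` is dense in `ℂ`. -/
theorem expexp_explicit_line_dense (a : ℝ) (ha : a ∈ Set.Ioo (0 : ℝ) 1)
    (d : ℕ → ℕ) (hd : ∀ k, d k = 0 ∨ d k = 1)
    (hsum : a = ∑' k : ℕ, (d k : ℝ) / 2 ^ (k + 1))
    (hstrings : ∀ m : ℕ, ∀ s : Fin m → ℕ, (∀ i, s i = 0 ∨ s i = 1) →
      ∃ j : ℕ, ∀ i : Fin m, d (j + (i : ℕ)) = s i) :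
    closure ((fun z : ℂ => Complex.exp (Complex.exp z)) ''
        lineThrough (Real.log (2 * π * a) + (π / 2) * Complex.I)
          (Real.log 2 / (2 * π))) = Set.univ := by
  have h : ({0}ᶜ : Set ℂ) ⊆ closure ((fun z : ℂ => Complex.exp (Complex.exp z)) ''
      lineThrough (Real.log (2 * π * a) + (π / 2) * Complex.I) (Real.log 2 / (2 * π))) := by
    intro w hw
    rw [← Complex.exp_log hw]
    exact exp_mem_closure_exp_exp_line ha.1 hd hsum hstrings _
  exact ((dense_compl_singleton (0 : ℂ)).mono h).of_closure.closure_eq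
end

section
/- For every p ∈ ℂ and every nonempty open set X ⊆ ℝ, the set {α ∈ X : closure((exp ∘ exp) '' L_α(p)) ≠ ℂ} has Hausdorff dimension equal to 1. -/
open Complex

open scoped ENNReal NNReal

/-- A finite set of naturals whose elements pairwise differ by less than `N` has at most `N`
elements. -/
lemma card_le_of_forall_lt_add {s : Finset ℕ} {N : ℕ}
    (h : ∀ i ∈ s, ∀ j ∈ s, i ≤ j → j < i + N) : s.card ≤ N := by
  rcases s.eq_empty_or_nonempty with rfl | hs
  · simp
  · have hsub : s ⊆ Finset.Ico (s.min' hs) (s.min' hs + N) := fun j hj =>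
      Finset.mem_Ico.2 ⟨s.min'_le j hj, h _ (s.min'_mem hs) j hj (s.min'_le j hj)⟩
    simpa using Finset.card_le_card hsub

open Classical in
/-- The total `s`-weight of those sets `U n` that meet `[x, x + ℓ]`. -/
noncomputable def coverCost (U : ℕ → Set ℝ) (w : ℕ → ℝ) (s x ℓ : ℝ) : ℝ≥0∞ :=
  ∑' n, if (U n ∩ Set.Icc x (x + ℓ)).Nonempty then ENNReal.ofReal (w n ^ s) else 0

lemma ofReal_le_coverCost {U : ℕ → Set ℝ} {w : ℕ → ℝ} {s x ℓ : ℝ} {n : ℕ}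
    (hn : (U n ∩ Set.Icc x (x + ℓ)).Nonempty) :
    ENNReal.ofReal (w n ^ s) ≤ coverCost U w s x ℓ := by
  classical
  refine le_trans ?_ (ENNReal.le_tsum n)
  rw [if_pos hn]

lemma lt_length_of_coverCost_lt {U : ℕ → Set ℝ} {w : ℕ → ℝ} {s x ℓ c : ℝ} {n : ℕ}
    (hs : 0 < s) (hℓ : 0 < ℓ) (hc : c ≤ 1) (hw : 0 < w n)
    (hcost : coverCost U w s x ℓ < ENNReal.ofReal (c * ℓ ^ s))
    (hn : (U n ∩ Set.Icc x (x + ℓ)).Nonempty) : w n < ℓ := by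
  have h1 := (ofReal_le_coverCost (w := w) (s := s) hn).trans_lt hcost
  have h2 : w n ^ s < c * ℓ ^ s := (ENNReal.ofReal_lt_ofReal_iff_of_nonneg (by positivity)).1 h1
  have h3 : 0 < ℓ ^ s := by positivity
  exact (Real.rpow_lt_rpow_iff hw.le hℓ.le hs).1 (h2.trans_le (by nlinarith))

lemma add_two_mul_min_le {M : ℕ} {s w h : ℝ} (hs1 : s < 1) (hM : 0 < M)
    (hw : 0 < w) (hh : 0 < h) (hwh : w ≤ M * h) :
    (w / h + 2) * min (w ^ s) ((M : ℝ) ^ (s - 1) * h ^ s) ≤ 3 * w ^ s := by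
  have hM' : (0 : ℝ) < M := by exact_mod_cast hM
  have hws : 0 < w ^ s := by positivity
  rcases le_total w h with hle | hle
  · have : w / h ≤ 1 := (div_le_one hh).2 hle
    calc _ ≤ (1 + 2) * w ^ s := by gcongr; exact min_le_left _ _
      _ = 3 * w ^ s := by ring
  · have h1 : 1 ≤ w / h := (one_le_div hh).2 hle
    have h2 : w / h ≤ M := (div_le_iff₀ hh).2 hwh
    have h3 : (w / h) ^ (1 - s) ≤ (M : ℝ) ^ (1 - s) :=
      Real.rpow_le_rpow (by positivity) h2 (by linarith)
    have h4 : (M : ℝ) ^ (s - 1) * (M : ℝ) ^ (1 - s) = 1 := by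
      rw [← Real.rpow_add hM']; simp
    have h5 : (w / h) * h ^ s = w ^ s * (w / h) ^ (1 - s) := by
      rw [Real.rpow_sub (by positivity), Real.rpow_one, Real.div_rpow hw.le hh.le]
      field_simp
    calc _ ≤ (3 * (w / h)) * ((M : ℝ) ^ (s - 1) * h ^ s) := by
          gcongr
          · linarith
          · exact min_le_right _ _
      _ = 3 * w ^ s * ((M : ℝ) ^ (s - 1) * (w / h) ^ (1 - s)) := by
          linear_combination (3 * (M : ℝ) ^ (s - 1)) * h5
      _ ≤ 3 * w ^ s * ((M : ℝ) ^ (s - 1) * (M : ℝ) ^ (1 - s)) := by gcongr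
      _ = 3 * w ^ s := by rw [h4, mul_one]

/-- A set of diameter at most `w` meets at most `w / h + 2` consecutive intervals of length `h`. -/
lemma card_meet_le {V : Set ℝ} {w x h : ℝ} (hw : 0 < w) (hh : 0 < h)
    (hV : ∀ a ∈ V, ∀ b ∈ V, b - a ≤ w) {F : Finset ℕ}
    (hF : ∀ i ∈ F, (V ∩ Set.Icc (x + i * h) (x + i * h + h)).Nonempty) :
    (F.card : ℝ) ≤ w / h + 2 := by
  have : F.card ≤ ⌊w / h⌋₊ + 2 := by
    refine card_le_of_forall_lt_add fun i hi j hj hij => ?_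
    obtain ⟨a, haV, ha⟩ := hF i hi
    obtain ⟨b, hbV, hb⟩ := hF j hj
    have h1 := hV a haV b hbV
    have h2 : ((j : ℝ) - i - 1) ≤ w / h := by
      rw [le_div_iff₀ hh]
      linarith [ha.2, hb.1]
    by_contra hcon
    have h3 : ((⌊w / h⌋₊ + 1 : ℕ) : ℝ) ≤ (j : ℝ) - i - 1 := by
      have : ((i + (⌊w / h⌋₊ + 2) : ℕ) : ℝ) ≤ j := by exact_mod_cast not_lt.1 hcon
      push_cast at this ⊢
      linarith
    have h4 := Nat.lt_floor_add_one (w / h)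
    push_cast at h3
    linarith
  calc (F.card : ℝ) ≤ ((⌊w / h⌋₊ + 2 : ℕ) : ℝ) := by exact_mod_cast this
    _ ≤ w / h + 2 := by
      push_cast
      gcongr
      exact Nat.floor_le (by positivity)

/-- Among a family containing at least half of the `M` subintervals of `[x, x + M h]`, one inherits
the smallness of the covering cost. -/
lemma exists_coverCost_lt {U : ℕ → Set ℝ} {w : ℕ → ℝ} {s x h : ℝ} {M : ℕ}
    (hs0 : 0 < s) (hs1 : s < 1) (hM : 0 < M) (hM8 : (8 : ℝ) ≤ (M : ℝ) ^ (1 - s)) (hh : 0 < h)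
    (hw : ∀ n, 0 < w n) (hU : ∀ n, ∀ a ∈ U n, ∀ b ∈ U n, b - a ≤ w n)
    (hcost : coverCost U w s x (M * h) < ENNReal.ofReal ((M : ℝ) ^ (s - 1) * (M * h) ^ s))
    {G : Finset ℕ} (hGM : G ⊆ Finset.range M) (hG : M ≤ 2 * G.card) :
    ∃ i ∈ G, coverCost U w s (x + i * h) h < ENNReal.ofReal ((M : ℝ) ^ (s - 1) * h ^ s) := by
  classical
  by_contra! hcon
  have hM' : (0 : ℝ) < M := by exact_mod_cast hM
  set c : ℝ := (M : ℝ) ^ (s - 1) with hc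
  have hcpos : 0 < c := by positivity
  have hc1 : c ≤ 1 := by
    apply Real.rpow_le_one_of_one_le_of_nonpos
    · exact_mod_cast hM
    · linarith
  set meets : ℕ → ℕ → Prop := fun i n => (U n ∩ Set.Icc (x + i * h) (x + i * h + h)).Nonempty
    with hmeets
  set g : ℕ → ℝ := fun n => min (w n ^ s) (c * h ^ s) with hg
  have hgpos : ∀ n, 0 < g n := fun n => lt_min (Real.rpow_pos_of_pos (hw n) s) (by positivity)
  have hlow : ∀ i ∈ G, ENNReal.ofReal (c * h ^ s) ≤
      ∑' n, if meets i n then ENNReal.ofReal (g n) else 0 := by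
    intro i hi
    by_cases hbig : ∃ n, meets i n ∧ c * h ^ s ≤ w n ^ s
    · obtain ⟨n, hn, hle⟩ := hbig
      refine le_trans ?_ (ENNReal.le_tsum n)
      rw [if_pos hn, hg]
      simp only [min_eq_right hle, le_refl]
    · push Not at hbig
      refine (hcon i hi).trans (le_of_eq (tsum_congr fun n => ?_))
      by_cases hn : meets i n
      · rw [if_pos hn, if_pos hn]
        simp only [hg, min_eq_left (hbig n hn).le]
      · rw [if_neg hn, if_neg hn]
  have hup : ∀ n, (∑ i ∈ G, if meets i n then ENNReal.ofReal (g n) else 0) ≤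
      ENNReal.ofReal 3 *
        if (U n ∩ Set.Icc x (x + M * h)).Nonempty then ENNReal.ofReal (w n ^ s) else 0 := by
    intro n
    rw [← Finset.sum_filter, Finset.sum_const, nsmul_eq_mul]
    rcases (G.filter fun i => meets i n).eq_empty_or_nonempty with he | ⟨i, hi⟩
    · simp [he]
    · rw [Finset.mem_filter] at hi
      have hiM : i + 1 ≤ M := Finset.mem_range.1 (hGM hi.1)
      have hiM' : (i : ℝ) + 1 ≤ M := by exact_mod_cast hiM
      have hmeet : (U n ∩ Set.Icc x (x + M * h)).Nonempty := by
        obtain ⟨a, haU, ha⟩ := hi.2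
        refine ⟨a, haU, ?_, ?_⟩
        · have : 0 ≤ (i : ℝ) * h := by positivity
          linarith [ha.1]
        · nlinarith [ha.2]
      rw [if_pos hmeet]
      have hwlt := lt_length_of_coverCost_lt hs0 (by positivity) hc1 (hw n) hcost hmeet
      have hcard := card_meet_le (hw n) hh (hU n) (F := G.filter fun i => meets i n)
        (fun i hi => (Finset.mem_filter.1 hi).2)
      rw [← ENNReal.ofReal_natCast, ← ENNReal.ofReal_mul (by positivity),
        ← ENNReal.ofReal_mul (by positivity)]
      apply ENNReal.ofReal_le_ofReal
      refine le_trans ?_ (add_two_mul_min_le hs1 hM (hw n) hh hwlt.le)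
      exact mul_le_mul_of_nonneg_right hcard (hgpos n).le
  have hsum : (G.card : ℝ≥0∞) * ENNReal.ofReal (c * h ^ s) ≤
      ENNReal.ofReal 3 * coverCost U w s x (M * h) := by
    calc (G.card : ℝ≥0∞) * ENNReal.ofReal (c * h ^ s)
        = ∑ _i ∈ G, ENNReal.ofReal (c * h ^ s) := by rw [Finset.sum_const, nsmul_eq_mul]
      _ ≤ ∑ i ∈ G, ∑' n, if meets i n then ENNReal.ofReal (g n) else 0 := Finset.sum_le_sum hlow
      _ = ∑' n, ∑ i ∈ G, if meets i n then ENNReal.ofReal (g n) else 0 :=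
          (Summable.tsum_finsetSum fun _ _ => ENNReal.summable).symm
      _ ≤ _ := ENNReal.tsum_le_tsum hup
      _ = _ := ENNReal.tsum_mul_left
  have hsum2 : (G.card : ℝ≥0∞) * ENNReal.ofReal (c * h ^ s) ≤
      ENNReal.ofReal 3 * ENNReal.ofReal (c * (M * h) ^ s) := hsum.trans (by gcongr)
  rw [← ENNReal.ofReal_natCast, ← ENNReal.ofReal_mul (by positivity),
    ← ENNReal.ofReal_mul (by positivity), ENNReal.ofReal_le_ofReal_iff (by positivity)] at hsum2
  have hG' : (M : ℝ) ≤ 2 * G.card := by exact_mod_cast hG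
  rw [Real.mul_rpow hM'.le hh.le] at hsum2
  have hMM : (M : ℝ) = (M : ℝ) ^ (1 - s) * (M : ℝ) ^ s := by
    rw [← Real.rpow_add hM']; simp
  have hMs : 0 < (M : ℝ) ^ s := by positivity
  have hch : 0 < c * h ^ s := by positivity
  have h1 : 8 * (M : ℝ) ^ s ≤ M := by
    conv_rhs => rw [hMM]
    gcongr
  have h2 : (G.card : ℝ) ≤ 3 * (M : ℝ) ^ s := by
    refine le_of_mul_le_mul_right ?_ hch
    linarith
  linarith

lemma exists_cover_of_hausdorffMeasure_eq_zero {E : Set ℝ} {s : ℝ} (hs0 : 0 < s)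
    (hE : MeasureTheory.Measure.hausdorffMeasure s E = 0) {δ : ℝ≥0∞} (hδ : 0 < δ) :
    ∃ (U : ℕ → Set ℝ) (w : ℕ → ℝ), E ⊆ ⋃ n, U n ∧ (∀ n, 0 < w n) ∧
      (∀ n, ∀ a ∈ U n, ∀ b ∈ U n, b - a ≤ w n) ∧ ∑' n, ENNReal.ofReal (w n ^ s) < δ := by
  wlog hδt : δ ≠ ⊤ generalizing δ
  · obtain ⟨U, w, h1, h2, h3, h4⟩ := this one_pos ENNReal.one_ne_top
    exact ⟨U, w, h1, h2, h3, h4.trans_le (by simp [not_not.1 hδt])⟩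
  rw [MeasureTheory.Measure.hausdorffMeasure_apply] at hE
  have h1 := ENNReal.iSup_eq_zero.1 (ENNReal.iSup_eq_zero.1 hE 1) one_pos
  have hδ2 : 0 < δ / 2 := ENNReal.half_pos hδ.ne'
  rw [← h1] at hδ2
  simp only [iInf_lt_iff] at hδ2
  obtain ⟨U, hEU, -, hsum⟩ := hδ2
  obtain ⟨e, hepos, hesum⟩ := ENNReal.exists_pos_sum_of_countable' (ENNReal.half_pos hδ.ne').ne' ℕ
  set a : ℕ → ℝ≥0∞ := fun n => ⨆ _ : (U n).Nonempty, Metric.ediam (U n) ^ s with ha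
  have htot : ∑' n, (a n + e n) < δ := by
    rw [ENNReal.tsum_add]
    calc _ < δ / 2 + δ / 2 := ENNReal.add_lt_add hsum hesum
      _ = δ := ENNReal.add_halves δ
  have hfin : ∀ n, a n + e n ≠ ⊤ := fun n => ((ENNReal.le_tsum n).trans_lt htot).ne_top
  have hpos : ∀ n, 0 < (a n + e n).toReal := fun n =>
    ENNReal.toReal_pos (by simp [(hepos n).ne']) (hfin n)
  have hrpow : ∀ n, ENNReal.ofReal (((a n + e n).toReal ^ s⁻¹) ^ s) = a n + e n := fun n => by
    rw [Real.rpow_inv_rpow ENNReal.toReal_nonneg hs0.ne', ENNReal.ofReal_toReal (hfin n)]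
  refine ⟨U, fun n => (a n + e n).toReal ^ s⁻¹, hEU, fun n => Real.rpow_pos_of_pos (hpos n) _, ?_,
    ?_⟩
  · intro n x hx y hy
    have hle : edist y x ^ s ≤ a n + e n := by
      refine le_trans ?_ le_self_add
      refine le_trans ?_ (le_iSup (fun _ : (U n).Nonempty => Metric.ediam (U n) ^ s) ⟨x, hx⟩)
      gcongr
      exact Metric.edist_le_ediam_of_mem hy hx
    rw [← hrpow n, edist_dist, ENNReal.ofReal_rpow_of_nonneg dist_nonneg hs0.le,
      ENNReal.ofReal_le_ofReal_iff (by positivity),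
      Real.rpow_le_rpow_iff dist_nonneg (by positivity) hs0] at hle
    exact (le_abs_self _).trans hle
  · simpa only [hrpow] using htot

/-- A set containing the limit points of an `M`-adic scheme in which at least half of the
subintervals survive at each step has dimension at least `s`, provided `8 ≤ M ^ (1 - s)`. -/
lemma le_dimH_of_half_subintervals {E : Set ℝ} {s : ℝ≥0} {M : ℕ} {ℓ : ℝ} {P : ℕ → ℝ → Prop}
    (hs0 : 0 < s) (hs1 : s < 1) (hM : 0 < M) (hM8 : (8 : ℝ) ≤ (M : ℝ) ^ (1 - (s : ℝ)))
    (hℓ : 0 < ℓ) {x₀ : ℝ} (hP0 : P 0 x₀)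
    (hstep : ∀ j x, P j x → ∃ G ⊆ Finset.range M, M ≤ 2 * G.card ∧
      ∀ i ∈ G, P (j + 1) (x + i * (ℓ / M ^ (j + 1))))
    (hE : ∀ (x : ℕ → ℝ) (z : ℝ), (∀ j, P j (x j)) →
      (∀ j, z ∈ Set.Icc (x j) (x j + ℓ / M ^ j)) → z ∈ E) :
    (s : ℝ≥0∞) ≤ dimH E := by
  by_contra! hlt
  have hs0' : (0 : ℝ) < s := hs0
  have hs1' : (s : ℝ) < 1 := hs1
  have hM' : (0 : ℝ) < M := by exact_mod_cast hM
  have hM1 : (1 : ℝ) < M := by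
    by_contra! hle
    have := Real.rpow_le_one hM'.le hle (sub_nonneg.2 hs1'.le)
    linarith
  have hc1 : (M : ℝ) ^ ((s : ℝ) - 1) ≤ 1 :=
    Real.rpow_le_one_of_one_le_of_nonpos hM1.le (by linarith)
  obtain ⟨U, w, hEU, hw, hU, hsum⟩ := exists_cover_of_hausdorffMeasure_eq_zero hs0'
    (hausdorffMeasure_of_dimH_lt hlt)
    (δ := ENNReal.ofReal ((M : ℝ) ^ ((s : ℝ) - 1) * ℓ ^ (s : ℝ)))
    (ENNReal.ofReal_pos.2 (by positivity))
  set Q : ℕ → ℝ → Prop := fun j x => P j x ∧ coverCost U w s x (ℓ / M ^ j) <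
    ENNReal.ofReal ((M : ℝ) ^ ((s : ℝ) - 1) * (ℓ / M ^ j) ^ (s : ℝ)) with hQ
  have hQ0 : Q 0 x₀ := by
    refine ⟨hP0, ?_⟩
    rw [pow_zero, div_one]
    refine lt_of_le_of_lt (ENNReal.tsum_le_tsum fun n => ?_) hsum
    split_ifs <;> simp
  have hQstep : ∀ j x, Q j x → ∃ y, Q (j + 1) y ∧
      Set.Icc y (y + ℓ / M ^ (j + 1)) ⊆ Set.Icc x (x + ℓ / M ^ j) := by
    rintro j x ⟨hP, hcost⟩
    obtain ⟨G, hGM, hG, hGP⟩ := hstep j x hP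
    have hlen : ℓ / (M : ℝ) ^ j = M * (ℓ / M ^ (j + 1)) := by
      rw [pow_succ]; field_simp
    have hpos : 0 < ℓ / (M : ℝ) ^ (j + 1) := by positivity
    rw [hlen] at hcost ⊢
    obtain ⟨i, hi, hicost⟩ := exists_coverCost_lt hs0' hs1' hM hM8 hpos hw hU hcost hGM hG
    refine ⟨_, ⟨hGP i hi, hicost⟩, Set.Icc_subset_Icc ?_ ?_⟩
    · have : 0 ≤ (i : ℝ) * (ℓ / M ^ (j + 1)) := by positivity
      linarith
    · have hiM : (i : ℝ) + 1 ≤ M := by exact_mod_cast Finset.mem_range.1 (hGM hi)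
      nlinarith
  choose f hfQ hfsub using hQstep
  let F : ∀ j, {x // Q j x} := fun j =>
    Nat.rec ⟨x₀, hQ0⟩ (fun j y => ⟨f j y.1 y.2, hfQ j y.1 y.2⟩) j
  obtain ⟨z, hz⟩ := IsCompact.nonempty_iInter_of_sequence_nonempty_isCompact_isClosed
    (fun j => Set.Icc (F j).1 ((F j).1 + ℓ / M ^ j))
    (fun j => hfsub j (F j).1 (F j).2)
    (fun j => Set.nonempty_Icc.2 (by
      have : 0 < ℓ / (M : ℝ) ^ j := by positivity
      linarith)) isCompact_Icc (fun j => isClosed_Icc)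
  rw [Set.mem_iInter] at hz
  obtain ⟨n, hn⟩ := Set.mem_iUnion.1 (hEU (hE (fun j => (F j).1) z (fun j => (F j).2.1) hz))
  have hwlt : ∀ j, w n < ℓ / M ^ j := fun j =>
    lt_length_of_coverCost_lt hs0' (by positivity) hc1 (hw n) (F j).2.2 ⟨z, hn, hz j⟩
  obtain ⟨j, hj⟩ := pow_unbounded_of_one_lt (ℓ / w n) hM1
  have := hwlt j
  rw [lt_div_iff₀ (by positivity)] at this
  rw [div_lt_iff₀ (hw n)] at hj
  linarith

/-- The exponential `α ↦ exp (c + α e)` is `ε`-close to an odd multiple of `π` on few of the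
intervals `[x + i h, x + (i + 1) h]`, `i < M`. -/
lemma card_near_odd_mul_pi_le {c e x h B ε : ℝ} {M : ℕ} (he : 0 < e) (hh : 0 < h)
    (hM : 0 < M) (hε : 0 < ε) (hε1 : ε ≤ 1) (hεB : 2 * M * ε ≤ B)
    (hlow : B < e * Real.exp (c + x * e) * (M * h))
    (hup : e * Real.exp (c + x * e) * (M * h) ≤ B * M)
    (hdist : e * (M * h) ≤ 1) {F : Finset ℕ} (hFM : F ⊆ Finset.range M)
    (hF : ∀ i ∈ F, ∃ α ∈ Set.Icc (x + i * h) (x + i * h + h), ∃ m : ℤ,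
      |Real.exp (c + α * e) - (2 * m + 1) * Real.pi| < ε) :
    (F.card : ℝ) ≤ 3 * (M * B / Real.pi + 2) := by
  have hM' : (0 : ℝ) < M := by exact_mod_cast hM
  set u : ℝ → ℝ := fun α => Real.exp (c + α * e) with hu
  have humono : Monotone u := fun α β hαβ => Real.exp_le_exp.2 (by gcongr)
  have hgrow : ∀ α β, x ≤ α → α ≤ β → e * u x * (β - α) ≤ u β - u α := by
    intro α β hxα hαβ
    have h1 : u β = u α * Real.exp ((β - α) * e) := by
      simp only [hu]; rw [← Real.exp_add]; ring_nf
    have h2 := Real.add_one_le_exp ((β - α) * e)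
    have h3 : u x ≤ u α := humono hxα
    have h4 : 0 < u x := Real.exp_pos _
    have h5 : 0 ≤ (β - α) * e := mul_nonneg (by linarith) he.le
    rw [h1]
    nlinarith
  have htotal : u (x + M * h) - u x ≤ 2 * (B * M) := by
    have h1 : u (x + M * h) = u x * Real.exp (e * (M * h)) := by
      simp only [hu]; rw [← Real.exp_add]; ring_nf
    have h0 : 0 ≤ e * (M * h) := by positivity
    have h2 := Real.abs_exp_sub_one_le (x := e * (M * h)) (by rwa [abs_of_nonneg h0])
    rw [abs_of_nonneg h0] at h2
    have h3 := (le_abs_self _).trans h2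
    have h4 : 0 < u x := Real.exp_pos _
    have h5 : e * u x * (M * h) ≤ B * M := hup
    rw [h1]
    nlinarith
  choose! α hα m hm using hF
  set A : ℝ := ((u x - ε) / Real.pi - 1) / 2 with hA
  set Z : ℝ := ((u (x + M * h) + ε) / Real.pi - 1) / 2 with hZ
  have hpi := Real.pi_pos
  have hmaps : ∀ i ∈ F, m i ∈ Finset.Icc ⌈A⌉ ⌊Z⌋ := by
    intro i hi
    have hiM : (i : ℝ) + 1 ≤ M := by exact_mod_cast Finset.mem_range.1 (hFM hi)
    have hih : 0 ≤ (i : ℝ) * h := by positivity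
    have h1 : u x ≤ u (α i) := humono (by linarith [(hα i hi).1])
    have h2 : u (α i) ≤ u (x + M * h) := humono (by nlinarith [(hα i hi).2])
    have h3 := abs_lt.1 (hm i hi)
    simp only [hu] at h1 h2
    rw [Finset.mem_Icc, Int.ceil_le, Int.le_floor, hA, hZ, div_le_iff₀ two_pos,
      le_div_iff₀ two_pos, sub_le_iff_le_add, le_sub_iff_add_le, div_le_iff₀ hpi, le_div_iff₀ hpi]
    simp only [hu]
    constructor <;> linarith [h3.1, h3.2]
  have hfiber : ∀ z ∈ Finset.Icc ⌈A⌉ ⌊Z⌋, (F.filter fun i => m i = z).card ≤ 3 := by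
    intro z _
    refine card_le_of_forall_lt_add fun i hi j hj hij => ?_
    rw [Finset.mem_filter] at hi hj
    by_contra! hcon
    have hcon' : (i : ℝ) + 3 ≤ j := by exact_mod_cast hcon
    have h1 := abs_lt.1 (hm i hi.1)
    have h2 := abs_lt.1 (hm j hj.1)
    rw [hi.2] at h1
    rw [hj.2] at h2
    have h3 : u (α i) ≤ u (x + i * h + h) := humono (hα i hi.1).2
    have h4 : u (x + j * h) ≤ u (α j) := humono (hα j hj.1).1
    have hih : 0 ≤ (i : ℝ) * h := by positivity
    have h5 := hgrow (x + i * h + h) (x + j * h) (by linarith) (by nlinarith)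
    have h6 : 2 * h ≤ (x + j * h) - (x + i * h + h) := by nlinarith
    have hux : 0 < e * u x := mul_pos he (Real.exp_pos _)
    have h7 : e * u x * (2 * h) ≤ 2 * ε := by
      have h8 := mul_le_mul_of_nonneg_left h6 hux.le
      simp only [hu] at *
      linarith [h1.1, h2.2]
    have h9 : B < e * u x * (M * h) := hlow
    have h10 : M * (e * u x * (2 * h)) ≤ M * (2 * ε) := by gcongr
    have h11 : 0 < e * u x * (M * h) := by positivity
    linarith
  have hcard := Finset.card_le_mul_card_image_of_maps_to hmaps 3 hfiber
  have hZA : Z - A ≤ M * B / Real.pi + 1 := by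
    have h1 : Z - A = (u (x + M * h) - u x + 2 * ε) / (2 * Real.pi) := by
      rw [hA, hZ]; field_simp; ring
    rw [h1, div_add_one hpi.ne', div_le_div_iff₀ (by positivity) hpi]
    nlinarith [Real.pi_gt_three]
  have hAZ : A ≤ Z := by
    have h1 : u x ≤ u (x + M * h) := humono (le_add_of_nonneg_right (by positivity))
    rw [hA, hZ]
    gcongr
    linarith
  have hIcc : ((Finset.Icc ⌈A⌉ ⌊Z⌋).card : ℝ) ≤ Z - A + 1 := by
    rw [Int.card_Icc]
    have h1 : (((⌊Z⌋ + 1 - ⌈A⌉).toNat : ℤ) : ℝ) = max ((⌊Z⌋ : ℝ) + 1 - ⌈A⌉) 0 := by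
      rw [Int.toNat_eq_max]; push_cast; rfl
    rw [← Int.cast_natCast, h1]
    refine max_le ?_ (by linarith)
    linarith [Int.floor_le Z, Int.le_ceil A]
  calc (F.card : ℝ) ≤ 3 * ((Finset.Icc ⌈A⌉ ⌊Z⌋).card : ℝ) := by exact_mod_cast hcard
    _ ≤ 3 * (M * B / Real.pi + 2) := by linarith

/-- For `β > 0` and `s < 1` there are `N`, `M` with `M ≤ exp (β N)`, `M` being large compared
with `N` and `M ^ (1 - s) ≥ 8`. -/
lemma exists_nat_le_exp_mul {β s : ℝ} (hβ : 0 < β) (hs : s < 1) :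
    ∃ N M : ℕ, 0 < N ∧ (M : ℝ) ≤ Real.exp (β * N) ∧ 24 * N ≤ M ∧ (8 : ℝ) ≤ (M : ℝ) ^ (1 - s) := by
  open Filter in
  have hexp : Tendsto (fun N : ℕ => Real.exp (β * N)) atTop atTop :=
    Real.tendsto_exp_atTop.comp (tendsto_natCast_atTop_atTop.const_mul_atTop hβ)
  have h1 := ((tendsto_rpow_atTop (sub_pos.2 hs)).comp
    (tendsto_natCast_atTop_atTop.comp (tendsto_nat_floor_atTop.comp hexp))).eventually_ge_atTop 8
  have h2 := (tendsto_natCast_atTop_atTop (R := ℝ)).eventually_ge_atTop (50 / β ^ 2)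
  obtain ⟨N, hN1, hN2, hN3⟩ := (h1.and (h2.and (Filter.eventually_gt_atTop 0))).exists
  refine ⟨N, ⌊Real.exp (β * N)⌋₊, hN3, Nat.floor_le (Real.exp_pos _).le, ?_, hN1⟩
  apply Nat.le_floor
  have hN : (1 : ℝ) ≤ N := by exact_mod_cast hN3
  have h3 := Real.quadratic_le_exp_of_nonneg (x := β * N) (by positivity)
  rw [div_le_iff₀ (by positivity)] at hN2
  push_cast
  nlinarith [mul_nonneg hβ.le (by linarith : (0:ℝ) ≤ N)]

/-- The slopes `e_k exp (c + x e_k)`, `e_k = π k + d`, grow geometrically in `k`. -/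
lemma exp_mul_slope_le {a c d x : ℝ} (hax : a ≤ x) {i j : ℕ} (hij : i ≤ j)
    (hi : 0 < Real.pi * i + d) :
    Real.exp (Real.pi * a * (j - i)) *
        ((Real.pi * i + d) * Real.exp (c + x * (Real.pi * i + d))) ≤
      (Real.pi * j + d) * Real.exp (c + x * (Real.pi * j + d)) := by
  have hij' : (i : ℝ) ≤ j := by exact_mod_cast hij
  have hpi := Real.pi_pos
  have h1 : Real.exp (Real.pi * a * (j - i)) * Real.exp (c + x * (Real.pi * i + d)) ≤
      Real.exp (c + x * (Real.pi * j + d)) := by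
    rw [← Real.exp_add]
    apply Real.exp_le_exp.2
    have : 0 ≤ Real.pi * (j - i) * (x - a) :=
      mul_nonneg (mul_nonneg hpi.le (by linarith)) (by linarith)
    linarith
  calc _ = (Real.pi * i + d) *
        (Real.exp (Real.pi * a * (j - i)) * Real.exp (c + x * (Real.pi * i + d))) := by ring
    _ ≤ (Real.pi * i + d) * Real.exp (c + x * (Real.pi * j + d)) := by gcongr
    _ ≤ _ := by gcongr

/-- Parameters `α` for which `exp (c + α (π k + d))` stays away from the odd multiples of `π`
as `k → ∞`. -/
def avoidingParams (c d : ℝ) : Set ℝ :=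
  {α | ∃ ε > 0, ∃ K : ℕ, ∀ k ≥ K, ∀ m : ℤ,
    ε ≤ |Real.exp (c + α * (Real.pi * k + d)) - (2 * m + 1) * Real.pi|}

lemma le_dimH_Icc_inter_avoidingParams {a b c d : ℝ} (ha : 0 < a) (hab : a < b) {s : ℝ≥0}
    (hs0 : 0 < s) (hs1 : s < 1) :
    (s : ℝ≥0∞) ≤ dimH (Set.Icc a b ∩ avoidingParams c d) := by
  classical
  have hpi := Real.pi_pos
  obtain ⟨N, M, hN, hMexp, hNM, hM8⟩ :=
    exists_nat_le_exp_mul (mul_pos hpi ha) (show (s : ℝ) < 1 from hs1)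
  have hM : 0 < M := by omega
  have hM' : (0 : ℝ) < M := by exact_mod_cast hM
  have hN' : (0 : ℝ) < N := by exact_mod_cast hN
  have hNM' : 24 * (N : ℝ) ≤ M := by exact_mod_cast hNM
  set B : ℝ := 1 / (12 * N) with hB
  have hBpos : 0 < B := by positivity
  have hBN : B * N = 1 / 12 := by rw [hB]; field_simp
  set ε : ℝ := B / (2 * M) with hε
  have hεpos : 0 < ε := by positivity
  have hεB : 2 * M * ε = B := by rw [hε]; field_simp
  have hM24 : (24 : ℝ) ≤ M := by
    have : (1 : ℝ) ≤ N := by exact_mod_cast hN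
    linarith
  have hε1 : ε ≤ 1 := by
    have : (1 : ℝ) ≤ N := by exact_mod_cast hN
    nlinarith
  set e : ℕ → ℝ := fun k => Real.pi * k + d with he
  set v : ℕ → ℝ → ℝ := fun k x => e k * Real.exp (c + x * e k) with hv
  have hetop : Filter.Tendsto e Filter.atTop Filter.atTop :=
    Filter.tendsto_atTop_add_const_right _ _ (tendsto_natCast_atTop_atTop.const_mul_atTop hpi)
  have huttop : Filter.Tendsto (fun k => Real.exp (c + a * e k)) Filter.atTop Filter.atTop :=
    Real.tendsto_exp_atTop.comp
      (Filter.tendsto_atTop_add_const_left _ _ (hetop.const_mul_atTop ha))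
  obtain ⟨K, hK⟩ := Filter.eventually_atTop.1 ((hetop.eventually_gt_atTop 0).and
    ((huttop.eventually_ge_atTop (B * M)).and
      ((hetop.atTop_mul_atTop₀ huttop).eventually_gt_atTop (B / (b - a)))))
  have hvmono : ∀ k ≥ K, ∀ x y, x ≤ y → v k x ≤ v k y := fun k hk x y hxy => by
    have := (hK k hk).1
    simp only [hv]
    gcongr
  have hba : 0 < b - a := sub_pos.2 hab
  refine le_dimH_of_half_subintervals (M := M) (ℓ := b - a) (x₀ := a)
    (P := fun j x => a ≤ x ∧ x + (b - a) / M ^ j ≤ b ∧ ∀ k ≥ K, v k x * ((b - a) / M ^ j) ≤ B →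
      ∀ α ∈ Set.Icc x (x + (b - a) / M ^ j), ∀ m : ℤ,
        ε ≤ |Real.exp (c + α * e k) - (2 * m + 1) * Real.pi|)
    hs0 hs1 hM hM8 hba ?_ ?_ ?_
  · refine ⟨le_rfl, by simp, fun k hk hle => ?_⟩
    have := (hK k hk).2.2
    rw [div_lt_iff₀ hba] at this
    rw [pow_zero, div_one] at hle
    exact absurd hle (not_le.2 this)
  · rintro j x ⟨hax, hxb, hP⟩
    set h : ℝ := (b - a) / M ^ (j + 1) with hh
    have hhpos : 0 < h := by positivity
    have hlen : (b - a) / (M : ℝ) ^ j = M * h := by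
      rw [hh, pow_succ]; field_simp
    rw [hlen] at hxb hP
    set bad : ℕ → ℕ → Prop := fun k i => ∃ α ∈ Set.Icc (x + i * h) (x + i * h + h), ∃ m : ℤ,
      |Real.exp (c + α * e k) - (2 * m + 1) * Real.pi| < ε with hbad
    set active : ℕ → Prop := fun k => K ≤ k ∧ B < v k x * (M * h) ∧ v k x * (M * h) ≤ B * M
      with hactive
    obtain ⟨S, hSN, hS⟩ : ∃ S : Finset ℕ, S.card ≤ N ∧ ∀ k, k ∈ S ↔ active k := by
      have hgap : ∀ i k, active i → active k → i ≤ k → k < i + N := by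
        rintro i k ⟨hKi, hBi, -⟩ ⟨-, -, hBk⟩ hik
        have h1 : Real.exp (Real.pi * a * (k - i)) * v i x ≤ v k x :=
          exp_mul_slope_le hax hik (hK i hKi).1
        have h2 : Real.exp (Real.pi * a * (k - i)) * B < M * B := by
          calc _ < Real.exp (Real.pi * a * (k - i)) * (v i x * (M * h)) := by gcongr
            _ = Real.exp (Real.pi * a * (k - i)) * v i x * (M * h) := by ring
            _ ≤ v k x * (M * h) := by gcongr
            _ ≤ M * B := by linarith
        have h3 := (lt_of_mul_lt_mul_right h2 hBpos.le).trans_le hMexp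
        rw [Real.exp_lt_exp] at h3
        have h4 := lt_of_mul_lt_mul_left h3 (mul_pos hpi ha).le
        have : (k : ℝ) < (i + N : ℕ) := by push_cast; linarith
        exact_mod_cast this
      by_cases hex : ∃ k, active k
      · refine ⟨(Finset.Ico (Nat.find hex) (Nat.find hex + N)).filter active, ?_, fun k => ?_⟩
        · exact (Finset.card_filter_le _ _).trans (by simp)
        · rw [Finset.mem_filter, Finset.mem_Ico]
          exact ⟨fun hk => hk.2, fun hk => ⟨⟨Nat.find_min' hex hk,
            hgap _ _ (Nat.find_spec hex) hk (Nat.find_min' hex hk)⟩, hk⟩⟩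
      · refine ⟨∅, by simp, fun k => ?_⟩
        simpa using fun hk => hex ⟨k, hk⟩
    set badSet : Finset ℕ := S.biUnion fun k => (Finset.range M).filter (bad k) with hbadSet
    have hcardk : ∀ k ∈ S, (((Finset.range M).filter (bad k)).card : ℝ) ≤
        3 * (M * B / Real.pi + 2) := by
      intro k hk
      obtain ⟨hKk, hB1, hB2⟩ := (hS k).1 hk
      obtain ⟨hek, huk, -⟩ := hK k hKk
      refine card_near_odd_mul_pi_le hek hhpos hM hεpos hε1 hεB.le hB1 hB2 ?_
        (Finset.filter_subset _ _) (fun i hi => (Finset.mem_filter.1 hi).2)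
      have h1 : B * M ≤ Real.exp (c + x * e k) := huk.trans (by gcongr)
      have h2 : 0 < B * M := by positivity
      have h3 : e k * Real.exp (c + x * e k) * (M * h) ≤ B * M := hB2
      have h4 : 0 < e k * (M * h) := by positivity
      by_contra! hcon
      nlinarith
    have hbadcard : 2 * badSet.card ≤ M := by
      have h1 : (badSet.card : ℝ) ≤ ∑ k ∈ S, 3 * (M * B / Real.pi + 2) :=
        le_trans (by exact_mod_cast Finset.card_biUnion_le) (Finset.sum_le_sum hcardk)
      rw [Finset.sum_const, nsmul_eq_mul] at h1
      have h2 : (S.card : ℝ) ≤ N := by exact_mod_cast hSN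
      have h3 : M * B / Real.pi ≤ M * B / 3 := by
        gcongr
        exact Real.pi_gt_three.le
      have h4 : (badSet.card : ℝ) ≤ N * (3 * (M * B / 3 + 2)) := h1.trans (by gcongr)
      have h5 : (2 * badSet.card : ℝ) ≤ M := by
        have h6 : N * (3 * (M * B / 3 + 2)) = M * (B * N) + 6 * N := by ring
        rw [h6, hBN] at h4
        linarith
      exact_mod_cast h5
    refine ⟨Finset.range M \ badSet, Finset.sdiff_subset, ?_, ?_⟩
    · have h1 := Finset.le_card_sdiff badSet (Finset.range M)
      rw [Finset.card_range] at h1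
      omega
    · intro i hi
      rw [Finset.mem_sdiff, Finset.mem_range] at hi
      have hiM : (i : ℝ) + 1 ≤ M := by exact_mod_cast hi.1
      have hih : 0 ≤ (i : ℝ) * h := by positivity
      have hiMh : (i : ℝ) * h + h ≤ M * h := by nlinarith
      refine ⟨by linarith, by linarith, fun k hk hle α hα m => ?_⟩
      by_cases hold : v k x * (M * h) ≤ B
      · exact hP k hk hold α ⟨by linarith [hα.1], by linarith [hα.2]⟩ m
      · by_contra! hcon
        have hkS : k ∈ S := (hS k).2 ⟨hk, not_le.1 hold, by
          have := hvmono k hk x (x + i * h) (by linarith)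
          calc v k x * (M * h) ≤ v k (x + i * h) * (M * h) := by gcongr
            _ = v k (x + i * h) * h * M := by ring
            _ ≤ B * M := by gcongr⟩
        exact hi.2 (Finset.mem_biUnion.2 ⟨k, hkS, Finset.mem_filter.2
          ⟨Finset.mem_range.2 hi.1, α, hα, m, hcon⟩⟩)
  · intro x z hP hz
    refine ⟨⟨(hP 0).1.trans (hz 0).1, (hz 0).2.trans (hP 0).2.1⟩, ε, hεpos, K, fun k hk m => ?_⟩
    have hM1 : (1 : ℝ) < M := by linarith
    obtain ⟨j, hj⟩ := pow_unbounded_of_one_lt (v k b * (b - a) / B) hM1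
    refine (hP j).2.2 k hk ?_ z (hz j) m
    have hlen : 0 < (b - a) / (M : ℝ) ^ j := by positivity
    calc v k (x j) * ((b - a) / M ^ j) ≤ v k b * ((b - a) / M ^ j) := by
          gcongr
          exact hvmono k hk _ _ (by linarith [(hP j).2.1])
      _ ≤ B := by
          rw [div_lt_iff₀ hBpos] at hj
          rw [← mul_div_assoc, div_le_iff₀ (by positivity)]
          linarith

/-- A point of a logarithmic spiral close to the imaginary axis and to an odd multiple of `π i`
yields a crossing height `exp (c + α (π k + π / 2 - b))` close to an odd multiple of `π`. -/
lemma exists_abs_exp_sub_odd_mul_pi_le {b c α δ t : ℝ} {K : ℕ} {n : ℤ} (hα : 0 < α) (hδ : 0 < δ)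
    (hδ1 : δ ≤ 1) (hδα : 2 * α * δ ≤ 1) (hr1 : 1 ≤ Real.exp (c + t * α))
    (ht1 : Real.pi * K + Real.pi ≤ b + t)
    (hzre : |Real.exp (c + t * α) * Real.cos (b + t)| < δ)
    (hzim : |Real.exp (c + t * α) * Real.sin (b + t) - (2 * n - 1) * Real.pi| < δ) :
    ∃ k ≥ K, ∃ m : ℤ, |Real.exp (c + α * (Real.pi * k + (Real.pi / 2 - b))) -
      (2 * m + 1) * Real.pi| ≤ δ * (4 * α + 3) := by
  have hpi := Real.pi_pos
  set r := Real.exp (c + t * α) with hr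
  have hr0 : 0 < r := by linarith
  set k : ℤ := round ((b + t - Real.pi / 2) / Real.pi) with hk
  set σ : ℝ := b + t - Real.pi / 2 - k * Real.pi with hσ
  have hround := abs_sub_round ((b + t - Real.pi / 2) / Real.pi)
  rw [← hk] at hround
  have hσdiv : (b + t - Real.pi / 2) / Real.pi - k = σ / Real.pi := by
    rw [hσ]; field_simp
  have hσ2 : |σ| ≤ Real.pi / 2 := by
    rw [hσdiv, abs_div, abs_of_pos hpi, div_le_iff₀ hpi] at hround
    linarith
  have hkK : (K : ℤ) ≤ k := by
    have h1 : (b + t - Real.pi / 2) / Real.pi - 1 / 2 ≤ k := by linarith [(abs_le.1 hround).2]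
    have h2 : (K : ℝ) + 1 / 2 ≤ (b + t - Real.pi / 2) / Real.pi := by
      rw [le_div_iff₀ hpi]; linarith
    have : (K : ℝ) ≤ k := by linarith
    exact_mod_cast this
  have hθ : b + t = (σ + Real.pi / 2) + k * Real.pi := by rw [hσ]; ring
  have hcos : |Real.cos (b + t)| = |Real.sin σ| := by
    rw [hθ, Real.cos_add_int_mul_pi, abs_mul, abs_zpow, abs_neg, abs_one, one_zpow, one_mul,
      Real.cos_add_pi_div_two, abs_neg]
  have hσr : r * |σ| ≤ 2 * δ := by
    have h1 := Real.mul_abs_le_abs_sin hσ2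
    rw [abs_mul, hcos, abs_of_pos hr0] at hzre
    have h2 : r * (2 / Real.pi * |σ|) ≤ δ := (by gcongr : _ ≤ r * |Real.sin σ|).trans hzre.le
    have h3 : r * |σ| = r * (2 / Real.pi * |σ|) * (Real.pi / 2) := by field_simp
    rw [h3]
    nlinarith [Real.pi_le_four]
  have hσδ : |σ| ≤ 2 * δ := le_trans (by nlinarith [abs_nonneg σ]) hσr
  lift k to ℕ using (Int.natCast_nonneg K).trans hkK with k' hk'
  have hkK' : K ≤ k' := by exact_mod_cast hkK
  set u := Real.exp (c + α * (Real.pi * k' + (Real.pi / 2 - b))) with hu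
  have hur : u = r * Real.exp (-(α * σ)) := by
    rw [hu, hr, ← Real.exp_add, hσ]
    push_cast
    ring_nf
  have hασ : |-(α * σ)| = α * |σ| := by rw [abs_neg, abs_mul, abs_of_pos hα]
  have h1 : |u - r| ≤ 4 * α * δ := by
    have h2 := Real.abs_exp_sub_one_le (x := -(α * σ)) (by rw [hασ]; nlinarith)
    have h3 : u - r = r * (Real.exp (-(α * σ)) - 1) := by rw [hur]; ring
    rw [hασ] at h2
    rw [h3, abs_mul, abs_of_pos hr0]
    calc _ ≤ r * (2 * (α * |σ|)) := by gcongr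
      _ = 2 * α * (r * |σ|) := by ring
      _ ≤ 2 * α * (2 * δ) := by gcongr
      _ = 4 * α * δ := by ring
  have h2 : |r - r * Real.cos σ| ≤ 2 * δ := by
    have h3 := Real.one_sub_sq_div_two_le_cos (x := σ)
    rw [abs_of_nonneg (by nlinarith [Real.cos_le_one σ])]
    calc r - r * Real.cos σ ≤ r * (σ ^ 2 / 2) := by nlinarith
      _ = (r * |σ|) * |σ| / 2 := by rw [← sq_abs]; ring
      _ ≤ (2 * δ) * (2 * δ) / 2 := by gcongr
      _ ≤ 2 * δ := by nlinarith
  obtain ⟨m, hm⟩ : ∃ m : ℤ, |r * Real.cos σ - (2 * m + 1) * Real.pi| < δ := by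
    rw [hθ, Real.sin_add_int_mul_pi, Real.sin_add_pi_div_two, zpow_natCast] at hzim
    rcases neg_one_pow_eq_or ℝ k' with h | h <;> rw [h] at hzim
    · refine ⟨n - 1, ?_⟩
      convert hzim using 2
      push_cast
      ring
    · refine ⟨-n, ?_⟩
      rw [← abs_neg]
      convert hzim using 2
      push_cast
      ring
  have h3 : |u - (2 * m + 1) * Real.pi| ≤ 4 * α * δ + 2 * δ + δ := by
    calc _ = |(u - r) + (r - r * Real.cos σ) + (r * Real.cos σ - (2 * m + 1) * Real.pi)| := by
          congr 1; ring
      _ ≤ |u - r| + |r - r * Real.cos σ| + |r * Real.cos σ - (2 * m + 1) * Real.pi| :=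
          abs_add_three _ _ _
      _ ≤ _ := by gcongr
  exact ⟨k', hkK', m, h3.trans (le_of_eq (by ring))⟩

/-- If `α` avoids, then far along the line the double exponential stays away from `-1`. -/
lemma exists_le_norm_expexp_add_one {p : ℂ} {α : ℝ} (hα : 0 < α)
    (hav : α ∈ avoidingParams p.re (Real.pi / 2 - p.im)) :
    ∃ η > 0, ∃ T : ℝ, ∀ t ≥ T, η ≤ ‖exp (exp (p + t * (I + α))) + 1‖ := by
  obtain ⟨ε, hε, K, hK⟩ := hav
  have hpi := Real.pi_pos
  obtain ⟨δ, hδ, hδ1, hδα, hδε⟩ : ∃ δ : ℝ, 0 < δ ∧ δ ≤ 1 ∧ 2 * α * δ ≤ 1 ∧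
      δ * (4 * α + 3) < ε := by
    refine ⟨min 1 (min (1 / (2 * α)) (ε / (2 * (4 * α + 3)))), by positivity, min_le_left _ _,
      ?_, ?_⟩
    · have : min 1 (min (1 / (2 * α)) (ε / (2 * (4 * α + 3)))) ≤ 1 / (2 * α) :=
        (min_le_right _ _).trans (min_le_left _ _)
      rw [le_div_iff₀ (by positivity)] at this
      linarith
    · have : min 1 (min (1 / (2 * α)) (ε / (2 * (4 * α + 3)))) ≤ ε / (2 * (4 * α + 3)) :=
        (min_le_right _ _).trans (min_le_right _ _)
      rw [le_div_iff₀ (by positivity)] at this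
      linarith
  obtain ⟨η, hη, hlog⟩ := Metric.continuousAt_iff.1 (continuousAt_clog one_mem_slitPlane) δ hδ
  refine ⟨η, hη, max (Real.pi * K + Real.pi - p.im) (-p.re / α), fun t ht => ?_⟩
  by_contra! hlt
  have ht1 := (le_max_left _ _).trans ht
  have ht2 := (le_max_right _ _).trans ht
  rw [div_le_iff₀ hα] at ht2
  set z := exp (p + t * (I + α)) with hz
  have hexp : exp (z + Real.pi * I) = -exp z := by rw [exp_add, exp_pi_mul_I]; ring
  have hnear : ‖log (-exp z)‖ < δ := by
    have := hlog (x := -exp z) (by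
      rwa [dist_eq_norm, ← norm_neg, show -(-exp z - 1) = exp z + 1 by ring])
    simpa using this
  obtain ⟨n, hn⟩ := exp_eq_exp_iff_exists_int.1
    (hexp.trans (exp_log (neg_ne_zero.2 (exp_ne_zero z))).symm)
  set q := log (-exp z) with hq
  have hzq : z = q + ((2 * n - 1) * Real.pi : ℝ) * I := by
    push_cast
    linear_combination hn
  have hzre : |z.re| < δ := by
    have : z.re = q.re := by simp [hzq]
    rw [this]
    exact (abs_re_le_norm q).trans_lt hnear
  have hzim : |z.im - (2 * n - 1) * Real.pi| < δ := by
    have : z.im - (2 * n - 1) * Real.pi = q.im := by simp [hzq]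
    rw [this]
    exact (abs_im_le_norm q).trans_lt hnear
  set r := Real.exp (p.re + t * α) with hr
  have hre : z.re = r * Real.cos (p.im + t) := by simp [hz, exp_re, hr]
  have him : z.im = r * Real.sin (p.im + t) := by simp [hz, exp_im, hr]
  have hr1 : 1 ≤ r := Real.one_le_exp (by linarith)
  rw [hre] at hzre
  rw [him] at hzim
  obtain ⟨k, hkK, m, hm⟩ := exists_abs_exp_sub_odd_mul_pi_le hα hδ hδ1 hδα hr1 (by linarith)
    hzre hzim
  have h4 := hK k hkK m
  linarith

lemma expexp_image_lineThrough (p : ℂ) (α : ℝ) :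
    (fun z : ℂ => exp (exp z)) '' lineThrough p α =
      Set.range fun t : ℝ => exp (exp (p + t * (I + α))) := by
  ext y
  constructor
  · rintro ⟨_, ⟨t, rfl⟩, rfl⟩
    exact ⟨t, rfl⟩
  · rintro ⟨t, rfl⟩
    exact ⟨_, ⟨t, rfl⟩, rfl⟩

lemma closure_expexp_ne_univ_of_pos {p : ℂ} {α : ℝ} (hα : 0 < α)
    (hav : α ∈ avoidingParams p.re (Real.pi / 2 - p.im)) :
    closure ((fun z : ℂ => exp (exp z)) '' lineThrough p α) ≠ Set.univ := by
  rw [expexp_image_lineThrough]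
  set f : ℝ → ℂ := fun t => exp (exp (p + t * (I + α))) with hf
  have hsmooth : ContDiff ℝ 1 f :=
    ((contDiff_const.add (ofRealCLM.contDiff.mul contDiff_const)).cexp).cexp
  obtain ⟨η, hη, T, hT⟩ := exists_le_norm_expexp_add_one hα hav
  have hlim : Filter.Tendsto f Filter.atBot (nhds 1) := by
    rw [← exp_zero]
    refine (continuous_exp.tendsto 0).comp (tendsto_exp_nhds_zero_iff.2 ?_)
    have : (fun t : ℝ => (p + t * (I + α)).re) = fun t : ℝ => p.re + t * α := by
      ext t; simp
    rw [this]
    exact Filter.tendsto_atBot_add_const_left _ _ (Filter.tendsto_id.atBot_mul_const hα)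
  obtain ⟨T₀, hT₀⟩ := Filter.eventually_atBot.1
    (hlim.eventually (Metric.ball_mem_nhds 1 one_pos))
  have hdense := hsmooth.dense_compl_range_of_finrank_lt_finrank (by simp)
  obtain ⟨y, hyrange, hyball⟩ := hdense.exists_mem_open (Metric.isOpen_ball (x := (-1 : ℂ)))
    ⟨-1, Metric.mem_ball_self (lt_min hη one_pos)⟩
  intro huniv
  have hsub : Set.range f ⊆ f '' Set.Icc T₀ T ∪ (Metric.ball (-1) (min η 1))ᶜ := by
    rintro _ ⟨t, rfl⟩
    by_cases ht : t ∈ Set.Icc T₀ T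
    · exact Or.inl ⟨t, ht, rfl⟩
    · right
      rw [Set.mem_compl_iff, Metric.mem_ball, dist_eq_norm, sub_neg_eq_add, not_lt]
      rcases le_or_gt t T₀ with h | h
      · refine (min_le_right _ _).trans ?_
        have h1 := hT₀ t h
        rw [dist_eq_norm] at h1
        have h2 : ‖(2 : ℂ)‖ ≤ ‖f t + 1‖ + ‖f t - 1‖ := by
          refine le_trans (le_of_eq ?_) (norm_sub_le (f t + 1) (f t - 1))
          congr 1; ring
        rw [Complex.norm_ofNat] at h2
        linarith
      · have h1 : T ≤ t := by
          by_contra! hlt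
          exact ht ⟨h.le, hlt.le⟩
        exact (min_le_left _ _).trans (hT t h1)
  have hclosed : IsClosed (f '' Set.Icc T₀ T ∪ (Metric.ball (-1) (min η 1))ᶜ) :=
    (isCompact_Icc.image hsmooth.continuous).isClosed.union Metric.isOpen_ball.isClosed_compl
  rcases closure_minimal hsub hclosed (huniv ▸ Set.mem_univ y) with ⟨t, -, ht⟩ | h
  · exact hyrange ⟨t, ht⟩
  · exact h hyball

lemma closure_expexp_ne_univ_of_neg {p : ℂ} {α : ℝ} (hα : α < 0)
    (hav : -α ∈ avoidingParams p.re (Real.pi / 2 + p.im)) :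
    closure ((fun z : ℂ => exp (exp z)) '' lineThrough p α) ≠ Set.univ := by
  have h := closure_expexp_ne_univ_of_pos (p := starRingEnd ℂ p) (neg_pos.2 hα) (by simpa using hav)
  contrapose! h
  have himage : (fun z : ℂ => exp (exp z)) '' lineThrough (starRingEnd ℂ p) (-α) =
      conjCLE '' ((fun z : ℂ => exp (exp z)) '' lineThrough p α) := by
    simp only [expexp_image_lineThrough]
    rw [← Set.range_comp, ← (Equiv.neg ℝ).surjective.range_comp]
    congr 1
    ext1 t
    simp only [Function.comp_apply, Equiv.neg_apply, conjCLE_apply, ← exp_conj]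
    simp
    ring_nf
  rw [himage, ← conjCLE.image_closure, h, Set.image_univ, conjCLE.surjective.range_eq]

/-- For every `p ∈ ℂ` and nonempty open `X ⊆ ℝ`, the set of `α ∈ X` for which the
image of `L_α(p)` under `exp ∘ exp` is not dense has Hausdorff dimension `1`. -/
theorem expexp_nondense_set_dimH (p : ℂ) (X : Set ℝ) (hX : IsOpen X)
    (hXne : X.Nonempty) :
    dimH {α : ℝ | α ∈ X ∧
      closure ((fun z : ℂ => Complex.exp (Complex.exp z)) '' lineThrough p α)
        ≠ Set.univ} = 1 := by
  refine le_antisymm ((dimH_mono (Set.subset_univ _)).trans Real.dimH_univ.le) ?_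
  refine ENNReal.le_of_forall_nnreal_lt fun s hs => ?_
  have hs1 : s < 1 := by exact_mod_cast hs
  rcases eq_zero_or_pos s with rfl | hs0
  · simp
  obtain ⟨x, hx0, hxX⟩ := (dense_compl_singleton (0 : ℝ)).exists_mem_open hX hXne
  obtain ⟨δ, hδ, hball⟩ := Metric.isOpen_iff.1 hX x hxX
  have hδx : ∀ y, |y - x| ≤ δ / 2 → y ∈ X := fun y hy =>
    hball (by rw [Metric.mem_ball, Real.dist_eq]; linarith)
  rcases lt_or_gt_of_ne hx0 with hneg | hpos
  · refine (le_dimH_Icc_inter_avoidingParams (a := -x) (b := -x + δ / 2) (c := p.re)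
      (d := Real.pi / 2 + p.im) (neg_pos.2 hneg) (by linarith) hs0 hs1).trans ?_
    rw [← (IsometryEquiv.neg ℝ).dimH_image]
    refine dimH_mono ?_
    rintro _ ⟨α, ⟨hα, hav⟩, rfl⟩
    rw [IsometryEquiv.neg_apply]
    refine ⟨hδx _ ?_, closure_expexp_ne_univ_of_neg ?_ (by rwa [neg_neg])⟩
    · rw [abs_le]; constructor <;> linarith [hα.1, hα.2]
    · linarith [hα.1]
  · refine (le_dimH_Icc_inter_avoidingParams (a := x) (b := x + δ / 2) (c := p.re)
      (d := Real.pi / 2 - p.im) hpos (by linarith) hs0 hs1).trans (dimH_mono ?_)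
    rintro α ⟨hα, hav⟩
    refine ⟨hδx _ ?_, closure_expexp_ne_univ_of_pos (hpos.trans_le hα.1) hav⟩
    rw [abs_le]; constructor <;> linarith [hα.1, hα.2]
end

section
/- For every nonempty open interval I ⊆ (1, ∞), the set {θ ∈ I : the sequence (θ^k)_{k≥0} is not dense modulo 1} has Hausdorff dimension equal to 1. -/
/-- A sequence of reals is dense modulo 1 iff its fractional parts are dense in `[0,1]`. -/
def DenseMod1 (x : ℕ → ℝ) : Prop :=
  Set.Icc (0 : ℝ) 1 ⊆ closure {y : ℝ | ∃ k : ℕ, Int.fract (x k) = y}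

open Set in
/-- If the digit sequences over an alphabet of size `m` are coded by reals in such a way that
sequences first differing at `n` are sent to points at distance at least a constant times
`m ^ (-n / r)`, then the set of codes has Hausdorff dimension at least `r`. -/
theorem le_dimH_range_of_separated {m : ℕ} (hm : 1 < m) (g : (ℕ → Fin m) → ℝ) {r c : NNReal}
    (hr : 0 < r) (hc : 0 < c)
    (hg : ∀ b b' n, (∀ i < n, b i = b' i) → b n ≠ b' n →
      c * ((m : ℝ) ^ n)⁻¹ ≤ |g b - g b'| ^ (r : ℝ)) :
    (r : ENNReal) ≤ dimH (range g) := by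
  have key : ∀ b b', |Real.ofDigits b - Real.ofDigits b'| ≤ c⁻¹ * |g b - g b'| ^ (r : ℝ) := by
    intro b b'
    have hc' : (0 : ℝ) < c := hc
    by_cases h : b = b'
    · subst h
      simp only [sub_self, abs_zero]
      positivity
    · have h1 := hg b b' _ (fun i hi => PiNat.apply_eq_of_lt_firstDiff hi)
        (PiNat.apply_firstDiff_ne h)
      have h2 := Real.abs_ofDigits_sub_ofDigits_le (x := b) (y := b')
        (n := PiNat.firstDiff b b') (fun i hi => PiNat.apply_eq_of_lt_firstDiff hi)
      rw [NNReal.coe_inv, inv_mul_eq_div, le_div_iff₀ hc']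
      nlinarith
  have hinj : Function.Injective g := by
    intro b b' h
    by_contra hne
    have h1 := hg b b' _ (fun i hi => PiNat.apply_eq_of_lt_firstDiff hi)
      (PiNat.apply_firstDiff_ne hne)
    rw [h, sub_self, abs_zero, Real.zero_rpow (by exact_mod_cast hr.ne')] at h1
    have : 0 < (c : ℝ) * ((m : ℝ) ^ PiNat.firstDiff b b')⁻¹ := by
      have hc' : (0 : ℝ) < c := hc
      positivity
    linarith
  have : Nonempty (ℕ → Fin m) := ⟨fun _ => ⟨0, by omega⟩⟩
  have hold : HolderOnWith c⁻¹ r (Real.ofDigits ∘ Function.invFun g) (range g) := by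
    rintro _ ⟨b, rfl⟩ _ ⟨b', rfl⟩
    simp only [Function.comp, Function.leftInverse_invFun hinj _]
    have := key b b'
    rw [edist_dist, edist_dist, Real.dist_eq, Real.dist_eq,
      ENNReal.ofReal_rpow_of_nonneg (abs_nonneg _) r.coe_nonneg,
      ← ENNReal.ofReal_coe_nnreal (p := c⁻¹), ← ENNReal.ofReal_mul (by positivity)]
    exact ENNReal.ofReal_le_ofReal (by simpa using this)
  have hsub : Icc (0 : ℝ) 1 ⊆ (Real.ofDigits ∘ Function.invFun g) '' range g := by
    intro y hy
    obtain ⟨b, -, hb⟩ := Real.ofDigits_SurjOn hm hy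
    exact ⟨g b, ⟨b, rfl⟩, by simpa [Function.leftInverse_invFun hinj b] using hb⟩
  have h1 : dimH (Icc (0 : ℝ) 1) = 1 := by
    rw [Real.dimH_of_nonempty_interior (by rw [interior_Icc]; exact ⟨1 / 2, by norm_num⟩)]
    simp
  have h2 := (dimH_mono hsub).trans (hold.dimH_image_le hr)
  rw [h1] at h2
  have hr0 : (r : ENNReal) ≠ 0 := by exact_mod_cast hr.ne'
  rw [ENNReal.le_div_iff_mul_le (Or.inl hr0) (Or.inl ENNReal.coe_ne_top), one_mul] at h2
  exact h2

open Set in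
/-- Hausdorff dimension of a homogeneous Cantor set: at every stage an interval is divided into
`4 * m` equal parts, and `m` of the parts with even index are kept. -/
theorem le_dimH_of_cantor_scheme {m : ℕ} (hm : 1 < m) {r : NNReal} (hr : 0 < r)
    (hmr : (4 * m : ℝ) ^ (r : ℝ) ≤ m) {L : ℕ → ℝ} (hL0 : 0 < L 0)
    (hL : ∀ n, L n = 4 * m * L (n + 1)) {P : ℕ → ℝ → Prop} {x₀ : ℝ} (h0 : P 0 x₀)
    (hstep : ∀ n x, P n x → ∃ e : Fin m → ℕ, Function.Injective e ∧
      ∀ j, e j < 2 * m ∧ P (n + 1) (x + 2 * e j * L (n + 1))) :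
    (r : ENNReal) ≤ dimH {θ : ℝ | ∀ n, ∃ x, P n x ∧ θ ∈ Icc x (x + L n)} := by
  have hm0 : (0 : ℝ) < m := by exact_mod_cast (by omega : 0 < m)
  have hLpow : ∀ n, L n = L 0 / (4 * m) ^ n := by
    intro n
    induction n with
    | zero => simp
    | succ n ih =>
      have := hL n
      rw [pow_succ]
      field_simp at ih ⊢
      rw [← ih, this]
      ring
  have hLpos : ∀ n, 0 < L n := fun n => by rw [hLpow]; positivity
  have hstep' : ∀ n x, ∃ e : Fin m → ℕ, Function.Injective e ∧ (∀ j, e j < 2 * m) ∧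
      (P n x → ∀ j, P (n + 1) (x + 2 * e j * L (n + 1))) := by
    intro n x
    by_cases h : P n x
    · obtain ⟨e, he, h'⟩ := hstep n x h
      exact ⟨e, he, fun j => (h' j).1, fun _ j => (h' j).2⟩
    · exact ⟨fun j => j, Fin.val_injective, fun j => by dsimp only; omega, fun h' => absurd h' h⟩
  choose e he_inj he_lt he_P using hstep'
  let X : (ℕ → Fin m) → ℕ → ℝ := fun b n =>
    Nat.rec x₀ (fun n x => x + 2 * e n x (b n) * L (n + 1)) n
  have hXs : ∀ b n, X b (n + 1) = X b n + 2 * e n (X b n) (b n) * L (n + 1) := fun b n => rfl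
  have hXP : ∀ b n, P n (X b n) := by
    intro b n
    induction n with
    | zero => exact h0
    | succ n ih => exact he_P n _ ih _
  have hXcongr : ∀ b b' n, (∀ i < n, b i = b' i) → X b n = X b' n := by
    intro b b' n
    induction n with
    | zero => intro; rfl
    | succ n ih =>
      intro h
      rw [hXs, hXs, ih (fun i hi => h i (by omega)), h n (by omega)]
  have hmono : ∀ b, Monotone (X b) := fun b => monotone_nat_of_le_succ fun n => by
    rw [hXs]
    have := hLpos (n + 1)
    have : (0 : ℝ) ≤ 2 * e n (X b n) (b n) * L (n + 1) := by positivity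
    linarith
  have hanti : ∀ b, Antitone (fun n => X b n + L n) := fun b => antitone_nat_of_succ_le fun n => by
    rw [hXs, hL n]
    have h1 := hLpos (n + 1)
    have h2 : (e n (X b n) (b n) : ℝ) + 1 ≤ 2 * m := by exact_mod_cast he_lt n (X b n) (b n)
    nlinarith
  have hle : ∀ b n k, X b n ≤ X b k + L k := by
    intro b n k
    have h1 := hmono b (le_max_left n k)
    have h2 := hanti b (le_max_right n k)
    have h3 := hLpos (max n k)
    simp only at h2
    linarith
  have hbdd : ∀ b, BddAbove (range (X b)) := fun b => ⟨X b 0 + L 0, by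
    rintro _ ⟨n, rfl⟩; exact hle b n 0⟩
  have hg : ∀ b n, (⨆ k, X b k) ∈ Icc (X b n) (X b n + L n) := fun b n =>
    ⟨le_ciSup (hbdd b) n, ciSup_le fun k => hle b k n⟩
  have hsub : range (fun b => ⨆ k, X b k) ⊆ {θ : ℝ | ∀ n, ∃ x, P n x ∧ θ ∈ Icc x (x + L n)} := by
    rintro _ ⟨b, rfl⟩ n
    exact ⟨X b n, hXP b n, hg b n⟩
  refine le_trans ?_ (dimH_mono hsub)
  have hcpos : (0 : ℝ) < L 0 ^ (r : ℝ) / m := by positivity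
  refine le_dimH_range_of_separated hm _ (c := ⟨L 0 ^ (r : ℝ) / m, hcpos.le⟩) hr hcpos ?_
  intro b b' n heq hne
  have hX := hXcongr b b' n heq
  have g1 := hg b (n + 1)
  have g2 := hg b' (n + 1)
  rw [hXs] at g1 g2
  rw [← hX] at g2
  have hne' : e n (X b n) (b n) ≠ e n (X b n) (b' n) := fun h => hne (he_inj n _ h)
  have hl := hLpos (n + 1)
  have hdist : L (n + 1) ≤ |(⨆ k, X b k) - ⨆ k, X b' k| := by
    generalize (⨆ k, X b k) = u at *
    generalize (⨆ k, X b' k) = v at *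
    rcases lt_or_gt_of_ne hne' with h | h
    · have h' : (e n (X b n) (b n) : ℝ) + 1 ≤ e n (X b n) (b' n) := by exact_mod_cast h
      have h2 := mul_le_mul_of_nonneg_right h' hl.le
      rw [abs_sub_comm]
      refine le_trans ?_ (le_abs_self _)
      linarith [g1.1, g1.2, g2.1, g2.2]
    · have h' : (e n (X b n) (b' n) : ℝ) + 1 ≤ e n (X b n) (b n) := by exact_mod_cast h
      have h2 := mul_le_mul_of_nonneg_right h' hl.le
      refine le_trans ?_ (le_abs_self _)
      linarith [g1.1, g1.2, g2.1, g2.2]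
  refine le_trans ?_ (Real.rpow_le_rpow hl.le hdist r.coe_nonneg)
  rw [hLpow (n + 1), Real.div_rpow hL0.le (by positivity), ← Real.rpow_natCast_mul (by positivity),
    mul_comm ((n + 1 : ℕ) : ℝ), Real.rpow_mul_natCast (by positivity)]
  have : ((4 * m : ℝ) ^ (r : ℝ)) ^ (n + 1) ≤ (m : ℝ) ^ (n + 1) := by gcongr
  calc L 0 ^ (r : ℝ) / m * ((m : ℝ) ^ n)⁻¹ = L 0 ^ (r : ℝ) / (m : ℝ) ^ (n + 1) := by
        rw [pow_succ]; field_simp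
    _ ≤ _ := by gcongr

theorem mul_sub_le_pow_sub_pow {x y : ℝ} (hx : 0 ≤ x) (hxy : x ≤ y) (k : ℕ) :
    k * x ^ (k - 1) * (y - x) ≤ y ^ k - x ^ k := by
  rw [← (Commute.all y x).geom_sum₂_mul k]
  refine mul_le_mul_of_nonneg_right ?_ (by linarith)
  calc (k : ℝ) * x ^ (k - 1) = ∑ i ∈ Finset.range k, x ^ i * x ^ (k - 1 - i) := by
        rw [Finset.sum_congr rfl (g := fun _ => x ^ (k - 1)), Finset.sum_const,
          Finset.card_range, nsmul_eq_mul]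
        intro i hi
        rw [← pow_add]
        congr 1
        have := Finset.mem_range.mp hi
        omega
    _ ≤ _ := by gcongr

theorem pow_sub_pow_le_mul_sub {x y : ℝ} (hx : 0 ≤ x) (hxy : x ≤ y) (k : ℕ) :
    y ^ k - x ^ k ≤ k * y ^ (k - 1) * (y - x) := by
  rw [← (Commute.all y x).geom_sum₂_mul k]
  refine mul_le_mul_of_nonneg_right ?_ (by linarith)
  calc ∑ i ∈ Finset.range k, y ^ i * x ^ (k - 1 - i)
      ≤ ∑ i ∈ Finset.range k, y ^ i * y ^ (k - 1 - i) := by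
        have : 0 ≤ y := hx.trans hxy
        gcongr
    _ = (k : ℝ) * y ^ (k - 1) := by
        rw [Finset.sum_congr rfl (g := fun _ => y ^ (k - 1)), Finset.sum_const,
          Finset.card_range, nsmul_eq_mul]
        intro i hi
        rw [← pow_add]
        congr 1
        have := Finset.mem_range.mp hi
        omega

/-- On an interval where the linear variation of `θ ↦ θ ^ k` is at most one, its actual variation
is at most three. -/
theorem add_pow_le_pow_add_three {x ℓ : ℝ} {k : ℕ} (hx : 1 ≤ x) (hℓ : 0 ≤ ℓ)
    (hA : k * x ^ (k - 1) * ℓ ≤ 1) : (x + ℓ) ^ k ≤ x ^ k + 3 := by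
  have hx0 : 0 < x := by linarith
  have h1 := pow_sub_pow_le_mul_sub hx0.le (by linarith : x ≤ x + ℓ) k
  have hkℓ : k * ℓ ≤ 1 := by
    have : (1 : ℝ) ≤ x ^ (k - 1) := one_le_pow₀ hx
    have h0 : 0 ≤ k * ℓ := by positivity
    nlinarith
  have h2 : (x + ℓ) ^ (k - 1) ≤ x ^ (k - 1) * 3 := by
    have h3 : x + ℓ ≤ x * Real.exp ℓ := by
      have := Real.add_one_le_exp ℓ
      nlinarith
    calc (x + ℓ) ^ (k - 1) ≤ (x * Real.exp ℓ) ^ (k - 1) := by gcongr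
      _ = x ^ (k - 1) * Real.exp ((k - 1 : ℕ) * ℓ) := by rw [mul_pow, Real.exp_nat_mul]
      _ ≤ x ^ (k - 1) * Real.exp 1 := by
          gcongr
          refine le_trans ?_ hkℓ
          gcongr
          omega
      _ ≤ x ^ (k - 1) * 3 := by
          gcongr
          linarith [Real.exp_one_lt_d9]
  have h4 : k * (x + ℓ) ^ (k - 1) * (x + ℓ - x) ≤ k * (x ^ (k - 1) * 3) * ℓ := by
    rw [add_sub_cancel_left]
    gcongr
  nlinarith

open Set Classical in
/-- Among well separated short intervals over which `θ ^ k` varies slowly, at most four contain a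
`θ` for which `θ ^ k` is slightly larger than an integer. -/
theorem card_exists_fract_pow_mem_Ioo_le_four {x ℓ ε : ℝ} {k M : ℕ} (hx : 1 ≤ x) (hℓ : 0 ≤ ℓ)
    (hA : k * x ^ (k - 1) * (2 * M * ℓ) ≤ 1) (hε : ε < k * x ^ (k - 1) * ℓ) :
    ((Finset.range M).filter fun i : ℕ =>
      ∃ θ ∈ Icc (x + 2 * i * ℓ) (x + 2 * i * ℓ + ℓ), Int.fract (θ ^ k) ∈ Ioo 0 ε).card ≤ 4 := by
  set S := (Finset.range M).filter fun i : ℕ =>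
      ∃ θ ∈ Icc (x + 2 * i * ℓ) (x + 2 * i * ℓ + ℓ), Int.fract (θ ^ k) ∈ Ioo 0 ε with hS
  have hex : ∀ i : ℕ, ∃ θ : ℝ, i ∈ S →
      θ ∈ Icc (x + 2 * i * ℓ) (x + 2 * i * ℓ + ℓ) ∧ Int.fract (θ ^ k) ∈ Ioo 0 ε := by
    intro i
    by_cases hi : i ∈ S
    · obtain ⟨θ, h1, h2⟩ := (Finset.mem_filter.mp hi).2
      exact ⟨θ, fun _ => ⟨h1, h2⟩⟩
    · exact ⟨0, fun h => absurd h hi⟩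
  choose t ht using hex
  have hxt : ∀ i ∈ S, x ≤ t i := fun i hi => by
    have h := (ht i hi).1.1
    have : (0 : ℝ) ≤ 2 * i * ℓ := by positivity
    linarith
  have hcard : (Finset.Icc ⌊x ^ k⌋ (⌊x ^ k⌋ + 3)).card = 4 := by
    rw [Int.card_Icc]; omega
  rw [← hcard]
  refine Finset.card_le_card_of_injOn (fun i => ⌊t i ^ k⌋) ?_ ?_
  · intro i hi
    have hi' : i ∈ S := hi
    have h1 := hxt i hi'
    have hiM : (i : ℝ) + 1 ≤ M := by
      exact_mod_cast Finset.mem_range.mp (Finset.mem_filter.mp hi').1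
    have h2 : t i ≤ x + 2 * M * ℓ := by
      have := (ht i hi').1.2
      nlinarith
    have h3 : t i ^ k ≤ x ^ k + 3 :=
      (pow_le_pow_left₀ (by linarith) h2 k).trans
        (add_pow_le_pow_add_three hx (by positivity) hA)
    simp only [Finset.coe_Icc, mem_Icc]
    refine ⟨Int.floor_mono (pow_le_pow_left₀ (by linarith) h1 k), ?_⟩
    have := Int.floor_mono h3
    rwa [show x ^ k + 3 = x ^ k + ((3 : ℤ) : ℝ) by norm_num, Int.floor_add_intCast] at this
  · have hlt : ∀ i ∈ S, ∀ j ∈ S, i < j → ⌊t i ^ k⌋ ≠ ⌊t j ^ k⌋ := by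
      intro i hi j hj hij heq
      have hij' : (i : ℝ) + 1 ≤ j := by exact_mod_cast hij
      have h1 : ℓ ≤ t j - t i := by
        have := (ht i hi).1.2
        have := (ht j hj).1.1
        nlinarith
      have hti := hxt i hi
      have h2 := mul_sub_le_pow_sub_pow (by linarith) (by linarith : t i ≤ t j) k
      have h3 : k * x ^ (k - 1) * ℓ ≤ k * t i ^ (k - 1) * (t j - t i) := by
        have : 0 ≤ t i := by linarith
        gcongr
      have h4 := (ht i hi).2.1
      have h5 := (ht j hj).2.2
      rw [Int.fract] at h4 h5
      rw [heq] at h4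
      linarith
    intro i hi j hj h
    by_contra hne
    rcases lt_or_gt_of_ne hne with hij | hij
    · exact hlt i hi j hj hij h
    · exact hlt j hj i hi hij h.symm

/-- The exponents `k` for which `k * x ^ (k - 1) * ℓ` has a given order of magnitude lie in a short
block. -/
theorem exists_forall_mem_Ico_of_magnitude {x Q ℓ : ℝ} {N : ℕ} (hx : 1 ≤ x) (hQ : 0 < Q)
    (hℓ : 0 ≤ ℓ) (hN : Q ≤ x ^ N) : ∃ k₁ : ℕ, ∀ k : ℕ,
      1 / Q < k * x ^ (k - 1) * ℓ → k * x ^ (k - 1) * ℓ ≤ 1 → k ∈ Finset.Ico k₁ (k₁ + N) := by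
  set T := {k : ℕ | 1 / Q < k * x ^ (k - 1) * ℓ ∧ k * x ^ (k - 1) * ℓ ≤ 1}
  refine ⟨sInf T, fun k h1 h2 => ?_⟩
  have hk : k ∈ T := ⟨h1, h2⟩
  have hle := Nat.sInf_le hk
  have hmem := Nat.sInf_mem ⟨k, hk⟩
  generalize sInf T = k₁ at *
  rw [Finset.mem_Ico]
  refine ⟨hle, ?_⟩
  by_contra! hcon
  have h3 := hmem.1
  have hk1 : k₁ ≠ 0 := by
    rintro rfl
    simp only [CharP.cast_eq_zero, zero_mul] at h3
    have : 0 < 1 / Q := by positivity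
    linarith
  have h4 : (k₁ : ℝ) * x ^ (k₁ - 1) * x ^ N ≤ k * x ^ (k - 1) := by
    rw [mul_assoc, ← pow_add]
    have : (k₁ : ℝ) ≤ k := by exact_mod_cast hle
    have : x ^ (k₁ - 1 + N) ≤ x ^ (k - 1) := pow_le_pow_right₀ hx (by omega)
    gcongr
  have h5 : (1 : ℝ) < 1 := by
    calc (1 : ℝ) = 1 / Q * Q := by field_simp
      _ < (k₁ * x ^ (k₁ - 1) * ℓ) * Q := by gcongr
      _ ≤ (k₁ * x ^ (k₁ - 1) * ℓ) * x ^ N := by gcongr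
      _ = (k₁ * x ^ (k₁ - 1) * x ^ N) * ℓ := by ring
      _ ≤ k * x ^ (k - 1) * ℓ := by gcongr
      _ ≤ 1 := h2
  exact lt_irrefl _ h5

open Set in
/-- Powers whose fractional parts eventually avoid an interval to the right of `0` are not dense
modulo one. -/
theorem not_denseMod1_of_eventually {x : ℕ → ℝ} {ε : ℝ} (hε : 0 < ε) {k₀ : ℕ}
    (h : ∀ k ≥ k₀, Int.fract (x k) ∉ Ioo 0 ε) : ¬ DenseMod1 x := by
  intro hd
  set F : Set ℝ := (fun k => Int.fract (x k)) '' Iio k₀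
  have hF : F.Finite := (finite_Iio k₀).image _
  have hsub : {y : ℝ | ∃ k : ℕ, Int.fract (x k) = y} ⊆ F ∪ (Ioo 0 ε)ᶜ := by
    rintro _ ⟨k, rfl⟩
    by_cases hk : k < k₀
    · exact Or.inl ⟨k, hk, rfl⟩
    · exact Or.inr (h k (by omega))
  have h1 := hd.trans (closure_minimal hsub (hF.isClosed.union isOpen_Ioo.isClosed_compl))
  have h2 : Ioo 0 (min ε 1) ⊆ F := by
    intro y hy
    rcases h1 ⟨hy.1.le, hy.2.le.trans (min_le_right _ _)⟩ with h | h
    · exact h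
    · exact absurd ⟨hy.1, hy.2.trans_le (min_le_left _ _)⟩ h
  exact (Ioo_infinite (by positivity)) (hF.subset h2)

open Filter in
theorem exists_branching_parameter {a r : ℝ} (ha : 1 < a) (hr : r < 1) :
    ∃ N : ℕ, 0 < N ∧ (16 * N : ℝ) ≤ a ^ N ∧ (16 * N : ℝ) ^ r ≤ 4 * N := by
  have h1 : ∀ᶠ N : ℕ in atTop, (16 * N : ℝ) ≤ a ^ N := by
    have := tendsto_pow_const_div_const_pow_of_one_lt 1 ha
    filter_upwards [this.eventually_lt_const (by norm_num : (0 : ℝ) < 1 / 16)] with N hN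
    rw [pow_one, div_lt_iff₀ (by positivity)] at hN
    linarith
  have h2 : ∀ᶠ N : ℕ in atTop, (16 * N : ℝ) ^ r ≤ 4 * N := by
    have h3 : Tendsto (fun N : ℕ => (16 * N : ℝ) ^ (1 - r)) atTop atTop :=
      (tendsto_rpow_atTop (by linarith)).comp
        (tendsto_natCast_atTop_atTop.const_mul_atTop (by norm_num))
    filter_upwards [h3.eventually_ge_atTop 4, eventually_gt_atTop 0] with N hN hN0
    have hpos : (0 : ℝ) < 16 * N := by positivity
    have h4 : (16 * N : ℝ) ^ (1 - r) * (16 * N : ℝ) ^ r = 16 * N := by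
      rw [← Real.rpow_add hpos]; simp
    have h5 : 0 < (16 * N : ℝ) ^ r := by positivity
    nlinarith
  obtain ⟨N, h⟩ := ((eventually_gt_atTop 0).and (h1.and h2)).exists
  exact ⟨N, h⟩

open Set Classical in
theorem exists_good_children {a b ε ℓ ℓ' x : ℝ} {m N k₀ : ℕ} (ha : 1 ≤ a) (hm : 0 < m)
    (hN : (4 * m : ℝ) ≤ a ^ N) (hNm : 4 * N ≤ m) (hε : ε * (4 * m) ^ 2 < 1)
    (hℓ' : 0 < ℓ') (hℓ : ℓ = 4 * m * ℓ') (hax : a ≤ x) (hxb : x + ℓ ≤ b)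
    (h : ∀ k ≥ k₀, k * x ^ (k - 1) * ℓ ≤ 1 / (4 * m) →
      ∀ θ ∈ Icc x (x + ℓ), Int.fract (θ ^ k) ∉ Ioo 0 ε) :
    ∃ e : Fin m → ℕ, Function.Injective e ∧ ∀ j, e j < 2 * m ∧
      (a ≤ x + 2 * e j * ℓ' ∧ x + 2 * e j * ℓ' + ℓ' ≤ b ∧
      ∀ k ≥ k₀, k * (x + 2 * e j * ℓ') ^ (k - 1) * ℓ' ≤ 1 / (4 * m) →
      ∀ θ ∈ Icc (x + 2 * e j * ℓ') (x + 2 * e j * ℓ' + ℓ'), Int.fract (θ ^ k) ∉ Ioo 0 ε) := by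
  have hm0 : (0 : ℝ) < m := by exact_mod_cast hm
  have hx1 : 1 ≤ x := ha.trans hax
  have hℓ0 : 0 < ℓ := by rw [hℓ]; positivity
  obtain ⟨k₁, hk₁⟩ := exists_forall_mem_Ico_of_magnitude (N := N) hx1
    (by positivity : (0 : ℝ) < 4 * m) hℓ0.le
    (hN.trans (pow_le_pow_left₀ (by linarith) hax N))
  set bad : ℕ → Finset ℕ := fun k => (Finset.range (2 * m)).filter fun i : ℕ =>
    ∃ θ ∈ Icc (x + 2 * i * ℓ') (x + 2 * i * ℓ' + ℓ'), Int.fract (θ ^ k) ∈ Ioo 0 ε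
  set K := (Finset.Ico k₁ (k₁ + N)).filter fun k : ℕ =>
    1 / (4 * m) < k * x ^ (k - 1) * ℓ ∧ k * x ^ (k - 1) * ℓ ≤ 1
  have hbad : (K.biUnion bad).card ≤ m := by
    refine (Finset.card_biUnion_le_card_mul K bad 4 ?_).trans ?_
    · intro k hk
      obtain ⟨h1, h2⟩ := (Finset.mem_filter.mp hk).2
      refine card_exists_fract_pow_mem_Ioo_le_four hx1 hℓ'.le ?_ ?_
      · convert h2 using 2
        rw [hℓ]; push_cast; ring
      · rw [hℓ, div_lt_iff₀ (by positivity)] at h1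
        have h3 : ε * (4 * m) ^ 2 < (k * x ^ (k - 1) * ℓ') * (4 * m) ^ 2 := by linarith
        exact lt_of_mul_lt_mul_right h3 (by positivity)
    · have : K.card ≤ N := (Finset.card_filter_le _ _).trans (by simp)
      omega
  set G := Finset.range (2 * m) \ K.biUnion bad with hG
  have hGcard : m ≤ G.card := by
    have := Finset.le_card_sdiff (K.biUnion bad) (Finset.range (2 * m))
    rw [Finset.card_range, ← hG] at this
    omega
  refine ⟨G.orderEmbOfCardLe hGcard, (G.orderEmbOfCardLe hGcard).injective, fun j => ?_⟩
  have hj := G.orderEmbOfCardLe_mem hGcard j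
  generalize G.orderEmbOfCardLe hGcard j = i at *
  obtain ⟨hi, hiK⟩ := Finset.mem_sdiff.mp hj
  rw [Finset.mem_range] at hi
  have hi' : (i : ℝ) + 1 ≤ 2 * m := by exact_mod_cast hi
  have hi0 : 0 ≤ 2 * i * ℓ' := by positivity
  have hend : x + 2 * i * ℓ' + ℓ' ≤ x + ℓ := by rw [hℓ]; nlinarith
  refine ⟨hi, by linarith, by linarith, fun k hk hkA θ hθ hfr => ?_⟩
  by_cases hkx : k * x ^ (k - 1) * ℓ ≤ 1 / (4 * m)
  · exact h k hk hkx θ ⟨by linarith [hθ.1], by linarith [hθ.2]⟩ hfr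
  · push Not at hkx
    have h2 : k * x ^ (k - 1) * ℓ ≤ 1 := by
      rw [le_div_iff₀ (by positivity)] at hkA
      have h3 : k * x ^ (k - 1) * ℓ' * (4 * m) ≤
          k * (x + 2 * i * ℓ') ^ (k - 1) * ℓ' * (4 * m) := by
        gcongr
        linarith
      rw [hℓ]
      linarith
    refine hiK (Finset.mem_biUnion.mpr ⟨k, ?_, ?_⟩)
    · exact Finset.mem_filter.mpr ⟨hk₁ k hkx h2, hkx, h2⟩
    · exact Finset.mem_filter.mpr ⟨Finset.mem_range.mpr hi, θ, hθ, hfr⟩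

open Set Filter in
theorem le_dimH_powers_not_dense {a b : ℝ} (ha : 1 < a) (hab : a < b) {r : NNReal} (hr0 : 0 < r)
    (hr : r < 1) :
    (r : ENNReal) ≤ dimH {θ : ℝ | θ ∈ Icc a b ∧ ¬ DenseMod1 (fun k : ℕ => θ ^ k)} := by
  obtain ⟨N, hN0, hN1, hN2⟩ := exists_branching_parameter ha (r := r) (by exact_mod_cast hr)
  set m := 4 * N with hm
  have hm4 : (4 * m : ℝ) = 16 * N := by rw [hm]; push_cast; ring
  have hm0 : (0 : ℝ) < m := by positivity
  have hQ : (1 : ℝ) < 4 * m := by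
    have : (1 : ℝ) ≤ N := by exact_mod_cast hN0
    linarith
  set ε : ℝ := 1 / (2 * (4 * m) ^ 2) with hε
  have hε0 : 0 < ε := by positivity
  have hε1 : ε * (4 * m) ^ 2 < 1 := by
    rw [hε]; field_simp; norm_num
  set L : ℕ → ℝ := fun n => (b - a) / (4 * m) ^ n with hLdef
  have hba : 0 < b - a := by linarith
  have hLpos : ∀ n, 0 < L n := fun n => by positivity
  have hL : ∀ n, L n = 4 * m * L (n + 1) := fun n => by
    simp only [hLdef, pow_succ]; field_simp
  have hLlim : Tendsto L atTop (nhds 0) :=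
    (tendsto_pow_atTop_atTop_of_one_lt hQ).const_div_atTop _
  obtain ⟨k₀, hk₀⟩ := exists_nat_gt (1 / (b - a))
  set P : ℕ → ℝ → Prop := fun n x => a ≤ x ∧ x + L n ≤ b ∧
    ∀ k ≥ k₀, k * x ^ (k - 1) * L n ≤ 1 / (4 * m) →
      ∀ θ ∈ Icc x (x + L n), Int.fract (θ ^ k) ∉ Ioo 0 ε with hP
  have hP0 : P 0 a := by
    refine ⟨le_rfl, by simp [hLdef], fun k hk hkA => ?_⟩
    exfalso
    have hL0 : L 0 = b - a := by simp [hLdef]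
    rw [hL0] at hkA
    have h1 : (1 : ℝ) / (4 * m) < 1 := by
      rw [div_lt_one (by positivity)]; exact hQ
    have h2 : (1 : ℝ) ≤ a ^ (k - 1) := one_le_pow₀ ha.le
    have h3 : (k₀ : ℝ) ≤ k := by exact_mod_cast hk
    have h4 : 1 < k * (b - a) := by
      rw [div_lt_iff₀ hba] at hk₀
      nlinarith
    nlinarith
  refine (le_dimH_of_cantor_scheme (by omega : 1 < m) hr0 (by rw [hm4, hm]; push_cast; exact hN2)
    (hLpos 0) hL hP0 ?_).trans (dimH_mono ?_)
  · rintro n x ⟨h1, h2, h3⟩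
    exact exists_good_children ha.le (by omega) (by rw [hm4]; exact hN1) hm.ge hε1 (hLpos _)
      (hL n) h1 h2 h3
  · intro θ hθ
    refine ⟨?_, not_denseMod1_of_eventually hε0 (k₀ := k₀) fun k hk => ?_⟩
    · obtain ⟨x, hx, h⟩ := hθ 0
      exact ⟨hx.1.trans h.1, h.2.trans hx.2.1⟩
    · have hlim : Tendsto (fun n => k * b ^ (k - 1) * L n) atTop (nhds 0) := by
        simpa using hLlim.const_mul (k * b ^ (k - 1))
      obtain ⟨n, hn⟩ := (hlim.eventually_lt_const
        (by positivity : (0 : ℝ) < 1 / (4 * m))).exists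
      obtain ⟨x, hx, h⟩ := hθ n
      refine hx.2.2 k hk (le_trans ?_ hn.le) θ h
      have := hLpos n
      have : 0 ≤ x := by linarith [hx.1]
      have : x ≤ b := by linarith [hx.2.1]
      gcongr

/-- For every nonempty open interval `I ⊆ (1, ∞)`, the set of `θ ∈ I` for which
the sequence `(θ^k)_{k ≥ 0}` is not dense modulo 1 has Hausdorff dimension `1`. -/
theorem powers_not_dense_mod_one_dimH (I : Set ℝ) (hIopen : IsOpen I)
    (hIintvl : I.OrdConnected) (hIne : I.Nonempty) (hI : I ⊆ Set.Ioi (1 : ℝ)) :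
    dimH {θ : ℝ | θ ∈ I ∧ ¬ DenseMod1 (fun k : ℕ => θ ^ k)} = 1 := by
  refine le_antisymm ((dimH_mono (Set.subset_univ _)).trans Real.dimH_univ.le) ?_
  obtain ⟨a, haI⟩ := hIne
  obtain ⟨δ, hδ, hball⟩ := Metric.isOpen_iff.mp hIopen a haI
  have hsub : Set.Icc a (a + δ / 2) ⊆ I := fun θ hθ => hball <| by
    rw [Metric.mem_ball, Real.dist_eq, abs_lt]
    constructor <;> linarith [hθ.1, hθ.2]
  refine ENNReal.le_of_forall_nnreal_lt fun r hr => ?_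
  rcases eq_zero_or_pos r with rfl | hr0
  · simp
  · refine (le_dimH_powers_not_dense (hI haI) (by linarith : a < a + δ / 2) hr0
      (by exact_mod_cast hr)).trans (dimH_mono ?_)
    rintro θ ⟨h1, h2⟩
    exact ⟨hsub h1, h2⟩
end

section
/- Let p ∈ ℂ and α ∈ ℝ with α ≠ 0, and define ρ : ℝ → ℂ by ρ(t) = exp(exp(p + t(i + α))). Regard ρ as taking values in the one-point compactification ℂ ∪ {∞} of ℂ. Then for every continuous function f : ℂ ∪ {∞} → ℝ, the averages (1/(2T)) ∫_{−T}^{T} f(ρ(t)) dt converge, as T → ∞, to f(0)/4 + f(1)/2 + f(∞)/4. Equivalently, the probability measures μ_T(A) := (1/(2T))·m({t ∈ [−T,T] : ρ(t) ∈ A}) converge in the weak* topology to (1/4)δ_0 + (1/2)δ_1 + (1/4)δ_∞. -/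
open Complex Filter OnePoint

/-- If the integrals of a bounded continuous function over consecutive intervals of length `P`
converge to `P * L`, then its averages over `[0, T]` converge to `L`. -/
theorem tendsto_average_of_tendsto_integral_period {F : ℝ → ℝ} (hF : Continuous F) {M P L : ℝ}
    (hM : ∀ x, |F x| ≤ M) (hP : 0 < P)
    (h : Tendsto (fun n : ℕ => ∫ t in (n * P)..((n + 1 : ℕ) * P), F t) atTop (nhds (P * L))) :
    Tendsto (fun T : ℝ => (1 / T) * ∫ t in (0 : ℝ)..T, F t) atTop (nhds L) := by
  have hint : ∀ a b : ℝ, IntervalIntegrable F MeasureTheory.volume a b :=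
    fun a b => hF.intervalIntegrable a b
  have hsum : ∀ N : ℕ, ∑ n ∈ Finset.range N, ∫ t in (n * P)..((n + 1 : ℕ) * P), F t =
      ∫ t in (0 : ℝ)..(N * P), F t := by
    intro N
    simpa using intervalIntegral.sum_integral_adjacent_intervals (f := F)
      (a := fun n : ℕ => (n : ℝ) * P) (n := N) (fun k _ => hint _ _)
  have hces : Tendsto (fun N : ℕ => (N : ℝ)⁻¹ * ∫ t in (0 : ℝ)..(N * P), F t) atTop
      (nhds (P * L)) := by
    simpa only [hsum] using h.cesaro
  have hfloor : Tendsto (fun T : ℝ => ⌊P⁻¹ * T⌋₊) atTop atTop :=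
    tendsto_nat_floor_atTop.comp (tendsto_id.const_mul_atTop (inv_pos.2 hP))
  have hmain := (tendsto_nat_floor_mul_div_atTop (R := ℝ) (inv_pos.2 hP).le).mul
    (hces.comp hfloor)
  rw [inv_mul_cancel_left₀ hP.ne'] at hmain
  have herr : Tendsto (fun T : ℝ => (1 / T) * ∫ t in (⌊P⁻¹ * T⌋₊ * P)..T, F t) atTop
      (nhds 0) := by
    refine squeeze_zero_norm' (a := fun T => (M * P) * T⁻¹) ?_
      (by simpa using tendsto_inv_atTop_zero.const_mul (M * P))
    filter_upwards [eventually_gt_atTop 0] with T hT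
    have hM0 : 0 ≤ M := (abs_nonneg _).trans (hM 0)
    have h1 := intervalIntegral.norm_integral_le_of_norm_le_const (f := F)
      (a := ⌊P⁻¹ * T⌋₊ * P) (b := T) (C := M) (fun x _ => hM x)
    have h2 : (⌊P⁻¹ * T⌋₊ : ℝ) * P ≤ T := by
      have := mul_le_mul_of_nonneg_right (Nat.floor_le (a := P⁻¹ * T) (by positivity)) hP.le
      rwa [mul_right_comm, inv_mul_cancel₀ hP.ne', one_mul] at this
    have h3 : T ≤ (⌊P⁻¹ * T⌋₊ : ℝ) * P + P := by
      have := mul_le_mul_of_nonneg_right (Nat.lt_floor_add_one (P⁻¹ * T)).le hP.le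
      rw [mul_right_comm, inv_mul_cancel₀ hP.ne', one_mul] at this
      linarith
    rw [abs_of_nonneg (by linarith)] at h1
    rw [norm_mul, Real.norm_of_nonneg (by positivity : 0 ≤ 1 / T), one_div, mul_comm]
    gcongr
    exact h1.trans (by gcongr; linarith)
  have hadd := hmain.add herr
  rw [add_zero] at hadd
  refine hadd.congr' ?_
  filter_upwards [hfloor.eventually_gt_atTop 0] with T hT
  have hN : ((⌊P⁻¹ * T⌋₊ : ℕ) : ℝ) ≠ 0 := by exact_mod_cast hT.ne'
  rw [← intervalIntegral.integral_add_adjacent_intervals (hint 0 (⌊P⁻¹ * T⌋₊ * P)) (hint _ T)]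
  simp only [Function.comp_apply]
  rw [← mul_assoc, div_mul_eq_mul_div, mul_inv_cancel₀ hN, ← mul_add]

/-- Averages of a bounded continuous function converge to `L` if its values at antipodal phases
of the period `2π` asymptotically sum to `2 * L`. -/
theorem tendsto_average_of_ae_tendsto_add {F : ℝ → ℝ} (hF : Continuous F) {M L : ℝ}
    (hM : ∀ x, |F x| ≤ M)
    (h : ∀ᵐ u : ℝ, Tendsto (fun n : ℕ => F (u + n * (2 * Real.pi)) +
      F (u + Real.pi + n * (2 * Real.pi))) atTop (nhds (2 * L))) :
    Tendsto (fun T : ℝ => (1 / T) * ∫ t in (0 : ℝ)..T, F t) atTop (nhds L) := by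
  refine tendsto_average_of_tendsto_integral_period hF hM Real.two_pi_pos ?_
  have hint : ∀ a b : ℝ, IntervalIntegrable F MeasureTheory.volume a b :=
    fun a b => hF.intervalIntegrable a b
  have key : Tendsto (fun n : ℕ => ∫ u in (0 : ℝ)..Real.pi, (F (u + n * (2 * Real.pi)) +
      F (u + Real.pi + n * (2 * Real.pi)))) atTop
      (nhds (∫ _ in (0 : ℝ)..Real.pi, 2 * L)) := by
    refine intervalIntegral.tendsto_integral_filter_of_dominated_convergence (fun _ => M + M)
      ?_ ?_ ?_ ?_
    · exact Eventually.of_forall fun n =>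
        (by fun_prop : Continuous fun u => F (u + n * (2 * Real.pi)) +
          F (u + Real.pi + n * (2 * Real.pi))).aestronglyMeasurable
    · exact Eventually.of_forall fun n => Eventually.of_forall fun u _ =>
        (norm_add_le _ _).trans (add_le_add (hM _) (hM _))
    · exact intervalIntegrable_const
    · filter_upwards [h] with u hu _ using hu
  rw [intervalIntegral.integral_const, sub_zero, smul_eq_mul,
    show Real.pi * (2 * L) = 2 * Real.pi * L by ring] at key
  refine key.congr fun n => ?_
  rw [intervalIntegral.integral_add
    ((by fun_prop : Continuous fun u => F (u + n * (2 * Real.pi))).intervalIntegrable _ _)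
    ((by fun_prop :
      Continuous fun u => F (u + Real.pi + n * (2 * Real.pi))).intervalIntegrable _ _)]
  simp only [add_assoc]
  rw [intervalIntegral.integral_comp_add_right, intervalIntegral.integral_comp_add_right,
    zero_add, zero_add, add_comm Real.pi (n * (2 * Real.pi)),
    show Real.pi + (n * (2 * Real.pi) + Real.pi) = (n + 1 : ℕ) * (2 * Real.pi) by
      push_cast; ring]
  exact intervalIntegral.integral_add_adjacent_intervals (hint _ _) (hint _ _)

theorem tendsto_coe_exp_comap_re_atTop :
    Tendsto (fun z : ℂ => (Complex.exp z : OnePoint ℂ)) (comap re atTop) (nhds ∞) := by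
  refine OnePoint.tendsto_coe_infty.comp ?_
  rw [coclosedCompact_eq_cocompact, ← Metric.cobounded_eq_cocompact]
  exact tendsto_exp_comap_re_atTop

theorem tendsto_coe_exp_comap_re_atBot :
    Tendsto (fun z : ℂ => (Complex.exp z : OnePoint ℂ)) (comap re atBot)
      (nhds ((0 : ℂ) : OnePoint ℂ)) :=
  (OnePoint.continuous_coe.tendsto 0).comp
    tendsto_exp_comap_re_atBot

section Ray

variable (p : ℂ) (ω α : ℝ)

theorem continuous_comp_exp_exp_ray {f : OnePoint ℂ → ℝ} (hf : Continuous f) :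
    Continuous fun t : ℝ =>
      f (Complex.exp (Complex.exp (p + (t : ℂ) * (ω * Complex.I + α))) : ℂ) :=
  hf.comp (OnePoint.continuous_coe.comp (by fun_prop))

theorem exists_abs_le_of_continuous {X : Type*} [TopologicalSpace X] [CompactSpace X]
    {f : X → ℝ} (hf : Continuous f) : ∃ M, ∀ x, |f x| ≤ M := by
  obtain ⟨M, hM⟩ := isCompact_univ.exists_bound_of_continuousOn hf.continuousOn
  exact ⟨M, fun x => hM x (Set.mem_univ x)⟩

theorem re_exp_ray (t : ℝ) :
    (Complex.exp (p + (t : ℂ) * (ω * Complex.I + α))).re =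
      Real.exp (p.re + t * α) * Real.cos (p.im + ω * t) := by
  simp [Complex.exp_re, mul_comm]

theorem tendsto_average_exp_exp_ray_of_neg {α : ℝ} (hα : α < 0) {f : OnePoint ℂ → ℝ}
    (hf : Continuous f) :
    Tendsto (fun T : ℝ => (1 / T) * ∫ t in (0 : ℝ)..T,
      f (Complex.exp (Complex.exp (p + (t : ℂ) * (ω * Complex.I + α))) : ℂ)) atTop
      (nhds (f ((1 : ℂ) : OnePoint ℂ))) := by
  obtain ⟨M, hM⟩ := exists_abs_le_of_continuous hf
  refine tendsto_average_of_ae_tendsto_add (continuous_comp_exp_exp_ray p ω α hf)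
    (fun _ => hM _) (Eventually.of_forall fun u => ?_)
  have hlim : Tendsto (fun t : ℝ =>
      f (Complex.exp (Complex.exp (p + (t : ℂ) * (ω * Complex.I + α))) : ℂ)) atTop
      (nhds (f ((1 : ℂ) : OnePoint ℂ))) := by
    have h0 : Tendsto (fun t : ℝ => Complex.exp (p + (t : ℂ) * (ω * Complex.I + α))) atTop
        (nhds 0) := by
      rw [Complex.tendsto_exp_nhds_zero_iff]
      simpa using tendsto_atBot_add_const_left _ p.re (tendsto_id.atTop_mul_const_of_neg hα)
    have h1 := (hf.comp (OnePoint.continuous_coe.comp Complex.continuous_exp)).tendsto 0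
    simpa [Function.comp_def] using h1.comp h0
  have hseq : ∀ v : ℝ, Tendsto (fun n : ℕ => v + n * (2 * Real.pi)) atTop atTop := fun v =>
    tendsto_atTop_add_const_left _ v
      (tendsto_natCast_atTop_atTop.atTop_mul_const Real.two_pi_pos)
  rw [two_mul (f _)]
  exact (hlim.comp (hseq u)).add (hlim.comp (hseq (u + Real.pi)))

theorem ae_cos_add_mul_ne_zero (b : ℝ) {ω : ℝ} (hω : ω ≠ 0) :
    ∀ᵐ u : ℝ, Real.cos (b + ω * u) ≠ 0 := by
  have hc : (Set.range fun k : ℤ => ((2 * k + 1) * Real.pi / 2 - b) / ω).Countable :=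
    Set.countable_range _
  filter_upwards [hc.ae_notMem MeasureTheory.volume] with u hu hcos
  obtain ⟨k, hk⟩ := Real.cos_eq_zero_iff.1 hcos
  refine hu ⟨k, ?_⟩
  simp only [← hk]
  field_simp
  ring

theorem cos_add_mul_add_nat_mul_two_pi (b u : ℝ) {ω : ℝ} (hω : ω = 1 ∨ ω = -1) (n : ℕ) :
    Real.cos (b + ω * (u + n * (2 * Real.pi))) = Real.cos (b + ω * u) := by
  rcases hω with rfl | rfl
  · rw [← Real.cos_add_nat_mul_two_pi (b + 1 * u) n]
    ring_nf
  · rw [← Real.cos_sub_nat_mul_two_pi (b + -1 * u) n]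
    ring_nf

theorem cos_add_mul_add_pi (b u : ℝ) {ω : ℝ} (hω : ω = 1 ∨ ω = -1) :
    Real.cos (b + ω * (u + Real.pi)) = -Real.cos (b + ω * u) := by
  rcases hω with rfl | rfl
  · rw [← Real.cos_add_pi]
    ring_nf
  · rw [← Real.cos_sub_pi]
    ring_nf

theorem tendsto_average_exp_exp_ray_of_pos {ω : ℝ} (hω : ω = 1 ∨ ω = -1) {α : ℝ} (hα : 0 < α)
    {f : OnePoint ℂ → ℝ} (hf : Continuous f) :
    Tendsto (fun T : ℝ => (1 / T) * ∫ t in (0 : ℝ)..T,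
      f (Complex.exp (Complex.exp (p + (t : ℂ) * (ω * Complex.I + α))) : ℂ)) atTop
      (nhds ((f ((0 : ℂ) : OnePoint ℂ) + f ∞) / 2)) := by
  obtain ⟨M, hM⟩ := exists_abs_le_of_continuous hf
  refine tendsto_average_of_ae_tendsto_add (continuous_comp_exp_exp_ray p ω α hf)
    (fun _ => hM _) ?_
  have hexp : ∀ v : ℝ, Tendsto (fun n : ℕ => Real.exp (p.re + (v + n * (2 * Real.pi)) * α))
      atTop atTop := fun v =>
    Real.tendsto_exp_atTop.comp <| tendsto_atTop_add_const_left _ _ <|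
      (tendsto_atTop_add_const_left _ v
        (tendsto_natCast_atTop_atTop.atTop_mul_const Real.two_pi_pos)).atTop_mul_const hα
  have hpos : ∀ v : ℝ, 0 < Real.cos (p.im + ω * v) → Tendsto (fun n : ℕ =>
      f (Complex.exp (Complex.exp (p + ((v + n * (2 * Real.pi) : ℝ) : ℂ) *
        (ω * Complex.I + α))) : ℂ)) atTop (nhds (f ∞)) := by
    intro v hv
    refine ((hf.tendsto _).comp tendsto_coe_exp_comap_re_atTop).comp (tendsto_comap_iff.2 ?_)
    simp only [Function.comp_def, re_exp_ray, cos_add_mul_add_nat_mul_two_pi _ _ hω]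
    exact (hexp v).atTop_mul_const hv
  have hneg : ∀ v : ℝ, Real.cos (p.im + ω * v) < 0 → Tendsto (fun n : ℕ =>
      f (Complex.exp (Complex.exp (p + ((v + n * (2 * Real.pi) : ℝ) : ℂ) *
        (ω * Complex.I + α))) : ℂ)) atTop (nhds (f ((0 : ℂ) : OnePoint ℂ))) := by
    intro v hv
    refine ((hf.tendsto _).comp tendsto_coe_exp_comap_re_atBot).comp (tendsto_comap_iff.2 ?_)
    simp only [Function.comp_def, re_exp_ray, cos_add_mul_add_nat_mul_two_pi _ _ hω]
    exact (hexp v).atTop_mul_const_of_neg hv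
  filter_upwards [ae_cos_add_mul_ne_zero p.im (by rcases hω with rfl | rfl <;> norm_num : ω ≠ 0)]
    with u hu
  rw [mul_div_cancel₀ _ (two_ne_zero' ℝ)]
  have hshift := cos_add_mul_add_pi p.im u hω
  rcases hu.lt_or_gt with h | h
  · exact (hneg u h).add (hpos (u + Real.pi) (by linarith))
  · rw [add_comm (f _)]
    exact (hpos u h).add (hneg (u + Real.pi) (by linarith))

end Ray

/-- For an oblique line, the time averages of any continuous function on the
one-point compactification of `ℂ` along `ρ(t) = exp(exp(p + t(i + α)))` converge
to `f(0)/4 + f(1)/2 + f(∞)/4`; i.e. the distributions `μ_T` converge weakly-* to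
`(1/4)δ₀ + (1/2)δ₁ + (1/4)δ_∞`. -/
theorem expexp_line_distribution (p : ℂ) (α : ℝ) (hα : α ≠ 0)
    (ρ : ℝ → ℂ) (hρ : ∀ t : ℝ, ρ t = Complex.exp (Complex.exp (p + (t : ℂ) * (Complex.I + (α : ℂ)))))
    (f : OnePoint ℂ → ℝ) (hf : Continuous f) :
    Tendsto (fun T : ℝ => (1 / (2 * T)) * ∫ t in (-T)..T, f ((ρ t : ℂ) : OnePoint ℂ))
      atTop
      (nhds (f (((0 : ℂ) : OnePoint ℂ)) / 4 + f (((1 : ℂ) : OnePoint ℂ)) / 2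
        + f (∞ : OnePoint ℂ) / 4)) := by
  have hright : ∀ t : ℝ, f (ρ t : ℂ) =
      f (Complex.exp (Complex.exp (p + (t : ℂ) * ((1 : ℝ) * Complex.I + α))) : ℂ) := by
    intro t
    rw [hρ, ofReal_one, one_mul]
  have hleft : ∀ t : ℝ, f (ρ (-t) : ℂ) =
      f (Complex.exp (Complex.exp (p + (t : ℂ) * ((-1 : ℝ) * Complex.I + (-α : ℝ)))) : ℂ) := by
    intro t
    rw [hρ]
    congr 4
    push_cast
    ring
  have hcont : Continuous fun t : ℝ => f (ρ t : ℂ) := by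
    simpa only [hright] using continuous_comp_exp_exp_ray p 1 α hf
  have hsplit : ∀ T : ℝ, (1 / (2 * T)) * ∫ t in (-T)..T, f (ρ t : ℂ) =
      1 / 2 * ((1 / T) * ∫ t in (0 : ℝ)..T, f (ρ (-t) : ℂ)) +
        1 / 2 * ((1 / T) * ∫ t in (0 : ℝ)..T, f (ρ t : ℂ)) := by
    intro T
    rw [intervalIntegral.integral_comp_neg (fun t => f (ρ t : ℂ)), neg_zero,
      ← intervalIntegral.integral_add_adjacent_intervals (hcont.intervalIntegrable (-T) 0)
        (hcont.intervalIntegrable 0 T)]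
    ring
  simp only [hsplit]
  simp only [hleft, hright]
  rcases hα.lt_or_gt with h | h
  · convert ((tendsto_average_exp_exp_ray_of_pos p (.inr rfl) (neg_pos.2 h) hf).const_mul
      (1 / 2)).add ((tendsto_average_exp_exp_ray_of_neg p 1 h hf).const_mul (1 / 2)) using 2
    ring
  · convert ((tendsto_average_exp_exp_ray_of_neg p (-1) (neg_lt_zero.2 h) hf).const_mul
      (1 / 2)).add ((tendsto_average_exp_exp_ray_of_pos p (.inl rfl) h hf).const_mul
      (1 / 2)) using 2
    ring
end

section
/- Let p ∈ ℂ and α > 0, and let Σ : ℝ → ℂ, Σ(t) = exp(p + t(i + α)), parametrise the logarithmic spiral exp(L_α(p)). For k ∈ ℤ let t_k := π/2 − Im(p) + kπ, so that Σ(t) lies on the imaginary axis exactly when t = t_k for some k, with Σ(t_k) = (−1)^k · i · e^{Re(p) + t_k α}, and |Σ(t_k)| is increasing in k. Then the image exp(Σ(ℝ)) = (exp ∘ exp) '' L_α(p) is dense in ℂ if and only if the sequence (Σ(t_k)/(2πi))_{k≥0} = ((−1)^k e^{Re(p) + t_k α}/(2π))_{k≥0} is dense modulo 1. -/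
open Complex Real

open Filter Topology

/-! ### Density modulo one -/

lemma exp_two_pi_mul_fract_mul_I (x : ℝ) :
    cexp ((2 * π * Int.fract x : ℝ) * I) = cexp ((2 * π * x : ℝ) * I) := by
  have h : (((2 * π * x : ℝ) : ℂ) * I)
      = ((2 * π * Int.fract x : ℝ) : ℂ) * I + (⌊x⌋ : ℂ) * (2 * π * I) := by
    have : (x : ℂ) = ((Int.fract x : ℝ) : ℂ) + (⌊x⌋ : ℂ) := by
      exact_mod_cast (Int.fract_add_floor x).symm
    push_cast
    rw [this]
    ring
  rw [h, Complex.exp_add, Complex.exp_int_mul_two_pi_mul_I, mul_one]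

/-- A left inverse of `y ↦ exp (2πiy)` on `[0, 1)`, continuous on the circle away from `1`. -/
noncomputable def circleCoord (z : ℂ) : ℝ := 1 / 2 - Complex.arg (-(starRingEnd ℂ) z) / (2 * π)

lemma neg_conj_exp_two_pi_mul_I (y : ℝ) :
    -(starRingEnd ℂ) (cexp ((2 * π * y : ℝ) * I))
      = Complex.cos ((π - 2 * π * y : ℝ) : ℂ) + Complex.sin ((π - 2 * π * y : ℝ) : ℂ) * I := by
  rw [Complex.exp_mul_I, ← Complex.ofReal_cos, ← Complex.ofReal_sin, ← Complex.ofReal_cos,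
    ← Complex.ofReal_sin, Real.cos_pi_sub, Real.sin_pi_sub]
  apply Complex.ext <;> simp [-Complex.ofReal_cos, -Complex.ofReal_sin]

lemma circleCoord_exp {y : ℝ} (hy : y ∈ Set.Ico (0 : ℝ) 1) :
    circleCoord (cexp ((2 * π * y : ℝ) * I)) = y := by
  have hπ := Real.pi_pos
  rw [circleCoord, neg_conj_exp_two_pi_mul_I,
    Complex.arg_cos_add_sin_mul_I ⟨by nlinarith [hy.2], by nlinarith [hy.1]⟩]
  field_simp
  ring

lemma continuousAt_circleCoord {y : ℝ} (hy : y ∈ Set.Ioo (0 : ℝ) 1) :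
    ContinuousAt circleCoord (cexp ((2 * π * y : ℝ) * I)) := by
  have hπ := Real.pi_pos
  have hmem : -(starRingEnd ℂ) (cexp ((2 * π * y : ℝ) * I)) ∈ slitPlane := by
    rw [Complex.mem_slitPlane_iff_arg, neg_conj_exp_two_pi_mul_I,
      Complex.arg_cos_add_sin_mul_I ⟨by nlinarith [hy.2], by nlinarith [hy.1]⟩,
      ← neg_conj_exp_two_pi_mul_I]
    refine ⟨by nlinarith [hy.1], ?_⟩
    simp
  have h1 : ContinuousAt (fun z : ℂ => -(starRingEnd ℂ) z) (cexp ((2 * π * y : ℝ) * I)) :=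
    Complex.continuous_conj.neg.continuousAt
  have h2 := ContinuousAt.comp (f := fun z : ℂ => -(starRingEnd ℂ) z)
    (Complex.continuousAt_arg hmem) h1
  exact continuousAt_const.sub (h2.div_const _)

lemma DenseMod1.of_mem_closure {x : ℕ → ℝ}
    (h : ∀ y ∈ Set.Ioo (0 : ℝ) 1, cexp ((2 * π * y : ℝ) * I) ∈
      closure (Set.range fun k => cexp ((2 * π * x k : ℝ) * I))) :
    DenseMod1 x := by
  rw [DenseMod1, ← closure_Ioo (zero_ne_one (α := ℝ))]
  refine closure_minimal (fun y hy => ?_) isClosed_closure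
  have := (continuousAt_circleCoord hy).continuousWithinAt.mem_closure_image (h y hy)
  rw [circleCoord_exp ⟨hy.1.le, hy.2⟩] at this
  refine closure_mono ?_ this
  rintro _ ⟨_, ⟨k, rfl⟩, rfl⟩
  refine ⟨k, ?_⟩
  dsimp only
  rw [← exp_two_pi_mul_fract_mul_I, circleCoord_exp ⟨Int.fract_nonneg _, Int.fract_lt_one _⟩]

lemma DenseMod1.mapClusterPt {x : ℕ → ℝ} (h : DenseMod1 x) {y : ℝ} (hy : y ∈ Set.Icc (0 : ℝ) 1) :
    MapClusterPt y atTop fun k => Int.fract (x k) := by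
  rw [← closure_Ioo (zero_ne_one (α := ℝ))] at hy
  refine closure_minimal (t := {y | MapClusterPt y atTop fun k => Int.fract (x k)})
    (fun y hy => ?_) isClosed_setOfPred_clusterPt hy
  rw [Set.mem_ofPred_eq, mapClusterPt_iff_frequently]
  intro s hs
  rw [frequently_atTop]
  intro N
  obtain ⟨U, hUs, hU, hyU⟩ := mem_nhds_iff.1 (inter_mem hs (isOpen_Ioo.mem_nhds hy))
  have hfin : ((fun k => Int.fract (x k)) '' Set.Iio N).Finite := (Set.finite_Iio N).image _
  have hinf : (U \ ((fun k => Int.fract (x k)) '' Set.Iio N)).Nonempty :=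
    ((infinite_of_mem_nhds y (hU.mem_nhds hyU)).sdiff hfin).nonempty
  obtain ⟨v, hv⟩ := hinf
  have hvI : v ∈ Set.Icc (0 : ℝ) 1 := Set.Ioo_subset_Icc_self (hUs hv.1).2
  obtain ⟨_, hw, k, rfl⟩ := mem_closure_iff.1 (h hvI) _ (hU.sdiff hfin.isClosed) hv
  refine ⟨k, ?_, (hUs hw.1).1⟩
  by_contra! hk
  exact hw.2 ⟨k, hk, rfl⟩

/-! ### The spiral -/

/-- The parametrisation of the logarithmic spiral `exp (L_α(p))`. -/
noncomputable def spiral (p : ℂ) (α : ℝ) (t : ℝ) : ℂ := cexp (p + (t : ℂ) * (I + (α : ℂ)))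

lemma image_exp_exp_lineThrough (p : ℂ) (α : ℝ) :
    (fun z : ℂ => cexp (cexp z)) '' lineThrough p α
      = Set.range fun t => cexp (spiral p α t) := by
  ext w
  constructor
  · rintro ⟨_, ⟨t, rfl⟩, rfl⟩
    exact ⟨t, rfl⟩
  · rintro ⟨t, rfl⟩
    exact ⟨_, ⟨t, rfl⟩, rfl⟩

lemma spiral_add (p : ℂ) (α t d : ℝ) :
    spiral p α (t + d) = spiral p α t * cexp ((d : ℂ) * (I + α)) := by
  rw [spiral, spiral, ← Complex.exp_add]
  push_cast
  ring_nf

lemma spiral_eq (p : ℂ) (α t : ℝ) :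
    spiral p α t = (rexp (p.re + t * α) : ℝ) * cexp ((p.im + t : ℝ) * I) := by
  rw [spiral, Complex.ofReal_exp, ← Complex.exp_add]
  congr 1
  apply Complex.ext <;> simp

lemma norm_spiral (p : ℂ) (α t : ℝ) : ‖spiral p α t‖ = rexp (p.re + t * α) := by
  rw [spiral_eq, norm_mul, Complex.norm_exp_ofReal_mul_I, mul_one, Complex.norm_real,
    Real.norm_of_nonneg (Real.exp_pos _).le]

lemma spiral_re (p : ℂ) (α t : ℝ) :
    (spiral p α t).re = rexp (p.re + t * α) * Real.cos (p.im + t) := by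
  rw [spiral_eq, Complex.re_ofReal_mul, Complex.exp_ofReal_mul_I_re]

lemma contDiff_spiral (p : ℂ) (α : ℝ) : ContDiff ℝ 1 (spiral p α) := by
  have h : ContDiff ℝ 1 fun t : ℝ => (t : ℂ) := Complex.ofRealCLM.contDiff
  exact (contDiff_const.add (h.mul contDiff_const)).cexp

lemma tendsto_norm_spiral_atTop (p : ℂ) {α : ℝ} (hα : 0 < α) :
    Tendsto (fun t => ‖spiral p α t‖) atTop atTop := by
  simp only [norm_spiral]
  exact Real.tendsto_exp_atTop.comp
    (tendsto_atTop_add_const_left _ _ (tendsto_id.atTop_mul_const hα))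

lemma tendsto_spiral_atBot (p : ℂ) {α : ℝ} (hα : 0 < α) :
    Tendsto (spiral p α) atBot (𝓝 0) := by
  rw [tendsto_zero_iff_norm_tendsto_zero]
  simp only [norm_spiral]
  exact Real.tendsto_exp_atBot.comp
    (tendsto_atBot_add_const_left _ _ (tendsto_id.atBot_mul_const hα))

/-- The parameter of the `k`-th intersection of the spiral with the imaginary axis. -/
noncomputable def crossing (p : ℂ) (k : ℕ) : ℝ := π / 2 - p.im + k * π

lemma spiral_crossing (p : ℂ) (α : ℝ) (k : ℕ) :
    spiral p α (crossing p k) =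
      (2 * π * ((-1) ^ k * rexp (p.re + crossing p k * α) / (2 * π)) : ℝ) * I := by
  have h : p.im + crossing p k = π / 2 + k * π := by rw [crossing]; ring
  rw [spiral_eq, h, Complex.exp_mul_I, ← Complex.ofReal_cos, ← Complex.ofReal_sin,
    Real.cos_add_nat_mul_pi, Real.sin_add_nat_mul_pi, mul_div_cancel₀ _ Real.two_pi_pos.ne']
  simp only [Real.cos_pi_div_two, Real.sin_pi_div_two]
  push_cast
  ring

lemma tendsto_crossing (p : ℂ) : Tendsto (crossing p) atTop atTop :=
  tendsto_atTop_add_const_left _ _ (tendsto_natCast_atTop_atTop.atTop_mul_const Real.pi_pos)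

/-! ### From density of the image to density modulo one -/

/-- Density of the image of the spiral is already witnessed by its unbounded end. -/
lemma mapClusterPt_exp_spiral {p : ℂ} {α : ℝ} (hα : 0 < α)
    (h : Dense (Set.range fun t => cexp (spiral p α t))) {ζ : ℂ} (hζ : ζ ≠ 1) :
    MapClusterPt ζ atTop fun t => cexp (spiral p α t) := by
  rw [mapClusterPt_iff_frequently]
  intro s hs
  rw [frequently_atTop]
  intro T
  have hcd : ContDiff ℝ 1 fun t => cexp (spiral p α t) := (contDiff_spiral p α).cexp
  have hdc := hcd.dense_compl_range_of_finrank_lt_finrank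
    (by rw [Complex.finrank_real_complex, Module.finrank_self]; norm_num)
  obtain ⟨A, B, hA, hB, hζA, h1B, hAB⟩ := t2_separation hζ
  have hbot : Tendsto (fun t => cexp (spiral p α t)) atBot (𝓝 1) := by
    simpa using (tendsto_spiral_atBot p hα).cexp
  obtain ⟨S, hS⟩ := eventually_atBot.1 (hbot.eventually (hB.mem_nhds h1B))
  obtain ⟨V, hVs, hV, hζV⟩ := mem_nhds_iff.1 hs
  obtain ⟨v, hv, hvr⟩ := hdc.inter_open_nonempty (V ∩ A) (hV.inter hA) ⟨ζ, hζV, hζA⟩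
  have hK : IsClosed ((fun t => cexp (spiral p α t)) '' Set.Icc S T) :=
    (isCompact_Icc.image hcd.continuous).isClosed
  obtain ⟨_, hw, t, rfl⟩ := h.inter_open_nonempty _ ((hV.inter hA).sdiff hK)
    ⟨v, hv, fun hv' => hvr (Set.image_subset_range _ _ hv')⟩
  refine ⟨t, ?_, hVs hw.1.1⟩
  by_contra! htT
  rcases le_total t S with hts | hts
  · exact Set.disjoint_left.1 hAB hw.1.2 (hS t hts)
  · exact hw.2 ⟨t, ⟨hts, htT.le⟩, rfl⟩

/-- The index of a crossing nearest to the parameter `t`. -/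
noncomputable def nearestCrossing (p : ℂ) (t : ℝ) : ℕ := ⌊(p.im + t) / π⌋₊

lemma abs_crossing_sub_le {p : ℂ} {t : ℝ} (ht : 0 ≤ p.im + t) :
    |crossing p (nearestCrossing p t) - t| ≤ π / 2 := by
  have hπ := Real.pi_pos
  have h1 := Nat.floor_le (div_nonneg ht hπ.le)
  have h2 := Nat.lt_floor_add_one ((p.im + t) / π)
  rw [le_div_iff₀ hπ] at h1
  rw [div_lt_iff₀ hπ] at h2
  rw [crossing, nearestCrossing, abs_le]
  constructor <;> linarith

lemma norm_spiral_mul_abs_crossing_sub_le {p : ℂ} (α : ℝ) {t : ℝ} (ht : 0 ≤ p.im + t) :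
    ‖spiral p α t‖ * |crossing p (nearestCrossing p t) - t| ≤ π / 2 * |(spiral p α t).re| := by
  have hπ := Real.pi_pos
  set d := crossing p (nearestCrossing p t) - t with hd
  have hcos : |Real.cos (p.im + t)| = |Real.sin d| := by
    have : p.im + t = (π / 2 - d) + nearestCrossing p t * π := by rw [hd, crossing]; ring
    rw [this, Real.cos_add_nat_mul_pi, Real.cos_pi_div_two_sub, abs_mul, abs_pow]
    simp
  rw [spiral_re, norm_spiral, abs_mul, hcos, abs_of_pos (Real.exp_pos _)]
  have h := Real.mul_abs_le_abs_sin (abs_crossing_sub_le ht)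
  have h' : |d| ≤ π / 2 * |Real.sin d| := by
    calc |d| = π / 2 * (2 / π * |d|) := by field_simp
      _ ≤ _ := by gcongr
  calc _ ≤ rexp (p.re + t * α) * (π / 2 * |Real.sin d|) := by gcongr
    _ = _ := by ring

lemma tendsto_spiral_crossing_sub {p : ℂ} {α : ℝ} (hα : 0 < α) {l : Filter ℝ} (hl : l ≤ atTop)
    (hre : Tendsto (fun t => (spiral p α t).re) l (𝓝 0)) :
    Tendsto (fun t => spiral p α (crossing p (nearestCrossing p t)) - spiral p α t) l (𝓝 0) := by
  have hπ := Real.pi_pos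
  have hre' : Tendsto (fun t => π / 2 * |(spiral p α t).re|) l (𝓝 0) := by
    simpa using hre.abs.const_mul (π / 2)
  have hpos : ∀ᶠ t in l, 0 ≤ p.im + t := by
    filter_upwards [hl (eventually_ge_atTop (-p.im))] with t ht
    linarith
  have hbig : ∀ᶠ t in l, 1 ≤ ‖spiral p α t‖ :=
    hl ((tendsto_norm_spiral_atTop p hα).eventually_ge_atTop 1)
  have hd : Tendsto (fun t => crossing p (nearestCrossing p t) - t) l (𝓝 0) := by
    refine squeeze_zero_norm' ?_ hre'
    filter_upwards [hpos, hbig] with t ht h1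
    rw [Real.norm_eq_abs]
    nlinarith [norm_spiral_mul_abs_crossing_sub_le α ht,
      abs_nonneg (crossing p (nearestCrossing p t) - t)]
  have hdc : Tendsto (fun t => ‖((crossing p (nearestCrossing p t) - t : ℝ) : ℂ) * (I + α)‖) l
      (𝓝 0) := by
    have := ((Complex.continuous_ofReal.tendsto 0).comp hd).mul_const (I + (α : ℂ))
    simpa using this.norm
  have hbound : Tendsto (fun t => 2 * ‖I + (α : ℂ)‖ * (π / 2 * |(spiral p α t).re|)) l (𝓝 0) := by
    simpa using hre'.const_mul (2 * ‖I + (α : ℂ)‖)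
  refine squeeze_zero_norm' ?_ hbound
  filter_upwards [hpos, hdc.eventually_le_const zero_lt_one] with t ht h1
  set d := crossing p (nearestCrossing p t) - t with hd
  have heq : crossing p (nearestCrossing p t) = t + d := by rw [hd]; ring
  calc ‖spiral p α (crossing p (nearestCrossing p t)) - spiral p α t‖
      = ‖spiral p α t‖ * ‖cexp ((d : ℂ) * (I + α)) - 1‖ := by
        rw [heq, spiral_add, ← norm_mul, mul_sub, mul_one]
    _ ≤ ‖spiral p α t‖ * (2 * ‖(d : ℂ) * (I + α)‖) := by
        gcongr
        exact Complex.norm_exp_sub_one_le h1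
    _ = 2 * ‖I + (α : ℂ)‖ * (‖spiral p α t‖ * |d|) := by
        rw [norm_mul, Complex.norm_real, Real.norm_eq_abs]
        ring
    _ ≤ _ := mul_le_mul_of_nonneg_left (norm_spiral_mul_abs_crossing_sub_le α ht) (by positivity)

lemma mem_closure_exp_spiral_crossing {p : ℂ} {α : ℝ} (hα : 0 < α) {ζ : ℂ} (hζ : ‖ζ‖ = 1)
    (h : MapClusterPt ζ atTop fun t => cexp (spiral p α t)) :
    ζ ∈ closure (Set.range fun k => cexp (spiral p α (crossing p k))) := by
  obtain ⟨U, hU, hUζ⟩ := mapClusterPt_iff_ultrafilter.1 h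
  have hre : Tendsto (fun t => (spiral p α t).re) U (𝓝 0) := by
    have := hUζ.norm.log (by rw [hζ]; exact one_ne_zero)
    simpa [Complex.norm_exp, hζ] using this
  have hlim := hUζ.mul (tendsto_spiral_crossing_sub hα hU hre).cexp
  simp only [← Complex.exp_add, add_sub_cancel, Complex.exp_zero, mul_one] at hlim
  exact mem_closure_of_tendsto hlim (Eventually.of_forall fun t => ⟨nearestCrossing p t, rfl⟩)

/-! ### From density modulo one to density of the image -/

/-- If `z` goes to infinity then `z (exp (c v / z) - 1)` approaches `v c`. -/
lemma tendsto_mul_exp_sub_one {ι : Type*} {l : Filter ι} {z : ι → ℂ}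
    (hz : Tendsto (fun k => ‖z k‖) l atTop) (v c : ℂ) :
    Tendsto (fun k => z k * (cexp (v / z k * c) - 1)) l (𝓝 (v * c)) := by
  have hinv : Tendsto (fun k => ‖v / z k * c‖) l (𝓝 0) := by
    have : Tendsto (fun k => ‖v‖ / ‖z k‖ * ‖c‖) l (𝓝 0) := by
      simpa using (tendsto_const_nhds.div_atTop hz).mul_const ‖c‖
    simpa only [norm_mul, norm_div] using this
  have hb : Tendsto (fun k => ‖v * c‖ * ‖v / z k * c‖) l (𝓝 0) := by
    simpa using hinv.const_mul ‖v * c‖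
  rw [tendsto_iff_norm_sub_tendsto_zero]
  refine squeeze_zero' (Eventually.of_forall fun _ => norm_nonneg _) ?_ hb
  filter_upwards [hinv.eventually_le_const zero_lt_one, hz.eventually_gt_atTop 0] with k h1 h0
  have hzk : z k ≠ 0 := norm_pos_iff.1 h0
  have hvc : z k * (v / z k * c) = v * c := by field_simp
  calc ‖z k * (cexp (v / z k * c) - 1) - v * c‖
      = ‖z k‖ * ‖cexp (v / z k * c) - 1 - v / z k * c‖ := by
        rw [← norm_mul, mul_sub (z k) _ (v / z k * c), hvc]
    _ ≤ ‖z k‖ * ‖v / z k * c‖ ^ 2 := by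
        gcongr
        exact Complex.norm_exp_sub_one_sub_id_le h1
    _ = ‖z k * (v / z k * c)‖ * ‖v / z k * c‖ := by
        rw [norm_mul (z k)]
        ring
    _ = _ := by rw [hvc]

lemma exists_exp_mul_I_mul_exp_eq {w : ℂ} (hw : w ≠ 0) (α : ℝ) :
    ∃ a : ℝ, ∃ y ∈ Set.Icc (0 : ℝ) 1,
      cexp ((2 * π * y : ℝ) * I) * cexp (-(a * I) * (I + α)) = w := by
  have hπ := Real.pi_pos
  refine ⟨(Complex.log w).re, Int.fract (((Complex.log w).im + (Complex.log w).re * α) / (2 * π)),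
    ⟨Int.fract_nonneg _, (Int.fract_lt_one _).le⟩, ?_⟩
  rw [exp_two_pi_mul_fract_mul_I, mul_div_cancel₀ _ Real.two_pi_pos.ne', ← Complex.exp_add]
  conv_rhs => rw [← Complex.exp_log hw]
  congr 1
  apply Complex.ext <;> simp

lemma dense_exp_spiral {p : ℂ} {α : ℝ} (hα : 0 < α) {x : ℕ → ℝ}
    (hx : ∀ k, spiral p α (crossing p k) = (2 * π * x k : ℝ) * I) (h : DenseMod1 x) :
    Dense (Set.range fun t => cexp (spiral p α t)) := by
  have hz := (tendsto_norm_spiral_atTop p hα).comp (tendsto_crossing p)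
  refine dense_closure.1 ((dense_compl_singleton (0 : ℂ)).mono ?_)
  intro w hw
  obtain ⟨a, y, hy, rfl⟩ := exists_exp_mul_I_mul_exp_eq hw α
  obtain ⟨U, hU, hUy⟩ := mapClusterPt_iff_ultrafilter.1 (h.mapClusterPt hy)
  have h1 : Tendsto (fun k => cexp (spiral p α (crossing p k))) U
      (𝓝 (cexp ((2 * π * y : ℝ) * I))) := by
    have hc : Continuous fun y : ℝ => cexp ((2 * π * y : ℝ) * I) := by fun_prop
    have := (hc.tendsto y).comp hUy
    simpa only [Function.comp_def, exp_two_pi_mul_fract_mul_I, ← hx] using this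
  have h2 := (tendsto_mul_exp_sub_one (hz.mono_left hU) (-(a * I)) (I + α)).cexp
  refine mem_closure_of_tendsto (h1.mul h2) (Eventually.of_forall fun k => ?_)
  have hd : -(a * I) / spiral p α (crossing p k) = ((-a / (2 * π * x k) : ℝ) : ℂ) := by
    rw [hx, ← neg_mul, mul_div_mul_right _ _ I_ne_zero]
    push_cast
    rfl
  refine ⟨crossing p k + -a / (2 * π * x k), ?_⟩
  dsimp only
  rw [hd, ← Complex.exp_add, spiral_add]
  congr 1
  ring

/-- For `α > 0` and `t_k := π/2 − Im p + kπ`, the image of the spiral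
`exp(L_α(p))` under `exp` is dense in `ℂ` if and only if the sequence
`((−1)^k e^{Re p + t_k α} / (2π))_{k ≥ 0}` of spiral intersections with the
imaginary axis, divided by `2πi`, is dense modulo `1`. -/
theorem expexp_dense_iff_intersections_dense_mod_one (p : ℂ) (α : ℝ) (hα : 0 < α)
    (t : ℤ → ℝ) (ht : ∀ k : ℤ, t k = π / 2 - p.im + k * π) :
    closure ((fun z : ℂ => Complex.exp (Complex.exp z)) '' lineThrough p α)
        = Set.univ ↔
      DenseMod1 (fun k : ℕ =>
        (-1 : ℝ) ^ k * Real.exp (p.re + t (k : ℤ) * α) / (2 * π)) := by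
  have htc : ∀ k : ℕ, t k = crossing p k := fun k => by rw [ht, crossing]; push_cast; rfl
  simp only [htc, image_exp_exp_lineThrough, ← dense_iff_closure_eq]
  refine ⟨fun h => DenseMod1.of_mem_closure fun y hy => ?_,
    dense_exp_spiral hα (spiral_crossing p α)⟩
  simp only [← spiral_crossing]
  refine mem_closure_exp_spiral_crossing hα (Complex.norm_exp_ofReal_mul_I _)
    (mapClusterPt_exp_spiral hα h fun h1 => ?_)
  have h0 := circleCoord_exp (y := 0) (by simp)
  rw [mul_zero, Complex.ofReal_zero, zero_mul, Complex.exp_zero, ← h1,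
    circleCoord_exp ⟨hy.1.le, hy.2⟩] at h0
  exact hy.1.ne' h0
end

section
/- Let J ⊆ ℝ be a nondegenerate interval, Y ⊆ J, and μ a Borel measure on ℝ with μ(Y) > 0. Suppose that for each n ≥ 1 there is a finite partition 𝒫_n of J into intervals, each of length at most 2^{−n}, and suppose there are ε ∈ (0,1) and β > 1 such that μ(P) ≤ β·(1+ε)^n·|P| for every n ≥ 1 and every P ∈ 𝒫_n (|P| denoting the length of P). Then the Hausdorff dimension of Y is at least 1 − 2ε. -/
open MeasureTheory

/-- Two points of an order-connected set are at distance at most the length of the set. -/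
lemma Set.OrdConnected.edist_le_volume {P : Set ℝ} (hP : P.OrdConnected) {x y : ℝ}
    (hx : x ∈ P) (hy : y ∈ P) : edist x y ≤ volume P := by
  rw [edist_dist, Real.dist_eq, ← Real.volume_interval, Set.uIcc_comm]
  exact measure_mono (hP.uIcc_subset hx hy)

/-- If a set is finitely partitioned into intervals of length at most `r`, on each of which `μ` has
density at most `C`, then the trace of any set of diameter at most `r` has measure at most
`4 * C * r`. -/
lemma measure_inter_le_of_interval_partition {μ : Measure ℝ} {F : Finset (Set ℝ)} {J U : Set ℝ}
    {C r : ENNReal} (hcover : ⋃₀ (↑F : Set (Set ℝ)) = J)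
    (hdisj : ∀ P ∈ F, ∀ Q ∈ F, P ≠ Q → Disjoint P Q) (hintvl : ∀ P ∈ F, P.OrdConnected)
    (hlen : ∀ P ∈ F, volume P ≤ r) (hmass : ∀ P ∈ F, μ P ≤ C * volume P)
    (hU : Metric.ediam U ≤ r) : μ (U ∩ J) ≤ 4 * C * r := by
  classical
  rcases (U ∩ J).eq_empty_or_nonempty with h | ⟨x, hxU, -⟩
  · simp [h]
  set G := F.filter fun P => (U ∩ P).Nonempty
  have hGF : ∀ {P}, P ∈ G → P ∈ F := fun h => (Finset.mem_filter.1 h).1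
  have hsub : U ∩ J ⊆ ⋃ P ∈ G, P := by
    rintro y ⟨hyU, hyJ⟩
    rw [← hcover] at hyJ
    obtain ⟨P, hP, hyP⟩ := hyJ
    exact Set.mem_biUnion (Finset.mem_filter.2 ⟨hP, y, hyU, hyP⟩ : P ∈ G) hyP
  have hball : ⋃ P ∈ G, P ⊆ Metric.closedEBall x (2 * r) := by
    refine Set.iUnion₂_subset fun P hP z hz => ?_
    obtain ⟨hPF, y, hyU, hyP⟩ := Finset.mem_filter.1 hP
    calc edist z x ≤ edist z y + edist y x := edist_triangle _ _ _
      _ ≤ r + r := add_le_add (((hintvl P hPF).edist_le_volume hz hyP).trans (hlen P hPF))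
          ((Metric.edist_le_ediam_of_mem hyU hxU).trans hU)
      _ = 2 * r := (two_mul r).symm
  calc μ (U ∩ J) ≤ μ (⋃ P ∈ G, P) := measure_mono hsub
    _ ≤ ∑ P ∈ G, μ P := measure_biUnion_finset_le _ _
    _ ≤ ∑ P ∈ G, C * volume P := Finset.sum_le_sum fun P hP => hmass P (hGF hP)
    _ = C * volume (⋃ P ∈ G, P) := by
        rw [← Finset.mul_sum, measure_biUnion_finset
          (fun P hP Q hQ hPQ => hdisj P (hGF hP) Q (hGF hQ) hPQ)
          (fun P hP => (hintvl P (hGF hP)).measurableSet)]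
    _ ≤ C * volume (Metric.closedEBall x (2 * r)) := by gcongr
    _ = 4 * C * r := by rw [Real.volume_closedEBall]; ring

/-- If the measure of every small set is at most a constant multiple of the `s`-th power of its
diameter, then every set of positive measure has Hausdorff dimension at least `s`. -/
lemma le_dimH_of_measure_le_mul_ediam_rpow {X : Type*} [EMetricSpace X] [MeasurableSpace X]
    [BorelSpace X] {ν : Measure X} {Y : Set X} (hY : ν Y ≠ 0) {s : NNReal} {c δ : ENNReal}
    (hc : c ≠ ⊤) (hδ : 0 < δ)
    (h : ∀ U : Set X, Metric.ediam U ≤ δ → ν U ≤ c * Metric.ediam U ^ (s : ℝ)) :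
    (s : ENNReal) ≤ dimH Y := by
  refine le_dimH_of_hausdorffMeasure_ne_zero fun h0 => hY ?_
  have hle : c⁻¹ • ν ≤ μH[s] := Measure.le_hausdorffMeasure _ _ δ hδ fun U hU => by
    rw [Measure.smul_apply, smul_eq_mul, mul_comm, ← div_eq_mul_inv]
    exact ENNReal.div_le_of_le_mul' (h U hU)
  have hYle := (hle Y).trans_eq h0
  rw [Measure.smul_apply, smul_eq_mul, nonpos_iff_eq_zero, mul_eq_zero] at hYle
  exact hYle.resolve_left (ENNReal.inv_ne_zero.2 hc)

lemma one_add_div_two_le_rpow {ε : ℝ} (hε : 0 ≤ ε) :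
    (1 + ε) * 2⁻¹ ≤ (2⁻¹ : ℝ) ^ (1 - 2 * ε) := by
  rw [Real.rpow_sub (by norm_num), Real.rpow_one, Real.rpow_mul (by norm_num), mul_comm,
    div_eq_mul_inv, ← Real.inv_rpow (by positivity)]
  gcongr
  rw [Real.rpow_def_of_pos (by norm_num)]
  have hlog : (1 : ℝ) ≤ Real.log ((2⁻¹ ^ (2 : ℝ))⁻¹) := by
    rw [Real.log_inv, Real.log_rpow (by norm_num), Real.log_inv]
    linarith [Real.log_two_gt_d9]
  nlinarith [Real.add_one_le_exp (Real.log ((2⁻¹ ^ (2 : ℝ) : ℝ)⁻¹) * ε)]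

lemma ofReal_mul_inv_two_pow_le {β ε : ℝ} (hβ : 0 ≤ β) (hε : 0 ≤ ε) (n : ℕ) :
    ENNReal.ofReal (β * (1 + ε) ^ n) * 2⁻¹ ^ n
      ≤ ENNReal.ofReal β * (2⁻¹ ^ n) ^ (1 - 2 * ε) := by
  have h2 : (2⁻¹ : ENNReal) = ENNReal.ofReal 2⁻¹ := by
    rw [ENNReal.ofReal_inv_of_pos two_pos, ENNReal.ofReal_ofNat]
  rw [h2, ← ENNReal.ofReal_pow (by norm_num), ENNReal.ofReal_rpow_of_pos (by positivity),
    ← ENNReal.ofReal_mul (by positivity), ← ENNReal.ofReal_mul hβ, mul_assoc, ← mul_pow,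
    ← Real.rpow_natCast_mul (by norm_num), mul_comm (n : ℝ), Real.rpow_mul_natCast (by norm_num)]
  gcongr
  exact one_add_div_two_le_rpow hε

lemma ENNReal.exists_inv_two_pow_near {d : ENNReal} (h0 : d ≠ 0) (h1 : d ≤ 2⁻¹) :
    ∃ n ≥ 1, d ≤ 2⁻¹ ^ n ∧ (2⁻¹ : ENNReal) ^ n ≤ 2 * d := by
  have hd : d ≠ ⊤ := ne_top_of_le_ne_top (by simp) h1
  lift d to NNReal using hd
  have h1' : d ≤ 2⁻¹ := by
    rw [← ENNReal.coe_le_coe]; simpa using h1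
  have h0' : 0 < d := pos_iff_ne_zero.2 (by simpa using h0)
  obtain ⟨n, hn, hn'⟩ := exists_nat_pow_near_of_lt_one h0' (h1'.trans (by norm_num))
    (y := (2⁻¹ : NNReal)) (by norm_num) (by norm_num)
  refine ⟨n, Nat.one_le_iff_ne_zero.2 ?_, ?_⟩
  · rintro rfl
    exact absurd h1' (not_le.2 (by simpa only [zero_add, pow_one] using hn))
  have hcast : (2⁻¹ : ENNReal) ^ n = ((2⁻¹ ^ n : NNReal) : ENNReal) := by
    rw [ENNReal.coe_pow, ENNReal.coe_inv two_ne_zero, ENNReal.coe_ofNat]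
  rw [hcast]
  constructor
  · exact_mod_cast hn'
  · have hmul : (2⁻¹ : NNReal) ^ n ≤ 2 * d := by
      rw [pow_succ] at hn
      calc (2⁻¹ : NNReal) ^ n = 2 * (2⁻¹ ^ n * 2⁻¹) := by
            rw [mul_comm, mul_assoc, inv_mul_cancel₀ two_ne_zero, mul_one]
        _ ≤ 2 * d := by gcongr
    exact_mod_cast hmul

/-- A quantity bounded by a multiple of `(2⁻ⁿ) ^ s` whenever `d ≤ 2⁻ⁿ` is bounded by a multiple of
`d ^ s`. -/
lemma ENNReal.le_mul_rpow_of_dyadic {a c d : ENNReal} {s : ℝ} (hs : 0 < s) (hc : c ≠ ⊤)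
    (hd : d ≤ 2⁻¹) (h : ∀ n ≥ 1, d ≤ 2⁻¹ ^ n → a ≤ c * (2⁻¹ ^ n) ^ s) :
    a ≤ c * 2 ^ s * d ^ s := by
  rcases eq_or_ne d 0 with rfl | h0
  · have hlim : Filter.Tendsto (fun n : ℕ => c * ((2⁻¹ : ENNReal) ^ n) ^ s) Filter.atTop
        (nhds (c * 0 ^ s)) :=
      ENNReal.Tendsto.const_mul ((ENNReal.continuous_rpow_const.tendsto 0).comp
        (ENNReal.tendsto_pow_atTop_nhds_zero_of_lt_one ENNReal.one_half_lt_one)) (Or.inr hc)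
    have ha := ge_of_tendsto hlim
      (Filter.eventually_atTop.2 ⟨1, fun n hn => h n hn zero_le⟩)
    simpa [ENNReal.zero_rpow_of_pos hs] using ha
  · obtain ⟨n, hn, hdn, hnd⟩ := ENNReal.exists_inv_two_pow_near h0 hd
    calc a ≤ c * (2⁻¹ ^ n) ^ s := h n hn hdn
      _ ≤ c * (2 * d) ^ s := by gcongr
      _ = c * 2 ^ s * d ^ s := by rw [ENNReal.mul_rpow_of_nonneg _ _ hs.le, mul_assoc]

/-- Mass distribution principle: if `Y ⊆ J` carries a measure `μ` with `μ Y > 0`,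
and for each `n ≥ 1` there is a finite partition `part n` of `J` into intervals of
length at most `2⁻ⁿ` on which `μ(P) ≤ β (1+ε)^n |P|`, then `dimH Y ≥ 1 − 2ε`. -/
theorem mass_distribution_dimH_lower_bound
    (J : Set ℝ) (hJ : J.OrdConnected) (hJnd : ∃ x ∈ J, ∃ y ∈ J, x ≠ y)
    (Y : Set ℝ) (hYJ : Y ⊆ J)
    (μ : Measure ℝ) (hμY : 0 < μ Y)
    (ε β : ℝ) (hε : ε ∈ Set.Ioo (0 : ℝ) 1) (hβ : 1 < β)
    (part : ℕ → Finset (Set ℝ))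
    (hcover : ∀ n ≥ 1, ⋃₀ (↑(part n) : Set (Set ℝ)) = J)
    (hdisj : ∀ n ≥ 1, ∀ P ∈ part n, ∀ Q ∈ part n, P ≠ Q → Disjoint P Q)
    (hintvl : ∀ n ≥ 1, ∀ P ∈ part n, P.OrdConnected)
    (hlen : ∀ n ≥ 1, ∀ P ∈ part n, volume P ≤ (2 : ENNReal)⁻¹ ^ n)
    (hmass : ∀ n ≥ 1, ∀ P ∈ part n,
      μ P ≤ ENNReal.ofReal (β * (1 + ε) ^ n) * volume P) :
    ENNReal.ofReal (1 - 2 * ε) ≤ dimH Y := by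
  rcases le_or_gt (1 - 2 * ε) 0 with hs | hs
  · simp [ENNReal.ofReal_of_nonpos hs]
  have hνY : μ.restrict J Y ≠ 0 := by
    rw [Measure.restrict_apply' hJ.measurableSet, Set.inter_eq_left.2 hYJ]
    exact hμY.ne'
  have hcoe : ((1 - 2 * ε).toNNReal : ℝ) = 1 - 2 * ε := Real.coe_toNNReal _ hs.le
  refine le_dimH_of_measure_le_mul_ediam_rpow (s := (1 - 2 * ε).toNNReal) (δ := 2⁻¹)
    (c := 4 * ENNReal.ofReal β * 2 ^ (1 - 2 * ε)) hνY ?_ (by simp) fun U hU => ?_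
  · exact ENNReal.mul_ne_top (ENNReal.mul_ne_top (by simp) ENNReal.ofReal_ne_top)
      (ENNReal.rpow_ne_top_of_nonneg hs.le (by simp))
  rw [hcoe, Measure.restrict_apply' hJ.measurableSet]
  refine ENNReal.le_mul_rpow_of_dyadic hs (ENNReal.mul_ne_top (by simp) ENNReal.ofReal_ne_top) hU
    fun n hn hUn => ?_
  calc μ (U ∩ J) ≤ 4 * ENNReal.ofReal (β * (1 + ε) ^ n) * 2⁻¹ ^ n :=
        measure_inter_le_of_interval_partition (hcover n hn) (hdisj n hn)
          (hintvl n hn) (hlen n hn) (hmass n hn) hUn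
    _ ≤ 4 * ENNReal.ofReal β * (2⁻¹ ^ n) ^ (1 - 2 * ε) := by
        rw [mul_assoc, mul_assoc]
        gcongr 4 * ?_
        exact ofReal_mul_inv_two_pow_le (by linarith) hε.1.le n
end

section
/- Let I be a nonempty open subinterval of the imaginary axis in ℂ, and let Î := ⋃_{k∈ℤ} (2kπi + I) be the union of its 2πi-translates. Suppose Î is disjoint from the open unit ball B(0,1). Let p ∈ ℂ and let Y ⊆ ℝ be a compact set such that exp(L_α(p)) ∩ Î = ∅ for every α ∈ Y. Then there exists a nonempty open set U ⊆ ℂ such that (exp ∘ exp) '' L_α(p) ∩ U = ∅ for every α ∈ Y; in particular, (exp ∘ exp) '' L_α(p) is not dense in ℂ for any α ∈ Y. -/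
open Complex Real

theorem abs_arctan_le_abs (q : ℝ) : |Real.arctan q| ≤ |q| := by
  have nonneg_case : ∀ r : ℝ, 0 ≤ r → Real.arctan r ≤ r := fun r hr => by
    simpa [Real.tan_arctan] using
      Real.le_tan (Real.arctan_nonneg.2 hr) (Real.arctan_lt_pi_div_two r)
  rcases le_total 0 q with hq | hq
  · rw [abs_of_nonneg hq, abs_of_nonneg (Real.arctan_nonneg.2 hq)]
    exact nonneg_case q hq
  · rw [abs_of_nonpos hq, abs_of_nonpos (Real.arctan_le_zero.2 hq), ← Real.arctan_neg]
    exact nonneg_case (-q) (by linarith)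

theorem add_I_mul_exp_arctan_mul (q α : ℝ) :
    ((q : ℂ) + Complex.I) * Complex.exp ((Real.arctan q : ℂ) * (Complex.I + (α : ℂ))) =
      ((√(1 + q ^ 2) * Real.exp (α * Real.arctan q) : ℝ) : ℂ) * Complex.I := by
  have hpos : 0 < √(1 + q ^ 2) := Real.sqrt_pos.2 (by positivity)
  have hsq : √(1 + q ^ 2) ^ 2 = 1 + q ^ 2 := Real.sq_sqrt (by positivity)
  have hrot : ((q : ℂ) + Complex.I) *
      (Real.cos (Real.arctan q) + Real.sin (Real.arctan q) * Complex.I) =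
      (√(1 + q ^ 2) : ℝ) * Complex.I := by
    rw [Real.cos_arctan, Real.sin_arctan]
    apply Complex.ext
    · simp
      ring
    · simp
      field_simp
      linarith
  rw [mul_add, Complex.exp_add, Complex.exp_mul_I, ← Complex.ofReal_cos, ← Complex.ofReal_sin,
    ← mul_assoc, hrot, ← Complex.ofReal_mul, ← Complex.ofReal_exp, mul_comm (Real.arctan q) α]
  push_cast
  ring

/-- Moving a short way along a logarithmic spiral, a point near the imaginary axis and not too
close to `0` reaches a nearby point of the imaginary axis. -/
theorem exists_mul_exp_eq_mul_I {x y α δ M : ℝ} (hy : 1 ≤ |y|) (hx : |x| ≤ δ) (hα : |α| ≤ M)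
    (hδ : δ ≤ 1) (hδM : M * δ ≤ 1) :
    ∃ s y' : ℝ, ((x : ℂ) + y * Complex.I) * Complex.exp ((s : ℂ) * (Complex.I + (α : ℂ))) =
      (y' : ℂ) * Complex.I ∧ |y' - y| ≤ δ * (1 + 4 * M) := by
  have hM : 0 ≤ M := (abs_nonneg α).trans hα
  have hy0 : y ≠ 0 := by
    rintro rfl
    norm_num at hy
  set q := x / y with hq
  have hqx : x = y * q := by rw [hq, mul_div_cancel₀ x hy0]
  have hqy : |y| * |q| ≤ δ := by rw [← abs_mul, ← hqx]; exact hx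
  have hqδ : |q| ≤ δ := (le_mul_of_one_le_left (abs_nonneg q) hy).trans hqy
  refine ⟨Real.arctan q, y * (√(1 + q ^ 2) * Real.exp (α * Real.arctan q)), ?_, ?_⟩
  · have h := add_I_mul_exp_arctan_mul q α
    rw [hqx, Complex.ofReal_mul, Complex.ofReal_mul, ← mul_add, mul_assoc, h, mul_assoc]
  · have hexpo : |α * Real.arctan q| ≤ M * |q| := by
      rw [abs_mul]
      exact mul_le_mul hα (abs_arctan_le_abs q) (abs_nonneg _) hM
    have hexp : |Real.exp (α * Real.arctan q) - 1| ≤ 2 * (M * |q|) :=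
      (Real.abs_exp_sub_one_le (hexpo.trans ((by gcongr : M * |q| ≤ M * δ).trans hδM))).trans
        (by gcongr)
    have hsqrt : √(1 + q ^ 2) ≤ 1 + |q| := by
      rw [Real.sqrt_le_left (by positivity)]
      nlinarith [sq_abs q, abs_nonneg q]
    have hsqrt' : 1 ≤ √(1 + q ^ 2) := Real.one_le_sqrt.2 (by nlinarith)
    have hfactor : |√(1 + q ^ 2) * Real.exp (α * Real.arctan q) - 1| ≤ |q| * (1 + 4 * M) := by
      calc |√(1 + q ^ 2) * Real.exp (α * Real.arctan q) - 1|
          = |√(1 + q ^ 2) * (Real.exp (α * Real.arctan q) - 1) + (√(1 + q ^ 2) - 1)| := by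
            congr 1; ring
        _ ≤ √(1 + q ^ 2) * |Real.exp (α * Real.arctan q) - 1| + (√(1 + q ^ 2) - 1) := by
            refine (abs_add_le _ _).trans_eq ?_
            rw [abs_mul, abs_of_nonneg (Real.sqrt_nonneg _), abs_of_nonneg (sub_nonneg.2 hsqrt')]
        _ ≤ 2 * (2 * (M * |q|)) + |q| := by
            gcongr <;> linarith
        _ = |q| * (1 + 4 * M) := by ring
    calc |y * (√(1 + q ^ 2) * Real.exp (α * Real.arctan q)) - y|
        = |y| * |√(1 + q ^ 2) * Real.exp (α * Real.arctan q) - 1| := by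
          rw [← abs_mul]; congr 1; ring
      _ ≤ |y| * (|q| * (1 + 4 * M)) := by gcongr
      _ = |y| * |q| * (1 + 4 * M) := by ring
      _ ≤ δ * (1 + 4 * M) := by gcongr

theorem exp_mul_exp_mem_exp_image_lineThrough {p z : ℂ} {α : ℝ} (hz : z ∈ lineThrough p α)
    (s : ℝ) : Complex.exp z * Complex.exp ((s : ℂ) * (Complex.I + (α : ℂ))) ∈
      Complex.exp '' lineThrough p α := by
  obtain ⟨t, rfl⟩ := hz
  refine ⟨p + ((t + s : ℝ) : ℂ) * (Complex.I + α), ⟨t + s, rfl⟩, ?_⟩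
  rw [← Complex.exp_add]
  push_cast
  ring_nf

/-- If the spirals `exp(L_α(p))`, `α ∈ Y` (`Y ⊆ ℝ` compact), all avoid the union
`Î` of the `2πi`-translates of an open subinterval `I` of the imaginary axis which
is disjoint from the unit ball, then there is a nonempty open set `U ⊆ ℂ` avoided
by `exp(exp(L_α(p)))` for every `α ∈ Y`; in particular none of these images is
dense. -/
theorem avoid_open_set_of_spiral_avoids_translates
    (c d : ℝ) (hcd : c < d)
    (I : Set ℂ) (hI : I = (fun y : ℝ => (y : ℂ) * Complex.I) '' Set.Ioo c d)
    (Ihat : Set ℂ)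
    (hIhat : Ihat = ⋃ k : ℤ, (fun z : ℂ => 2 * (k : ℂ) * (π : ℂ) * Complex.I + z) '' I)
    (hball : Disjoint Ihat (Metric.ball (0 : ℂ) 1))
    (p : ℂ) (Y : Set ℝ) (hY : IsCompact Y)
    (havoid : ∀ α ∈ Y, (Complex.exp '' lineThrough p α) ∩ Ihat = ∅) :
    ∃ U : Set ℂ, IsOpen U ∧ U.Nonempty ∧
      (∀ α ∈ Y,
        ((fun z : ℂ => Complex.exp (Complex.exp z)) '' lineThrough p α) ∩ U = ∅) ∧
      (∀ α ∈ Y,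
        ¬ Dense ((fun z : ℂ => Complex.exp (Complex.exp z)) '' lineThrough p α)) := by
  have mem_Ihat : ∀ (y : ℝ) (k : ℤ), y - 2 * k * π ∈ Set.Ioo c d →
      (y : ℂ) * Complex.I ∈ Ihat := by
    intro y k hy
    rw [hIhat, hI]
    refine Set.mem_iUnion.2 ⟨k, _, ⟨_, hy, rfl⟩, ?_⟩
    push_cast
    ring
  obtain ⟨M, hM0, hM⟩ : ∃ M : ℝ, 0 ≤ M ∧ ∀ α ∈ Y, |α| ≤ M := by
    obtain ⟨M, hM⟩ := hY.isBounded.exists_norm_le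
    exact ⟨max M 0, le_max_right _ _, fun α hα => (hM α hα).trans (le_max_left _ _)⟩
  set η := (d - c) / 3 with hη
  have hη0 : 0 < η := by rw [hη]; linarith
  obtain ⟨δ, hδ0, hδ1, hδη⟩ : ∃ δ : ℝ, 0 < δ ∧ δ * (1 + 4 * M) ≤ 1 ∧ δ * (1 + 4 * M) ≤ η := by
    refine ⟨min 1 η / (1 + 4 * M), div_pos (lt_min one_pos hη0) (by positivity), ?_, ?_⟩
    · rw [div_mul_cancel₀ _ (by positivity)]
      exact min_le_left _ _
    · rw [div_mul_cancel₀ _ (by positivity)]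
      exact min_le_right _ _
  set V : Set ℂ := Set.Ioo (-δ) δ ×ℂ Set.Ioo (c + η) (d - η) with hV
  have hUopen : IsOpen (Complex.exp '' V) :=
    isOpenMap_exp _ (isOpen_Ioo.reProdIm isOpen_Ioo)
  have hUne : (Complex.exp '' V).Nonempty := by
    refine Set.Nonempty.image _ ⟨⟨0, (c + d) / 2⟩, ?_⟩
    rw [hV, Complex.mem_reProdIm]
    refine ⟨⟨?_, ?_⟩, ⟨?_, ?_⟩⟩ <;> dsimp only <;> linarith
  have hdisj : ∀ α ∈ Y, ((fun z : ℂ => Complex.exp (Complex.exp z)) '' lineThrough p α) ∩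
      (Complex.exp '' V) = ∅ := by
    intro α hα
    rw [Set.eq_empty_iff_forall_notMem]
    rintro _ ⟨⟨z, hz, rfl⟩, v, hv, hvz⟩
    obtain ⟨n, hn⟩ := Complex.exp_eq_exp_iff_exists_int.1 hvz.symm
    rw [hV, Complex.mem_reProdIm] at hv
    obtain ⟨⟨hre₁, hre₂⟩, him₁, him₂⟩ := hv
    set y := v.im + 2 * n * π with hy
    have hw : Complex.exp z = (v.re : ℂ) + (y : ℂ) * Complex.I := by
      rw [hn, hy]
      conv_lhs => rw [← Complex.re_add_im v]
      push_cast
      ring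
    have hy1 : 1 ≤ |y| := by
      by_contra! hlt
      refine Set.disjoint_left.1 hball
        (mem_Ihat y n ⟨by linarith, by linarith⟩) ?_
      simpa using hlt
    obtain ⟨s, y', hs, hyy'⟩ := exists_mul_exp_eq_mul_I hy1 (abs_le.2 ⟨hre₁.le, hre₂.le⟩) (hM α hα)
      (by nlinarith) (by nlinarith)
    have hnear := abs_le.1 (hyy'.trans hδη)
    have hmem := exp_mul_exp_mem_exp_image_lineThrough hz s
    rw [hw, hs] at hmem
    have hmem' : (y' : ℂ) * Complex.I ∈ Ihat := mem_Ihat y' n ⟨by linarith, by linarith⟩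
    exact (havoid α hα).le ⟨hmem, hmem'⟩
  refine ⟨Complex.exp '' V, hUopen, hUne, hdisj, fun α hα hdense => ?_⟩
  have hmeet := hdense.inter_open_nonempty _ hUopen hUne
  rw [Set.inter_comm, hdisj α hα] at hmeet
  exact Set.not_nonempty_empty hmeet
end
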